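/- Let $K$ be a field of characteristic zero, let $n \ge 1$, let $a_1, \ldots, a_n$ be nonzero elements of $K$, and let $H$ be a finitely generated subgroup of the multiplicative group $(K^*)^n$. Then there are only finitely many tuples $(x_1, \ldots, x_n) \in H$ satisfying $a_1 x_1 + \cdots + a_n x_n = 1$ such that the equation is non-degenerate, i.e., $\sum_{i \in I} a_i x_i \neq 0$ for every nonempty subset $I \subseteq \{1, \ldots, n\}$. -/

import Mathlib

section WeightedNorm

variable {σ A : Type*} [CommRing A]

/-- The weighted `ℓ¹` seminorm on polynomials attached to a ring seminorm on the coefficients. -/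
noncomputable def wnorm (N : RingSeminorm A) (ρ : σ → ℝ) (p : MvPolynomial σ A) : ℝ :=
  ∑ s ∈ p.support, N (p.coeff s) * s.prod fun i n => ρ i ^ n

theorem wnorm_eq_sum {N : RingSeminorm A} {ρ : σ → ℝ} (p : MvPolynomial σ A)
    {t : Finset (σ →₀ ℕ)} (ht : p.support ⊆ t) :
    wnorm N ρ p = ∑ s ∈ t, N (p.coeff s) * s.prod fun i n => ρ i ^ n := by
  unfold wnorm
  refine Finset.sum_subset ht fun s _ hs => ?_
  rw [MvPolynomial.notMem_support_iff.1 hs, map_zero, zero_mul]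

theorem wnorm_monomial (N : RingSeminorm A) (ρ : σ → ℝ) (s : σ →₀ ℕ) (c : A) :
    wnorm N ρ (MvPolynomial.monomial s c) = N c * s.prod fun i n => ρ i ^ n := by
  classical
  rw [wnorm_eq_sum _ MvPolynomial.support_monomial_subset, Finset.sum_singleton,
    MvPolynomial.coeff_monomial, if_pos rfl]

theorem wnorm_add_le (N : RingSeminorm A) {ρ : σ → ℝ} (hρ : ∀ i, 0 ≤ ρ i)
    (p q : MvPolynomial σ A) : wnorm N ρ (p + q) ≤ wnorm N ρ p + wnorm N ρ q := by
  classical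
  rw [wnorm_eq_sum (p + q) MvPolynomial.support_add,
    wnorm_eq_sum p Finset.subset_union_left (t := p.support ∪ q.support),
    wnorm_eq_sum q Finset.subset_union_right (t := p.support ∪ q.support),
    ← Finset.sum_add_distrib]
  refine Finset.sum_le_sum fun s _ => ?_
  rw [← add_mul, MvPolynomial.coeff_add]
  exact mul_le_mul_of_nonneg_right (map_add_le_add _ _ _)
    (Finset.prod_nonneg fun i _ => pow_nonneg (hρ i) _)

theorem wnorm_sum_le (N : RingSeminorm A) {ρ : σ → ℝ} (hρ : ∀ i, 0 ≤ ρ i) {ι : Type*}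
    (t : Finset ι) (f : ι → MvPolynomial σ A) :
    wnorm N ρ (∑ i ∈ t, f i) ≤ ∑ i ∈ t, wnorm N ρ (f i) :=
  Finset.le_sum_of_subadditive (wnorm N ρ) (by simp [wnorm])
    (wnorm_add_le N hρ) _ _

theorem wnorm_mul_le (N : RingSeminorm A) {ρ : σ → ℝ} (hρ : ∀ i, 0 ≤ ρ i)
    (p q : MvPolynomial σ A) : wnorm N ρ (p * q) ≤ wnorm N ρ p * wnorm N ρ q := by
  rw [MvPolynomial.mul_def, MvPolynomial.sum_def]
  refine (wnorm_sum_le N hρ _ _).trans ?_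
  rw [wnorm_eq_sum p subset_rfl, Finset.sum_mul]
  refine Finset.sum_le_sum fun s _ => ?_
  rw [MvPolynomial.sum_def]
  refine (wnorm_sum_le N hρ _ _).trans ?_
  rw [wnorm_eq_sum q subset_rfl, Finset.mul_sum]
  refine Finset.sum_le_sum fun t _ => ?_
  rw [wnorm_monomial, Finsupp.prod_add_index' (by simp) (by intros; exact pow_add _ _ _)]
  have h1 : 0 ≤ s.prod fun i n => ρ i ^ n := Finset.prod_nonneg fun i _ => pow_nonneg (hρ i) _
  have h2 : 0 ≤ t.prod fun i n => ρ i ^ n := Finset.prod_nonneg fun i _ => pow_nonneg (hρ i) _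
  calc _ ≤ (N (p.coeff s) * N (q.coeff t)) *
        ((s.prod fun i n => ρ i ^ n) * t.prod fun i n => ρ i ^ n) :=
        mul_le_mul_of_nonneg_right (map_mul_le_mul _ _ _) (by positivity)
    _ = _ := by ring

/-- The weighted `ℓ¹` seminorm as a ring seminorm. -/
noncomputable def wseminorm (N : RingSeminorm A) (ρ : σ → ℝ) (hρ : ∀ i, 0 ≤ ρ i) :
    RingSeminorm (MvPolynomial σ A) where
  toFun := wnorm N ρ
  map_zero' := by simp [wnorm]
  add_le' := wnorm_add_le N hρ
  neg' p := by simp [wnorm, MvPolynomial.support_neg]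
  mul_le' := wnorm_mul_le N hρ

variable (N : RingSeminorm A) (ρ : σ → ℝ) (hρ : ∀ i, 0 ≤ ρ i)

theorem wseminorm_monomial (s : σ →₀ ℕ) (c : A) :
    wseminorm N ρ hρ (MvPolynomial.monomial s c) = N c * s.prod fun i n => ρ i ^ n :=
  wnorm_monomial N ρ s c

theorem wseminorm_C (c : A) : wseminorm N ρ hρ (MvPolynomial.C c) = N c := by
  have := wseminorm_monomial N ρ hρ 0 c
  simpa using this

theorem wseminorm_X (i : σ) : wseminorm N ρ hρ (MvPolynomial.X i) = N 1 * ρ i := by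
  have := wseminorm_monomial N ρ hρ (Finsupp.single i 1) 1
  simpa [MvPolynomial.X] using this

theorem coeff_le_wseminorm (p : MvPolynomial σ A) (s : σ →₀ ℕ) :
    (N (p.coeff s) * s.prod fun i n => ρ i ^ n) ≤ wseminorm N ρ hρ p := by
  classical
  change _ ≤ wnorm N ρ p
  rw [wnorm_eq_sum p (Finset.subset_insert s p.support)]
  exact Finset.single_le_sum (f := fun s => N (p.coeff s) * s.prod fun i n => ρ i ^ n)
    (fun s _ => mul_nonneg (apply_nonneg _ _)
      (Finset.prod_nonneg fun i _ => pow_nonneg (hρ i) _)) (Finset.mem_insert_self _ _)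

theorem wseminorm_le_sum_of_support (p : MvPolynomial σ A) :
    wseminorm N ρ hρ p = ∑ s ∈ p.support, N (p.coeff s) * s.prod fun i n => ρ i ^ n := rfl

end WeightedNorm

theorem RingSeminorm.map_pow_le_pow_of_one {A : Type*} [CommRing A] (N : RingSeminorm A)
    (h1 : N 1 ≤ 1) (x : A) (n : ℕ) : N (x ^ n) ≤ N x ^ n := by
  induction n with
  | zero => simpa
  | succ k ih =>
    rw [pow_succ, pow_succ]
    exact (map_mul_le_mul _ _ _).trans
      (mul_le_mul_of_nonneg_right ih (apply_nonneg _ _))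

theorem RingSeminorm.map_prod_le_prod {A ι : Type*} [CommRing A] (N : RingSeminorm A)
    (h1 : N 1 ≤ 1) (t : Finset ι) (f : ι → A) : N (∏ i ∈ t, f i) ≤ ∏ i ∈ t, N (f i) := by
  classical
  induction t using Finset.induction_on with
  | empty => simpa
  | insert a s ha ih =>
    rw [Finset.prod_insert ha, Finset.prod_insert ha]
    exact (map_mul_le_mul _ _ _).trans
      (mul_le_mul_of_nonneg_left ih (apply_nonneg _ _))

theorem RingSeminorm.map_sum_le_sum {A ι : Type*} [CommRing A] (N : RingSeminorm A)
    (t : Finset ι) (f : ι → A) : N (∑ i ∈ t, f i) ≤ ∑ i ∈ t, N (f i) :=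
  Finset.le_sum_of_subadditive N (map_zero N).le (map_add_le_add N) _ _

/-- A polynomial map is bounded by the seminorm of the polynomial at the sizes of the arguments. -/
theorem RingSeminorm.eval₂_le {σ A B : Type*} [CommRing A] [CommRing B] (M : RingSeminorm A)
    (N : RingSeminorm B) (h1 : N 1 ≤ 1) (φ : A →+* B) (hφ : ∀ a, N (φ a) ≤ M a)
    (x : σ → B) (ρ : σ → ℝ) (hρ : ∀ i, 0 ≤ ρ i) (hx : ∀ i, N (x i) ≤ ρ i)
    (p : MvPolynomial σ A) : N (p.eval₂ φ x) ≤ wseminorm M ρ hρ p := by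
  rw [MvPolynomial.eval₂_eq, wseminorm_le_sum_of_support]
  refine (N.map_sum_le_sum _ _).trans (Finset.sum_le_sum fun s _ => ?_)
  refine (map_mul_le_mul _ _ _).trans
    (mul_le_mul (hφ _) ?_ (apply_nonneg _ _) (apply_nonneg _ _))
  refine (N.map_prod_le_prod h1 _ _).trans (Finset.prod_le_prod (fun _ _ => apply_nonneg _ _) ?_)
  intro i _
  exact (N.map_pow_le_pow_of_one h1 _ _).trans (pow_le_pow_left₀ (apply_nonneg _ _) (hx i) _)

section PolyNorm

open Polynomial

variable {A : Type*} [CommRing A]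

/-- The `ℓ¹` seminorm on univariate polynomials attached to a ring seminorm on coefficients. -/
noncomputable def pnorm (N : RingSeminorm A) (p : A[X]) : ℝ := ∑ n ∈ p.support, N (p.coeff n)

theorem pnorm_eq_sum {N : RingSeminorm A} (p : A[X]) {t : Finset ℕ} (ht : p.support ⊆ t) :
    pnorm N p = ∑ n ∈ t, N (p.coeff n) := by
  refine Finset.sum_subset ht fun s _ hs => ?_
  rw [Polynomial.notMem_support_iff.1 hs, map_zero]

theorem pnorm_monomial (N : RingSeminorm A) (n : ℕ) (c : A) : pnorm N (monomial n c) = N c := by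
  rw [pnorm_eq_sum _ (support_monomial_subset n c), Finset.sum_singleton, coeff_monomial, if_pos rfl]

theorem pnorm_add_le (N : RingSeminorm A) (p q : A[X]) :
    pnorm N (p + q) ≤ pnorm N p + pnorm N q := by
  rw [pnorm_eq_sum (p + q) support_add,
    pnorm_eq_sum p Finset.subset_union_left (t := p.support ∪ q.support),
    pnorm_eq_sum q Finset.subset_union_right (t := p.support ∪ q.support),
    ← Finset.sum_add_distrib]
  refine Finset.sum_le_sum fun s _ => ?_
  rw [coeff_add]
  exact map_add_le_add _ _ _

theorem pnorm_sum_le (N : RingSeminorm A) {ι : Type*} (t : Finset ι) (f : ι → A[X]) :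
    pnorm N (∑ i ∈ t, f i) ≤ ∑ i ∈ t, pnorm N (f i) :=
  Finset.le_sum_of_subadditive (pnorm N) (by simp [pnorm]) (pnorm_add_le N) _ _

theorem pnorm_mul_le (N : RingSeminorm A) (p q : A[X]) :
    pnorm N (p * q) ≤ pnorm N p * pnorm N q := by
  rw [mul_eq_sum_sum]
  refine (pnorm_sum_le N _ _).trans ?_
  rw [pnorm_eq_sum p subset_rfl, Finset.sum_mul]
  refine Finset.sum_le_sum fun s _ => ?_
  rw [Polynomial.sum_def]
  refine (pnorm_sum_le N _ _).trans ?_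
  rw [pnorm_eq_sum q subset_rfl, Finset.mul_sum]
  refine Finset.sum_le_sum fun t _ => ?_
  rw [pnorm_monomial]
  exact map_mul_le_mul _ _ _

/-- The `ℓ¹` seminorm on univariate polynomials as a ring seminorm. -/
noncomputable def pseminorm (N : RingSeminorm A) : RingSeminorm A[X] where
  toFun := pnorm N
  map_zero' := by simp [pnorm]
  add_le' := pnorm_add_le N
  neg' p := by simp [pnorm, support_neg]
  mul_le' := pnorm_mul_le N

theorem pseminorm_eq_sum_support (N : RingSeminorm A) (p : A[X]) :
    pseminorm N p = ∑ n ∈ p.support, N (p.coeff n) := rfl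

theorem pseminorm_eq_sum {N : RingSeminorm A} (p : A[X]) {t : Finset ℕ} (ht : p.support ⊆ t) :
    pseminorm N p = ∑ n ∈ t, N (p.coeff n) := pnorm_eq_sum p ht

theorem pseminorm_monomial (N : RingSeminorm A) (n : ℕ) (c : A) :
    pseminorm N (monomial n c) = N c := pnorm_monomial N n c

theorem pseminorm_one (N : RingSeminorm A) : pseminorm N (1 : A[X]) = N 1 :=
  pnorm_monomial N 0 1

theorem coeff_le_pseminorm (N : RingSeminorm A) (p : A[X]) (n : ℕ) :
    N (p.coeff n) ≤ pseminorm N p := by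
  rw [pseminorm_eq_sum p (Finset.subset_insert n p.support)]
  exact Finset.single_le_sum (f := fun n => N (p.coeff n)) (fun _ _ => apply_nonneg _ _)
    (Finset.mem_insert_self _ _)

/-- The absolute value on `ℤ` as a ring seminorm. -/
noncomputable def intSeminorm : RingSeminorm ℤ where
  toFun x := |(x : ℝ)|
  map_zero' := by simp
  add_le' x y := by push_cast; exact abs_add_le _ _
  neg' x := by push_cast; exact abs_neg _
  mul_le' x y := by push_cast; rw [abs_mul]

theorem intSeminorm_apply (x : ℤ) : intSeminorm x = |(x : ℝ)| := rfl

/-- The `ℓ¹` norm of an integral polynomial in several variables. -/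
noncomputable def lone (σ : Type*) : RingSeminorm (MvPolynomial σ ℤ) :=
  wseminorm intSeminorm (fun _ => 1) (fun _ => zero_le_one)

theorem lone_eq_sum {σ : Type*} (p : MvPolynomial σ ℤ) :
    lone σ p = ∑ s ∈ p.support, |((p.coeff s : ℤ) : ℝ)| := by
  unfold lone
  rw [wseminorm_le_sum_of_support]
  simp [intSeminorm_apply]

theorem lone_one (σ : Type*) : lone σ 1 = 1 := by
  rw [← MvPolynomial.C_1, lone, wseminorm_C, intSeminorm_apply]; simp

theorem coeff_le_lone {σ : Type*} (p : MvPolynomial σ ℤ) (s : σ →₀ ℕ) :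
    |((p.coeff s : ℤ) : ℝ)| ≤ lone σ p := by
  have := coeff_le_wseminorm intSeminorm (fun _ : σ => (1 : ℝ)) (fun _ => zero_le_one) p s
  simpa [intSeminorm_apply, lone] using this

theorem one_le_lone {σ : Type*} {p : MvPolynomial σ ℤ} (hp : p ≠ 0) : 1 ≤ lone σ p := by
  obtain ⟨s, hs⟩ := MvPolynomial.ne_zero_iff.1 hp
  refine le_trans ?_ (coeff_le_lone p s)
  exact_mod_cast Int.one_le_abs hs

end PolyNorm

theorem RingSeminorm.det_le {A n : Type*} [CommRing A] [Fintype n] [DecidableEq n]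
    (N : RingSeminorm A) (h1 : N 1 ≤ 1) {c : ℝ} (M : Matrix n n A)
    (hM : ∀ i j, N (M i j) ≤ c) :
    N M.det ≤ (Fintype.card n).factorial * c ^ Fintype.card n := by
  rw [Matrix.det_apply]
  refine (N.map_sum_le_sum _ _).trans ?_
  have key : ∀ π ∈ (Finset.univ : Finset (Equiv.Perm n)),
      N (Equiv.Perm.sign π • ∏ i, M (π i) i) ≤ c ^ Fintype.card n := by
    intro π _
    have h2 : N (Equiv.Perm.sign π • ∏ i, M (π i) i) = N (∏ i, M (π i) i) := by
      rcases Int.units_eq_one_or (Equiv.Perm.sign π) with h | h <;> rw [h] <;> simp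
    rw [h2]
    refine (N.map_prod_le_prod h1 _ _).trans ?_
    refine (Finset.prod_le_prod (fun _ _ => apply_nonneg _ _)
      (fun i _ => hM (π i) i)).trans (le_of_eq ?_)
    simp
  refine (Finset.sum_le_card_nsmul _ _ _ key).trans (le_of_eq ?_)
  simp [Fintype.card_perm]

section Wronskian

variable {F A J ι : Type*} [Field F] [CommRing A] [IsDomain A] [Algebra F A]

theorem exists_det_ne_zero_of_wronskian_aux (L : Type*) [Field L] [CharZero L] [Algebra A L]
    [IsFractionRing A L] [Fintype ι] [DecidableEq ι]
    (D : (J →₀ ℕ) → A →ₗ[F] A) (δ : J → Derivation F A A)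
    (hδ : ∀ j μ x, δ j (D μ x) = ((μ j + 1 : ℕ) : F) • D (μ + Finsupp.single j 1) x)
    (f : ι → A) (hfull : ∀ a : ι → A, a ≠ 0 → ∃ μ, ∑ l, a l * D μ (f l) ≠ 0) :
    ∃ μ : ι → (J →₀ ℕ), (∀ i, (μ i).degree < Fintype.card ι) ∧
      (Matrix.of fun i l => D (μ i) (f l)).det ≠ 0 := by
  classical
  let al : (ι → A) → ι → L := fun x l => algebraMap A L (x l)
  let c : (J →₀ ℕ) → ι → L := fun μ => al fun l => D μ (f l)
  let T : ℕ → Submodule L (ι → L) := fun s => Submodule.span L (c '' {μ | μ.degree < s})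
  have hcT : ∀ s μ, μ.degree < s → c μ ∈ T s := fun s μ h => Submodule.subset_span ⟨μ, h, rfl⟩
  have hmono : Monotone T := fun s t hst =>
    Submodule.span_mono (Set.image_mono fun μ (h : μ.degree < s) => lt_of_lt_of_le h hst)
  have hal_inj : Function.Injective (algebraMap A L) := IsFractionRing.injective A L
  have hδc : ∀ j μ, (al fun l => δ j (D μ (f l))) =
      ((μ j + 1 : ℕ) : L) • c (μ + Finsupp.single j 1) := by
    intro j μ
    funext l
    simp only [hδ, Algebra.smul_def, c, al, Pi.smul_apply, map_mul]
    simp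
  -- derivatives of members of `T s` lie in `T (s + 1)`
  have hmulal : ∀ (q : A) (x : ι → A), (al fun l => q * x l) = algebraMap A L q • al x := by
    intro q x; funext l; simp [al]
  have haddal : ∀ (x y : ι → A), (al fun l => x l + y l) = al x + al y := by
    intro q x; funext l; simp [al]
  have hleib : ∀ j (q : A) (x : ι → A), (al fun l => δ j (q * x l)) =
      algebraMap A L q • (al fun l => δ j (x l)) + algebraMap A L (δ j q) • al x := by
    intro j q x; funext l; simp [al, Derivation.leibniz, Algebra.smul_def, mul_comm]
  have hder : ∀ s j (x : ι → A), al x ∈ T s → (al fun l => δ j (x l)) ∈ T (s + 1) := by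
    intro s
    have hP : ∀ v ∈ T s, ∃ (q : A) (x : ι → A), q ≠ 0 ∧ algebraMap A L q • v = al x ∧
        ∀ j, (al fun l => δ j (x l)) ∈ T (s + 1) := by
      intro v hv
      induction hv using Submodule.span_induction with
      | mem v hv =>
        obtain ⟨μ, hμ, rfl⟩ := hv
        refine ⟨1, fun l => D μ (f l), one_ne_zero, by simp [c], fun j => ?_⟩
        rw [hδc]
        refine Submodule.smul_mem _ _ (hcT _ _ ?_)
        have : μ.degree < s := hμ
        simp only [map_add, Finsupp.degree_single]
        omega
      | zero => exact ⟨1, 0, one_ne_zero, by funext l; simp [al], fun j => by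
          have : (al fun l => δ j ((0 : ι → A) l)) = 0 := by funext l; simp [al]
          rw [this]; exact Submodule.zero_mem _⟩
      | add v w hv hw ihv ihw =>
        obtain ⟨q, x, hq, hx, hx'⟩ := ihv
        obtain ⟨r, y, hr, hy, hy'⟩ := ihw
        have hxT : al x ∈ T (s + 1) := hx ▸ Submodule.smul_mem _ _ (hmono (Nat.le_succ s) hv)
        have hyT : al y ∈ T (s + 1) := hy ▸ Submodule.smul_mem _ _ (hmono (Nat.le_succ s) hw)
        refine ⟨q * r, fun l => r * x l + q * y l, mul_ne_zero hq hr, ?_, fun j => ?_⟩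
        · rw [haddal, hmulal, hmulal, ← hx, ← hy, smul_add, map_mul, mul_smul, mul_smul,
            smul_comm (algebraMap A L q) (algebraMap A L r) v]
        · simp only [map_add]
          rw [haddal, hleib, hleib]
          exact add_mem (add_mem (Submodule.smul_mem _ _ (hx' j)) (Submodule.smul_mem _ _ hxT))
            (add_mem (Submodule.smul_mem _ _ (hy' j)) (Submodule.smul_mem _ _ hyT))
      | smul a v hv ih =>
        obtain ⟨q, x, hq, hx, hx'⟩ := ih
        have hxT : al x ∈ T (s + 1) := hx ▸ Submodule.smul_mem _ _ (hmono (Nat.le_succ s) hv)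
        obtain ⟨n, d, hd, rfl⟩ := IsFractionRing.div_surjective (A := A) a
        have hd0 : d ≠ 0 := nonZeroDivisors.ne_zero hd
        refine ⟨q * d, fun l => n * x l, mul_ne_zero hq hd0, ?_, fun j => ?_⟩
        · rw [hmulal, ← hx, smul_smul, smul_smul, map_mul]
          congr 1
          have : algebraMap A L d ≠ 0 := by rwa [Ne, map_eq_zero_iff _ hal_inj]
          field_simp
        · rw [hleib]
          exact add_mem (Submodule.smul_mem _ _ (hx' j)) (Submodule.smul_mem _ _ hxT)
    intro j x hx
    obtain ⟨q, y, hq, hy, hy'⟩ := hP _ hx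
    have hxT : al x ∈ T (s + 1) := hmono (Nat.le_succ s) hx
    have hyx : y = fun l => q * x l := by
      funext l
      have := congrFun hy l
      apply hal_inj
      simpa [al] using this.symm
    have h1 := hy' j
    rw [hyx, hleib] at h1
    have h2 := (Submodule.add_mem_iff_left _ (Submodule.smul_mem _ _ hxT)).1 h1
    have hq' : algebraMap A L q ≠ 0 := by rwa [Ne, map_eq_zero_iff _ hal_inj]
    exact (Submodule.smul_mem_iff _ hq').1 h2
  have hstab : ∀ s, T s = T (s + 1) → T (s + 1) = T (s + 2) := by
    intro s hs
    refine le_antisymm (hmono (Nat.le_succ _)) (Submodule.span_le.2 ?_)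
    rintro _ ⟨μ, hμ, rfl⟩
    have hμ' : μ.degree < s + 2 := hμ
    by_cases h0 : μ = 0
    · subst h0
      exact hcT _ _ (by simp)
    obtain ⟨j, hj⟩ : ∃ j, μ j ≠ 0 := by
      by_contra h; push Not at h; exact h0 (Finsupp.ext h)
    obtain ⟨ν, rfl⟩ : ∃ ν, μ = ν + Finsupp.single j 1 :=
      ⟨μ - Finsupp.single j 1, (tsub_add_cancel_of_le (by simpa using Nat.one_le_iff_ne_zero.2 hj)).symm⟩
    have h1 := hder s j (fun l => D ν (f l)) (by
      rw [hs]; refine hcT _ _ ?_; simp only [map_add, Finsupp.degree_single] at hμ'; omega)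
    rw [hδc] at h1
    exact (Submodule.smul_mem_iff _ (Nat.cast_ne_zero.2 (Nat.succ_ne_zero _))).1 h1
  have hchain : ∀ s, T s = T (s + 1) → ∀ r, T (s + r) = T s := by
    intro s hs r
    have : T (s + r) = T s ∧ T (s + r) = T (s + r + 1) := by
      induction r with
      | zero => exact ⟨rfl, hs⟩
      | succ r ih => exact ⟨ih.2.symm.trans ih.1, hstab _ ih.2⟩
    exact this.1
  have hrank : ∀ s, s ≤ Module.finrank L (T s) ∨ ∀ r, T (s + r) = T s := by
    intro s
    induction s with
    | zero => left; exact Nat.zero_le _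
    | succ s ih =>
      rcases ih with h | h
      · by_cases hs : T s = T (s + 1)
        · right
          intro r
          rw [← hs, ← hchain s hs (1 + r), add_assoc]
        · left
          have := Submodule.finrank_lt_finrank_of_lt (lt_of_le_of_ne (hmono (Nat.le_succ s)) hs)
          exact lt_of_le_of_lt h this
      · right
        intro r
        rw [add_assoc, h, h]
  let k := Fintype.card ι
  have htop : T k = ⊤ := by
    rcases hrank k with h | h
    · apply Submodule.eq_top_of_finrank_eq
      apply le_antisymm (Submodule.finrank_le _)
      rw [Module.finrank_fintype_fun_eq_card]
      exact h
    · by_contra hne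
      obtain ⟨φ, hφ0, hφ⟩ := Submodule.exists_le_ker_of_lt_top _ (lt_top_iff_ne_top.2 hne)
      obtain ⟨q, hq⟩ := IsLocalization.exist_integer_multiples_of_finite (nonZeroDivisors A)
        (fun l => φ (Pi.single l 1))
      choose a ha using hq
      have hqL : algebraMap A L q ≠ 0 := by
        rw [Ne, map_eq_zero_iff _ hal_inj]; exact nonZeroDivisors.ne_zero q.2
      have hφe : ∀ v : ι → L, φ v = ∑ l, v l * φ (Pi.single l 1) := by
        intro v
        conv_lhs => rw [pi_eq_sum_univ' v]
        rw [map_sum]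
        refine Finset.sum_congr rfl fun l _ => ?_
        rw [map_smul, smul_eq_mul]
      obtain ⟨μ, hμ⟩ := hfull a (by
        rintro rfl
        apply hφ0
        ext v
        have := ha v
        simp only [Pi.zero_apply, map_zero] at this
        rw [Algebra.smul_def] at this
        simpa [hqL] using this.symm)
      apply hμ
      apply hal_inj
      rw [map_zero, map_sum]
      have h1 : c μ ∈ T k := by
        rw [← h (μ.degree + 1)]
        exact hcT _ _ (by omega)
      have h2 : φ (c μ) = 0 := hφ h1
      rw [hφe] at h2
      have h3 := congrArg (fun z => algebraMap A L q * z) h2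
      simp only [mul_zero] at h3
      rw [← h3, Finset.mul_sum]
      refine Finset.sum_congr rfl fun l _ => ?_
      rw [map_mul, ha, Algebra.smul_def]
      simp only [c, al]
      ring
  obtain ⟨b, hb, hbspan, hbli⟩ := exists_linearIndependent L (c '' {μ | μ.degree < k})
  have hbtop : Submodule.span L b = ⊤ := hbspan.trans htop
  let B := Module.Basis.mk hbli (by rw [Subtype.range_coe, hbtop])
  have : Fintype b := FiniteDimensional.fintypeBasisIndex B
  have hcard : Fintype.card b = Fintype.card ι := by
    rw [← Module.finrank_eq_card_basis B, Module.finrank_fintype_fun_eq_card]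
  let e : ι ≃ b := (Fintype.equivOfCardEq hcard).symm
  have hsel : ∀ i, ∃ μ, μ.degree < k ∧ c μ = e i := by
    intro i
    obtain ⟨μ, hμ, h⟩ := hb (e i).2
    exact ⟨μ, hμ, h⟩
  choose μ hμ hμe using hsel
  refine ⟨μ, hμ, fun hdet => ?_⟩
  have hli : LinearIndependent L (fun i => c (μ i)) := by
    simp only [hμe]
    exact hbli.comp e e.injective
  have h4 : (Matrix.of fun i => c (μ i)).det ≠ 0 := by
    rw [← isUnit_iff_ne_zero, ← Matrix.isUnit_iff_isUnit_det,
      ← Matrix.linearIndependent_rows_iff_isUnit]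
    exact hli
  apply h4
  have h5 := congrArg (algebraMap A L) hdet
  rw [map_zero, RingHom.map_det] at h5
  exact h5

/-- Generalised Wronskian: if the divided-power operators `D μ` separate linear independence of
`f`, then some determinant built from operators of degree less than the number of functions is
nonzero. -/
theorem exists_det_ne_zero_of_wronskian [CharZero F] [Fintype ι] [DecidableEq ι]
    (D : (J →₀ ℕ) → A →ₗ[F] A) (δ : J → Derivation F A A)
    (hδ : ∀ j μ x, δ j (D μ x) = ((μ j + 1 : ℕ) : F) • D (μ + Finsupp.single j 1) x)
    (f : ι → A) (hfull : ∀ a : ι → A, a ≠ 0 → ∃ μ, ∑ l, a l * D μ (f l) ≠ 0) :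
    ∃ μ : ι → (J →₀ ℕ), (∀ i, (μ i).degree < Fintype.card ι) ∧
      (Matrix.of fun i l => D (μ i) (f l)).det ≠ 0 := by
  have hinj : Function.Injective (algebraMap F (FractionRing A)) := (algebraMap F _).injective
  have : CharZero (FractionRing A) := charZero_of_injective_algebraMap hinj
  exact exists_det_ne_zero_of_wronskian_aux (FractionRing A) D δ hδ f hfull

end Wronskian

section Shift

open MvPolynomial

variable {σ R K : Type*} [CommRing R] [CommRing K] [Algebra R K]

/-- Translation of the variables of a polynomial by a point. -/
noncomputable def mvshift (ξ : σ → K) : MvPolynomial σ R →ₐ[R] MvPolynomial σ K :=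
  aeval fun i => X i + C (ξ i)

/-- Divided partial derivatives: the coefficients of the generic translate. -/
noncomputable def hasse (μ : σ →₀ ℕ) : MvPolynomial σ R →ₗ[R] MvPolynomial σ R :=
  ((lcoeff (MvPolynomial σ R) μ).restrictScalars R).comp
    (mvshift (X : σ → MvPolynomial σ R)).toLinearMap

theorem hasse_apply (μ : σ →₀ ℕ) (p : MvPolynomial σ R) :
    hasse μ p = coeff μ (mvshift (X : σ → MvPolynomial σ R) p) := rfl

@[simp] theorem mvshift_X (ξ : σ → K) (i : σ) :
    mvshift ξ (X i : MvPolynomial σ R) = X i + C (ξ i) := aeval_X _ _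

theorem hasse_C [DecidableEq σ] (μ : σ →₀ ℕ) (c : R) :
    hasse μ (C c : MvPolynomial σ R) = if μ = 0 then C c else 0 := by
  rw [hasse_apply, mvshift, aeval_C, IsScalarTower.algebraMap_apply R (MvPolynomial σ R),
    algebraMap_eq, algebraMap_eq, coeff_C]
  simp [eq_comm]

theorem hasse_mul_X [DecidableEq σ] (μ : σ →₀ ℕ) (p : MvPolynomial σ R) (i : σ) :
    hasse μ (p * X i) = hasse μ p * X i +
      if i ∈ μ.support then hasse (μ - Finsupp.single i 1) p else 0 := by
  simp only [hasse_apply, map_mul, mvshift_X, mul_add, coeff_add, coeff_mul_X', mul_comm _ (C (X i)),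
    coeff_C_mul]
  rw [add_comm, mul_comm]

theorem pderiv_hasse (j : σ) (μ : σ →₀ ℕ) (p : MvPolynomial σ R) :
    pderiv j (hasse μ p) = ((μ j + 1 : ℕ) : R) • hasse (μ + Finsupp.single j 1) p := by
  classical
  induction p using MvPolynomial.induction_on generalizing μ with
  | C c =>
    have : μ + Finsupp.single j 1 ≠ 0 := fun h => by simpa using DFunLike.congr_fun h j
    rw [hasse_C, hasse_C, if_neg this]
    split_ifs <;> simp
  | add p q hp hq => rw [map_add, map_add, map_add, smul_add, hp, hq]
  | mul_X p i ih =>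
    rw [hasse_mul_X, hasse_mul_X, map_add, Derivation.leibniz, ih]
    by_cases hij : i = j
    · subst hij
      rw [pderiv_X_self]
      have h1 : i ∈ (μ + Finsupp.single i 1).support := by simp
      rw [if_pos h1, add_tsub_cancel_right]
      by_cases h2 : i ∈ μ.support
      · have h3 : μ - Finsupp.single i 1 + Finsupp.single i 1 = μ :=
          tsub_add_cancel_of_le (by simpa using Nat.one_le_iff_ne_zero.2 (by simpa using h2))
        have h4 : (μ - Finsupp.single i 1 : σ →₀ ℕ) i + 1 = μ i := by
          have := DFunLike.congr_fun h3 i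
          simpa using this
        rw [if_pos h2, ih, h3, h4]
        simp only [smul_eq_mul, Algebra.smul_def, algebraMap_eq, Nat.cast_add, Nat.cast_one,
          map_add, map_one]
        ring
      · rw [if_neg h2]
        have h4 : μ i = 0 := by simpa using h2
        rw [h4]
        simp only [smul_eq_mul, Algebra.smul_def, algebraMap_eq, map_zero]
        simp
        ring
    · rw [pderiv_X_of_ne hij]
      have h1 : i ∈ (μ + Finsupp.single j 1).support ↔ i ∈ μ.support := by
        simp [Ne.symm hij]
      simp only [h1]
      split_ifs with h2
      · rw [ih]
        have h3 : (μ - Finsupp.single i 1 : σ →₀ ℕ) j = μ j := by simp [hij]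
        have h5 : μ - Finsupp.single i 1 + Finsupp.single j 1 =
            μ + Finsupp.single j 1 - Finsupp.single i 1 := by
          ext x
          simp only [Finsupp.coe_add, Finsupp.coe_tsub, Pi.add_apply, Pi.sub_apply,
            Finsupp.single_apply]
          split_ifs <;> grind
        rw [h3, h5]
        simp only [smul_eq_mul, Algebra.smul_def]
        ring
      · simp only [smul_eq_mul, Algebra.smul_def, map_zero]
        ring

end Shift

section Instances

variable {F ι : Type*} [Field F] [CharZero F] [Fintype ι] [DecidableEq ι]

theorem Polynomial.exists_det_hasseDeriv_ne_zero (f : ι → Polynomial F)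
    (hf : LinearIndependent F f) :
    ∃ ν : ι → ℕ, (∀ i, ν i < Fintype.card ι) ∧
      (Matrix.of fun i l => Polynomial.hasseDeriv (ν i) (f l)).det ≠ 0 := by
  obtain ⟨μ, h1, h2⟩ := exists_det_ne_zero_of_wronskian (F := F) (J := Unit)
    (fun μ => Polynomial.hasseDeriv (R := F) (μ ())) (fun _ => Polynomial.derivative')
    (fun j μ x => by
      have := congrArg (fun φ => φ x) (Polynomial.hasseDeriv_comp (R := F) 1 (μ ()))
      simp only [LinearMap.comp_apply, Polynomial.hasseDeriv_one'] at this
      rw [show (Polynomial.derivative' : Derivation F _ _) (Polynomial.hasseDeriv (μ ()) x) =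
        Polynomial.derivative (Polynomial.hasseDeriv (μ ()) x) from rfl]
      simpa [add_comm, Algebra.smul_def, add_mul] using this) f (fun a ha => by
      by_contra! hcon
      obtain ⟨l, hl⟩ := Function.ne_iff.1 ha
      obtain ⟨x, hx⟩ : ∃ x, (a l).eval x ≠ 0 := by
        by_contra! h
        exact hl (Polynomial.funext (by simpa using h))
      have h0 : ∑ l, (a l).eval x • f l = 0 := by
        apply Polynomial.taylor_injective x
        rw [map_zero, map_sum]
        ext n
        have := congrArg (Polynomial.eval x) (hcon (Finsupp.single () n))
        simpa [Polynomial.eval_finsetSum, Polynomial.taylor_coeff] using this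
      exact hx (Fintype.linearIndependent_iff.1 hf _ h0 l))
  refine ⟨fun i => μ i (), fun i => ?_, h2⟩
  have := h1 i
  simpa [Finsupp.degree_eq_sum] using this

theorem MvPolynomial.exists_det_hasse_ne_zero {σ : Type*} (f : ι → MvPolynomial σ F)
    (hf : LinearIndependent F f) :
    ∃ μ : ι → (σ →₀ ℕ), (∀ i, (μ i).degree < Fintype.card ι) ∧
      (Matrix.of fun i l => hasse (μ i) (f l)).det ≠ 0 := by
  refine exists_det_ne_zero_of_wronskian (F := F) hasse (fun j => pderiv j) pderiv_hasse f
    (fun a ha => ?_)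
  by_contra! hcon
  obtain ⟨l, hl⟩ := Function.ne_iff.1 ha
  obtain ⟨x, hx⟩ : ∃ x, eval x (a l) ≠ 0 := by
    by_contra! h
    exact hl (MvPolynomial.funext (by simpa using h))
  have h1 : ∑ l, C (a l) * mvshift (X : σ → MvPolynomial σ F) (f l) = 0 := by
    ext1 μ
    rw [coeff_sum]
    simpa [coeff_C_mul, hasse_apply] using hcon μ
  let ψ : MvPolynomial σ (MvPolynomial σ F) →ₐ[F] MvPolynomial σ F :=
    ((aeval (fun i => X i - C (x i)) : MvPolynomial σ F →ₐ[F] MvPolynomial σ F)).comp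
      (mapAlgHom (aeval x : MvPolynomial σ F →ₐ[F] F))
  have hψ : ∀ p : MvPolynomial σ F, ψ (mvshift (X : σ → MvPolynomial σ F) p) = p := by
    have : ψ.comp (mvshift (X : σ → MvPolynomial σ F)) = AlgHom.id F _ := by
      ext1 i
      simp [ψ]
    exact fun p => DFunLike.congr_fun this p
  have h0 : ∑ l, eval x (a l) • f l = 0 := by
    have := congrArg ψ h1
    rw [map_zero, map_sum] at this
    simp only [map_mul, hψ] at this
    rw [← this]
    refine Finset.sum_congr rfl fun l _ => ?_
    rw [Algebra.smul_def, algebraMap_eq]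
    simp [ψ]
  exact hx (Fintype.linearIndependent_iff.1 hf _ h0 l)

end Instances

section HasseLemmas

open MvPolynomial

variable {σ R K : Type*} [CommRing R] [CommRing K] [Algebra R K]

theorem coeff_hasse_monomial (μ i s : σ →₀ ℕ) (c : R)
    (h : coeff i (hasse μ (monomial s c)) ≠ 0) : s = i + μ := by
  classical
  induction s using Finsupp.induction_linear generalizing μ i c with
  | zero =>
    rw [← C_apply, hasse_C] at h
    split_ifs at h with hμ
    · rw [coeff_C] at h
      split_ifs at h with hi
      · rw [← hi, hμ, add_zero]
      · exact absurd rfl h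
    · exact absurd (coeff_zero i) h
  | add s t hs ht =>
    have : (monomial (s + t) c : MvPolynomial σ R) = monomial s c * monomial t 1 := by
      rw [monomial_mul, mul_one]
    rw [this, hasse_apply, map_mul, coeff_mul, coeff_sum] at h
    obtain ⟨x, hx, hne⟩ := Finset.exists_ne_zero_of_sum_ne_zero h
    rw [coeff_mul] at hne
    obtain ⟨y, hy, hne⟩ := Finset.exists_ne_zero_of_sum_ne_zero hne
    have h1 := hs x.1 y.1 c (left_ne_zero_of_mul hne)
    have h2 := ht x.2 y.2 1 (right_ne_zero_of_mul hne)
    rw [Finset.HasAntidiagonal.mem_antidiagonal] at hx hy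
    rw [h1, h2, ← hx, ← hy]
    abel
  | single a n =>
    induction n generalizing μ i c with
    | zero =>
      rw [Finsupp.single_zero, ← C_apply, hasse_C] at h
      split_ifs at h with hμ
      · rw [coeff_C] at h
        split_ifs at h with hi
        · rw [← hi, hμ, add_zero, Finsupp.single_zero]
        · exact absurd rfl h
      · exact absurd (coeff_zero i) h
    | succ n ih =>
      have : (monomial (Finsupp.single a (n + 1)) c : MvPolynomial σ R) =
          monomial (Finsupp.single a n) c * X a := by
        rw [X, monomial_mul, mul_one, ← Finsupp.single_add]
      rw [this, hasse_mul_X, coeff_add, coeff_mul_X'] at h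
      by_cases h1 : (if a ∈ i.support then
          coeff (i - Finsupp.single a 1) (hasse μ (monomial (Finsupp.single a n) c)) else 0) = 0
      · rw [h1, zero_add] at h
        split_ifs at h with ha
        · have h2 := ih _ _ _ h
          have h3 : μ - Finsupp.single a 1 + Finsupp.single a 1 = μ :=
            tsub_add_cancel_of_le (by simpa using Nat.one_le_iff_ne_zero.2 (by simpa using ha))
          rw [Finsupp.single_add, h2, add_assoc, h3]
        · exact absurd (coeff_zero i) h
      · split_ifs at h1 with ha
        · have h2 := ih _ _ _ h1
          have h3 : i - Finsupp.single a 1 + Finsupp.single a 1 = i :=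
            tsub_add_cancel_of_le (by simpa using Nat.one_le_iff_ne_zero.2 (by simpa using ha))
          rw [Finsupp.single_add, h2, add_right_comm, h3]
        · exact absurd rfl h1

theorem coeff_hasse_eq_zero {μ i : σ →₀ ℕ} {p : MvPolynomial σ R} (h : coeff (i + μ) p = 0) :
    coeff i (hasse μ p) = 0 := by
  classical
  rw [p.as_sum, map_sum, coeff_sum]
  refine Finset.sum_eq_zero fun s _ => ?_
  by_contra hne
  rw [coeff_hasse_monomial _ _ _ _ hne, h] at hne
  simp at hne

theorem hasse_mvshift (ξ : σ → K) (μ : σ →₀ ℕ) (p : MvPolynomial σ R) :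
    hasse μ (mvshift ξ p) = mvshift ξ (hasse μ p) := by
  have key : (mvshift (X : σ → MvPolynomial σ K)).toRingHom.comp
      (mvshift ξ : MvPolynomial σ R →ₐ[R] _).toRingHom =
      (map (mvshift ξ : MvPolynomial σ R →ₐ[R] _).toRingHom).comp
        (mvshift (X : σ → MvPolynomial σ R)).toRingHom := by
    apply MvPolynomial.ringHom_ext
    · intro r
      simp [mvshift, IsScalarTower.algebraMap_apply R (MvPolynomial σ R), algebraMap_eq,
        IsScalarTower.algebraMap_apply R K (MvPolynomial σ K)]
    · intro i
      simp [mvshift, add_assoc, add_comm (X i), algebraMap_eq]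
  have := congrArg (coeff μ) (DFunLike.congr_fun key p)
  rw [hasse_apply, hasse_apply]
  simpa [coeff_map] using this

theorem lone_hasse_le [Fintype σ] (μ : σ →₀ ℕ) (p : MvPolynomial σ ℤ) (d : σ → ℕ)
    (hd : ∀ i, degreeOf i p ≤ d i) : lone σ (hasse μ p) ≤ 2 ^ (∑ i, d i) * lone σ p := by
  let N2 : RingSeminorm (MvPolynomial σ (MvPolynomial σ ℤ)) :=
    wseminorm (lone σ) (fun _ => 1) (fun _ => zero_le_one)
  have h1 : lone σ (hasse μ p) ≤ N2 (mvshift X p) := by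
    rw [hasse_apply]
    have := coeff_le_wseminorm (lone σ) (fun _ => 1) (fun _ => zero_le_one)
      (mvshift (X : σ → MvPolynomial σ ℤ) p) μ
    simpa using this
  have hN1 : N2 1 = 1 := by rw [← C_1, wseminorm_C, lone_one]
  have hloneX : ∀ i, lone σ (X i) = 1 := fun i => by
    rw [lone, wseminorm_X, intSeminorm_apply]; simp
  have h2 : N2 (mvshift X p) ≤ wseminorm intSeminorm (fun _ => 2) (fun _ => zero_le_two) p := by
    rw [mvshift, aeval_def]
    refine RingSeminorm.eval₂_le _ _ hN1.le _ (fun a => ?_) _ _ _ (fun i => ?_) p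
    · rw [IsScalarTower.algebraMap_apply ℤ (MvPolynomial σ ℤ), algebraMap_eq, algebraMap_eq,
        wseminorm_C, lone, wseminorm_C]
    · refine (map_add_le_add _ _ _).trans ?_
      rw [wseminorm_X, wseminorm_C, lone_one, hloneX]
      norm_num
  refine h1.trans (h2.trans ?_)
  rw [wseminorm_le_sum_of_support, lone_eq_sum, Finset.mul_sum]
  refine Finset.sum_le_sum fun s hs => ?_
  rw [mul_comm, intSeminorm_apply]
  refine mul_le_mul_of_nonneg_right ?_ (abs_nonneg _)
  rw [Finsupp.prod_fintype _ _ (by simp), Finset.prod_pow_eq_pow_sum]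
  refine pow_le_pow_right₀ one_le_two (Finset.sum_le_sum fun i _ => ?_)
  exact (monomial_le_degreeOf i hs).trans (hd i)

end HasseLemmas

section Low

variable {m : ℕ} {A : Type*} [CommRing A]

/-- The weight of a multi-index with respect to degrees `d`. -/
noncomputable def wt {m : ℕ} (d : Fin m → ℕ) (s : Fin m →₀ ℕ) : ℝ := ∑ k, (s k : ℝ) / d k

theorem wt_add (d : Fin m → ℕ) (s t : Fin m →₀ ℕ) : wt d (s + t) = wt d s + wt d t := by
  simp [wt, add_div, Finset.sum_add_distrib]

theorem wt_nonneg (d : Fin m → ℕ) (s : Fin m →₀ ℕ) : 0 ≤ wt d s :=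
  Finset.sum_nonneg fun _ _ => by positivity

/-- Polynomials all of whose coefficients of weight less than `t` vanish. -/
def IsLow (d₀ : ℕ) (d : Fin m → ℕ) (t : ℝ) (R : Polynomial (MvPolynomial (Fin m) A)) : Prop :=
  ∀ (n : ℕ) i, (n : ℝ) / d₀ + wt d i < t → (R.coeff n).coeff i = 0

theorem IsLow.mono {d₀ : ℕ} {d : Fin m → ℕ} {t t' : ℝ}
    {R : Polynomial (MvPolynomial (Fin m) A)} (h : IsLow d₀ d t R) (ht : t' ≤ t) :
    IsLow d₀ d t' R := fun n i hi => h n i (hi.trans_le ht)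

theorem isLow_of_nonpos {d₀ : ℕ} {d : Fin m → ℕ} {t : ℝ} (ht : t ≤ 0)
    (R : Polynomial (MvPolynomial (Fin m) A)) : IsLow d₀ d t R := fun n i hi =>
  absurd (hi.trans_le ht) (not_lt.2 (add_nonneg (by positivity) (wt_nonneg _ _)))

theorem IsLow.mul {d₀ : ℕ} {d : Fin m → ℕ} {t t' : ℝ}
    {R R' : Polynomial (MvPolynomial (Fin m) A)} (h : IsLow d₀ d t R) (h' : IsLow d₀ d t' R') :
    IsLow d₀ d (t + t') (R * R') := by
  classical
  intro n i hi
  rw [Polynomial.coeff_mul, MvPolynomial.coeff_sum]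
  refine Finset.sum_eq_zero fun x hx => ?_
  rw [MvPolynomial.coeff_mul]
  refine Finset.sum_eq_zero fun y hy => ?_
  rw [Finset.HasAntidiagonal.mem_antidiagonal] at hx hy
  rw [← hx, ← hy, wt_add, Nat.cast_add, add_div] at hi
  by_cases h1 : (x.1 : ℝ) / d₀ + wt d y.1 < t
  · rw [h _ _ h1, zero_mul]
  · rw [h' x.2 y.2 (by linarith), mul_zero]

theorem IsLow.prod {d₀ : ℕ} {d : Fin m → ℕ} {κ : Type*} (s : Finset κ) (t : κ → ℝ)
    (R : κ → Polynomial (MvPolynomial (Fin m) A)) (h : ∀ i ∈ s, IsLow d₀ d (t i) (R i)) :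
    IsLow d₀ d (∑ i ∈ s, t i) (∏ i ∈ s, R i) := by
  classical
  induction s using Finset.induction_on with
  | empty => exact isLow_of_nonpos (by simp) _
  | insert a s ha ih =>
    rw [Finset.sum_insert ha, Finset.prod_insert ha]
    exact (h a (Finset.mem_insert_self _ _)).mul
      (ih fun i hi => h i (Finset.mem_insert_of_mem hi))

theorem IsLow.det {d₀ : ℕ} {d : Fin m → ℕ} {κ : Type*} [Fintype κ] [DecidableEq κ] (t : κ → ℝ)
    (M : Matrix κ κ (Polynomial (MvPolynomial (Fin m) A)))
    (h : ∀ i j, IsLow d₀ d (t i) (M i j)) : IsLow d₀ d (∑ i, t i) M.det := by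
  intro n i hi
  rw [Matrix.det_apply, Polynomial.finsetSum_coeff, MvPolynomial.coeff_sum]
  refine Finset.sum_eq_zero fun π _ => ?_
  have h1 : IsLow d₀ d (∑ j, t (π j)) (∏ j, M (π j) j) :=
    IsLow.prod _ _ _ fun j _ => h _ _
  rw [Equiv.sum_comp π t] at h1
  have h2 := h1 n i hi
  rcases Int.units_eq_one_or (Equiv.Perm.sign π) with h | h <;> rw [h] <;> simp [h2]

theorem sum_max_ge {k d₀ : ℕ} (hk : k ≤ 2 * d₀) {τ : ℝ} (hτ0 : 0 < τ)
    (hτ1 : τ ≤ 1) : k * τ ^ 2 / 8 ≤ ∑ ν ∈ Finset.range k, max 0 (τ - (ν : ℝ) / d₀) := by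
  rcases Nat.eq_zero_or_pos k with rfl | hk0
  · simp
  have hd0 : (0 : ℝ) < d₀ := by
    have : 0 < d₀ := by omega
    exact_mod_cast this
  have hk' : (k : ℝ) ≤ 2 * d₀ := by exact_mod_cast hk
  have hk0' : (0 : ℝ) < k := by exact_mod_cast hk0
  let r := ⌊(k : ℝ) * τ / 4⌋₊
  have hr1 : (r : ℝ) ≤ k * τ / 4 := Nat.floor_le (by positivity)
  have hr2 : (k : ℝ) * τ / 4 < r + 1 := Nat.lt_floor_add_one _
  have hrk : r + 1 ≤ k := by
    have : (r : ℝ) < k := by nlinarith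
    exact_mod_cast this
  calc (k : ℝ) * τ ^ 2 / 8 = (k * τ / 4) * (τ / 2) := by ring
    _ ≤ ((r + 1 : ℕ) : ℝ) * (τ / 2) := by push_cast; gcongr
    _ = ∑ ν ∈ Finset.range (r + 1), τ / 2 := by simp
    _ ≤ ∑ ν ∈ Finset.range (r + 1), max 0 (τ - (ν : ℝ) / d₀) := by
      refine Finset.sum_le_sum fun ν hν => le_max_of_le_right ?_
      have h1 : (ν : ℝ) ≤ r := by
        exact_mod_cast Nat.lt_succ_iff.1 (Finset.mem_range.1 hν)
      have h2 : (ν : ℝ) / d₀ ≤ τ / 2 := by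
        rw [div_le_iff₀ hd0]
        nlinarith
      linarith
    _ ≤ _ := Finset.sum_le_sum_of_subset_of_nonneg (Finset.range_mono hrk)
      fun _ _ _ => le_max_left _ _

end Low

section Entries

open MvPolynomial

variable {σ R S K : Type*} [CommRing R] [CommRing S] [CommRing K] [Algebra R K]

/-- Mixed divided derivative of `∑ s ≤ d₀, q s * X ^ s`. -/
noncomputable def mixedDeriv (d₀ ν : ℕ) (μ : σ →₀ ℕ) (q : ℕ → MvPolynomial σ R) :
    Polynomial (MvPolynomial σ R) :=
  ∑ s ∈ Finset.range (d₀ + 1), Polynomial.monomial (s - ν) ((s.choose ν : ℕ) * hasse μ (q s))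

/-- Translation by a point in the distinguished variable and in the coefficients. -/
noncomputable def bishift (ξ₀ : K) (ξ : σ → K) :
    Polynomial (MvPolynomial σ R) →+* Polynomial (MvPolynomial σ K) :=
  Polynomial.eval₂RingHom (Polynomial.C.comp (mvshift ξ : MvPolynomial σ R →ₐ[R] _).toRingHom)
    (Polynomial.X + Polynomial.C (C ξ₀))

theorem bishift_monomial (ξ₀ : K) (ξ : σ → K) (n : ℕ) (p : MvPolynomial σ R) :
    bishift ξ₀ ξ (Polynomial.monomial n p) =
      Polynomial.C (mvshift ξ p) * (Polynomial.X + Polynomial.C (C ξ₀)) ^ n := by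
  simp [bishift]

theorem coeff_bishift_mixedDeriv (ξ₀ : K) (ξ : σ → K) (d₀ ν : ℕ) (μ : σ →₀ ℕ)
    (q : ℕ → MvPolynomial σ R) (n : ℕ) :
    (bishift ξ₀ ξ (mixedDeriv d₀ ν μ q)).coeff n = ((n + ν).choose ν : ℕ) * hasse μ
      ((bishift ξ₀ ξ (∑ s ∈ Finset.range (d₀ + 1), Polynomial.monomial s (q s))).coeff (n + ν)) := by
  unfold mixedDeriv
  simp only [map_sum, Polynomial.finsetSum_coeff, bishift_monomial, Polynomial.coeff_C_mul,
    Polynomial.coeff_X_add_C_pow, Finset.mul_sum, map_mul, map_natCast,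
    mul_assoc, Polynomial.coeff_natCast_mul]
  refine Finset.sum_congr rfl fun s _ => ?_
  have h1 : (mvshift ξ (q s) * (C ξ₀ ^ (s - (n + ν)) * ((s.choose (n + ν) : ℕ) : MvPolynomial σ K)))
      = (ξ₀ ^ (s - (n + ν)) * ((s.choose (n + ν) : ℕ) : K)) • mvshift ξ (q s) := by
    rw [Algebra.smul_def, algebraMap_eq]
    simp [mul_comm]
  rw [h1, map_smul, ← hasse_mvshift, Algebra.smul_def, algebraMap_eq]
  rcases le_or_gt (n + ν) s with h | h
  · have h2 : s.choose ν * (s - ν).choose n = s.choose (n + ν) * (n + ν).choose ν := by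
      have := Nat.choose_mul (n := s) (k := n + ν) (s := ν) (Nat.le_add_left ν n)
      rw [Nat.add_sub_cancel] at this
      exact this.symm
    have h2' : ((s.choose ν : ℕ) : MvPolynomial σ K) * ((s - ν).choose n : ℕ) =
      (s.choose (n + ν) : ℕ) * ((n + ν).choose ν : ℕ) := by exact_mod_cast congrArg _ h2
    have h3 : s - ν - n = s - (n + ν) := by omega
    rw [h3]
    simp only [map_mul, map_pow, map_natCast]
    linear_combination (hasse μ (mvshift ξ (q s)) * C ξ₀ ^ (s - (n + ν))) * h2'
  · rw [Nat.choose_eq_zero_of_lt h]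
    rcases le_or_gt ν s with h' | h'
    · rw [Nat.choose_eq_zero_of_lt (show s - ν < n by omega)]
      simp
    · rw [Nat.choose_eq_zero_of_lt h']
      simp

theorem isLow_bishift_mixedDeriv {m : ℕ} {d₀ : ℕ} {d : Fin m → ℕ} {t : ℝ} (ξ₀ : K)
    (ξ : Fin m → K) (ν : ℕ) (μ : Fin m →₀ ℕ) (q : ℕ → MvPolynomial (Fin m) R)
    (h : IsLow d₀ d t (bishift ξ₀ ξ (∑ s ∈ Finset.range (d₀ + 1), Polynomial.monomial s (q s)))) :
    IsLow d₀ d (t - (ν : ℝ) / d₀ - wt d μ) (bishift ξ₀ ξ (mixedDeriv d₀ ν μ q)) := by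
  intro n i hi
  rw [coeff_bishift_mixedDeriv, ← map_natCast (C (σ := Fin m) (R := K)), coeff_C_mul,
    coeff_hasse_eq_zero, mul_zero]
  apply h
  rw [wt_add, Nat.cast_add, add_div]
  linarith

theorem pseminorm_mixedDeriv_le [Fintype σ] (d₀ ν : ℕ) (μ : σ →₀ ℕ) (q : ℕ → MvPolynomial σ ℤ)
    (d : σ → ℕ) (hd : ∀ s i, degreeOf i (q s) ≤ d i) :
    pseminorm (lone σ) (mixedDeriv d₀ ν μ q) ≤
      2 ^ (d₀ + ∑ i, d i) * ∑ s ∈ Finset.range (d₀ + 1), lone σ (q s) := by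
  unfold mixedDeriv
  refine (RingSeminorm.map_sum_le_sum _ _ _).trans ?_
  rw [Finset.mul_sum]
  refine Finset.sum_le_sum fun s hs => ?_
  rw [pseminorm_monomial]
  have h1 : lone σ ((s.choose ν : ℕ) : MvPolynomial σ ℤ) ≤ 2 ^ d₀ := by
    rw [← map_natCast (C (σ := σ) (R := ℤ)), lone, wseminorm_C, intSeminorm_apply]
    have : s.choose ν ≤ 2 ^ d₀ := (Nat.choose_le_two_pow s ν).trans
      (Nat.pow_le_pow_right two_pos (Nat.lt_succ_iff.1 (Finset.mem_range.1 hs)))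
    simp only [Int.cast_natCast, Nat.abs_cast]
    exact_mod_cast this
  refine (map_mul_le_mul _ _ _).trans ?_
  rw [pow_add, mul_assoc]
  exact mul_le_mul h1 (lone_hasse_le _ _ d (hd s)) (apply_nonneg _ _) (by positivity)

theorem map_mixedDeriv (φ : R →+* S) (d₀ ν : ℕ) (μ : σ →₀ ℕ) (q : ℕ → MvPolynomial σ R)
    (hφ : ∀ p : MvPolynomial σ R, hasse μ (map φ p) = map φ (hasse μ p)) :
    (mixedDeriv d₀ ν μ q).map (map φ) = mixedDeriv d₀ ν μ fun s => map φ (q s) := by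
  simp [mixedDeriv, Polynomial.map_sum, hφ]

theorem hasse_map (φ : R →+* S) (μ : σ →₀ ℕ) (p : MvPolynomial σ R) :
    hasse μ (map φ p) = map φ (hasse μ p) := by
  have key : (mvshift (X : σ → MvPolynomial σ S)).toRingHom.comp (map φ) =
      (map (map φ)).comp (mvshift (X : σ → MvPolynomial σ R)).toRingHom := by
    apply MvPolynomial.ringHom_ext
    · intro r
      simp [mvshift, IsScalarTower.algebraMap_apply R (MvPolynomial σ R), algebraMap_eq,
        IsScalarTower.algebraMap_apply S (MvPolynomial σ S)]
    · intro i
      simp [mvshift]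
  have := congrArg (coeff μ) (DFunLike.congr_fun key p)
  rw [hasse_apply, hasse_apply]
  simpa [coeff_map] using this

/-- Rank factorisation of a polynomial in separated variables, with its generalised Wronskian. -/
theorem exists_mixedDeriv_det_factor (d₀ : ℕ) (q : ℕ → MvPolynomial σ ℤ)
    (hq : ∃ s < d₀ + 1, q s ≠ 0) :
    ∃ (k : ℕ) (ν : Fin k → ℕ) (μ : Fin k → σ →₀ ℕ) (s : Fin k → ℕ) (U : Polynomial ℚ),
      0 < k ∧ k ≤ d₀ + 1 ∧ (∀ i, ν i < k) ∧ Function.Injective ν ∧ (∀ i, (μ i).degree < k) ∧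
      (∀ i, s i < d₀ + 1) ∧ U ≠ 0 ∧ (Matrix.of fun i j => hasse (μ i) (q (s j))).det ≠ 0 ∧
      ((Matrix.of fun i j => mixedDeriv d₀ (ν i) (μ j) q).det).map (map (Int.castRingHom ℚ)) =
        U.map C * Polynomial.C
          (map (Int.castRingHom ℚ) (Matrix.of fun i j => hasse (μ i) (q (s j))).det) := by
  classical
  let qQ : Fin (d₀ + 1) → MvPolynomial σ ℚ := fun s => map (Int.castRingHom ℚ) (q s)
  obtain ⟨κ, a, hainj, haspan, hali⟩ := exists_linearIndependent' ℚ qQ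
  have hκ : Fintype κ := Fintype.ofInjective a hainj
  let e := Fintype.equivFin κ
  set k := Fintype.card κ with hk
  let b : Fin k → Fin (d₀ + 1) := fun i => a (e.symm i)
  have hbinj : Function.Injective b := hainj.comp e.symm.injective
  have hbli : LinearIndependent ℚ (fun i => qQ (b i)) := hali.comp _ e.symm.injective
  have hbspan : ∀ s, ∃ c : Fin k → ℚ, qQ s = ∑ l, c l • qQ (b l) := by
    intro s
    have h1 : qQ s ∈ Submodule.span ℚ (Set.range fun i => qQ (b i)) := by
      have h2 : Set.range (fun i => qQ (b i)) = Set.range (qQ ∘ a) := by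
        ext x
        constructor
        · rintro ⟨i, rfl⟩; exact ⟨e.symm i, rfl⟩
        · rintro ⟨i, rfl⟩; exact ⟨e i, by simp [b]⟩
      rw [h2, haspan]
      exact Submodule.subset_span ⟨s, rfl⟩
    obtain ⟨c, hc⟩ := (Submodule.mem_span_range_iff_exists_fun ℚ).1 h1
    exact ⟨c, hc.symm⟩
  choose α hα using hbspan
  have hαδ : ∀ l l', α (b l') l = if l = l' then 1 else 0 := by
    intro l l'
    have h1 : ∑ l, (α (b l') l - if l = l' then 1 else 0) • qQ (b l) = 0 := by
      simp only [sub_smul, Finset.sum_sub_distrib, ← hα, ite_smul, one_smul, zero_smul]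
      simp
    exact sub_eq_zero.1 (Fintype.linearIndependent_iff.1 hbli _ h1 l)
  let f : Fin k → Polynomial ℚ := fun l => ∑ s : Fin (d₀ + 1), Polynomial.monomial (s : ℕ) (α s l)
  have hfli : LinearIndependent ℚ f := by
    rw [Fintype.linearIndependent_iff]
    intro c hc l
    have h1 := congrArg (fun p => Polynomial.coeff p (b l)) hc
    simp only [f, Polynomial.finsetSum_coeff, Polynomial.coeff_smul, Polynomial.coeff_monomial,
      Polynomial.coeff_zero, smul_eq_mul, Fin.val_inj, Finset.sum_ite_eq', Finset.mem_univ,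
      if_true, hαδ] at h1
    simpa using h1
  obtain ⟨ν, hν, hνdet⟩ := Polynomial.exists_det_hasseDeriv_ne_zero f hfli
  obtain ⟨μ, hμ, hμdet⟩ := MvPolynomial.exists_det_hasse_ne_zero _ hbli
  rw [Fintype.card_fin] at hν hμ
  have hV : map (Int.castRingHom ℚ) (Matrix.of fun i j => hasse (μ i) (q (b j))).det =
      (Matrix.of fun i j => hasse (μ i) (qQ (b j))).det := by
    rw [RingHom.map_det]
    congr 1
    ext i j : 1
    simp [qQ, hasse_map]
  refine ⟨k, ν, μ, fun i => b i, _, ?_, ?_, hν, ?_, hμ, fun i => (b i).2, hνdet, ?_, ?_⟩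
  · rw [hk, Fintype.card_pos_iff]
    by_contra hemp
    rw [not_nonempty_iff] at hemp
    obtain ⟨s, hs, hne⟩ := hq
    have h1 := hα ⟨s, hs⟩
    have : IsEmpty (Fin k) := ⟨fun i => hemp.elim (e.symm i)⟩
    rw [Finset.univ_eq_empty, Finset.sum_empty] at h1
    exact hne (map_injective _ Int.cast_injective (by simpa [qQ] using h1))
  · have := Fintype.card_le_of_injective b hbinj
    simpa using this
  · intro i j hij
    by_contra hne
    exact hνdet (Matrix.det_zero_of_row_eq hne (by ext l : 1; simp [hij]))
  · intro h0
    rw [h0, map_zero] at hV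
    exact hμdet hV.symm
  · rw [hV, ← Polynomial.coe_mapRingHom, RingHom.map_det, ← Matrix.det_transpose
      (Matrix.of fun i j => hasse (μ i) (qQ (b j))), RingHom.map_det, ← Polynomial.coe_mapRingHom,
      RingHom.map_det, ← Matrix.det_mul]
    congr 1
    ext i j : 1
    simp only [RingHom.mapMatrix_apply, Matrix.map_apply, Matrix.of_apply, Matrix.mul_apply,
      Matrix.transpose_apply, Polynomial.coe_mapRingHom]
    rw [map_mixedDeriv _ _ _ _ _ (fun p => hasse_map _ _ p), mixedDeriv, Finset.sum_range]
    simp only [f, map_sum, Polynomial.hasseDeriv_monomial, Polynomial.map_sum,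
      Polynomial.map_monomial, Finset.sum_mul]
    rw [Finset.sum_comm]
    refine Finset.sum_congr rfl fun s _ => ?_
    have h1 : map (Int.castRingHom ℚ) (q s) = ∑ l, α s l • qQ (b l) := hα s
    rw [h1, map_sum, Finset.mul_sum, map_sum]
    refine Finset.sum_congr rfl fun l _ => ?_
    rw [Polynomial.monomial_mul_C, map_smul, Algebra.smul_def, algebraMap_eq, C_mul]
    simp only [C_eq_coe_nat, mul_assoc]

end Entries

section Roth

open MvPolynomial

/-- The `ℓ¹` norm of an integral polynomial in one variable. -/
noncomputable abbrev lonep : RingSeminorm (Polynomial ℤ) := pseminorm intSeminorm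

/-- `η` bounds from below the logarithmic cost per unit of vanishing order at `ξ`. -/
def HB {K : Type*} [Field K] (ξ : K) (η : ℝ) : Prop :=
  ∀ V : Polynomial ℤ, V ≠ 0 → ∀ e : ℕ,
    (Polynomial.X - Polynomial.C ξ) ^ e ∣ V.map (Int.castRingHom K) → e * η ≤ Real.log (lonep V)

variable {K : Type*} [Field K]

theorem pseminorm_finSuccEquiv_le {m : ℕ} (Q : MvPolynomial (Fin (m + 1)) ℤ) :
    pseminorm (lone (Fin m)) (finSuccEquiv ℤ m Q) ≤ lone (Fin (m + 1)) Q := by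
  have h1 : pseminorm (lone (Fin m)) 1 = 1 := by rw [pseminorm_one, lone_one]
  rw [finSuccEquiv_apply]
  refine RingSeminorm.eval₂_le intSeminorm _ h1.le _ (fun a => ?_) _ _ _ (fun i => ?_) Q
  · rw [RingHom.comp_apply, ← Polynomial.monomial_zero_left, pseminorm_monomial, lone, wseminorm_C]
  · refine Fin.cases ?_ (fun j => ?_) i
    · rw [Fin.cases_zero, ← Polynomial.monomial_one_one_eq_X, pseminorm_monomial, lone_one]
    · rw [Fin.cases_succ, ← Polynomial.monomial_zero_left, pseminorm_monomial, lone, wseminorm_X,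
        intSeminorm_apply]
      simp

theorem bishift_finSuccEquiv {m : ℕ} (ξ : Fin (m + 1) → K) (Q : MvPolynomial (Fin (m + 1)) ℤ) :
    bishift (ξ 0) (fun i => ξ i.succ) (finSuccEquiv ℤ m Q) = finSuccEquiv K m (mvshift ξ Q) := by
  have key : (bishift (ξ 0) (fun i => ξ i.succ)).comp (finSuccEquiv ℤ m).toRingEquiv.toRingHom =
      (finSuccEquiv K m).toRingEquiv.toRingHom.comp
        (mvshift ξ : MvPolynomial (Fin (m + 1)) ℤ →ₐ[ℤ] _).toRingHom := by
    apply MvPolynomial.ringHom_ext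
    · intro r; simp
    · intro i
      refine Fin.cases ?_ (fun j => ?_) i
      · simp [bishift, finSuccEquiv_apply]
      · simp [bishift, finSuccEquiv_apply]
  exact DFunLike.congr_fun key Q

theorem bishift_map_C {m : ℕ} (U : Polynomial ℤ) (ξ₀ : K) (ξ : Fin m → K) :
    bishift ξ₀ ξ (U.map C) = (Polynomial.taylor ξ₀ (U.map (Int.castRingHom K))).map C := by
  induction U using Polynomial.induction_on' with
  | add p q hp hq => simp only [Polynomial.map_add, map_add, hp, hq]
  | monomial n a =>
    rw [Polynomial.map_monomial, Polynomial.map_monomial, bishift_monomial,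
      Polynomial.taylor_monomial]
    simp [mvshift]

variable [CharZero K]

theorem exists_order {m : ℕ} {W : Polynomial (MvPolynomial (Fin m) ℤ)}
    {U : Polynomial ℤ} {V : MvPolynomial (Fin m) ℤ} {v : ℤ} (hU : U ≠ 0)
    (h : Polynomial.C (C v) * W = U.map C * Polynomial.C V) (ξ₀ : K) (ξ : Fin m → K) :
    ∃ e : ℕ, (Polynomial.X - Polynomial.C ξ₀) ^ e ∣ U.map (Int.castRingHom K) ∧
      ∀ i, coeff i (mvshift ξ V) ≠ 0 → ((bishift ξ₀ ξ W).coeff e).coeff i ≠ 0 := by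
  have hUK : U.map (Int.castRingHom K) ≠ 0 := by
    rwa [Ne, Polynomial.map_eq_zero_iff Int.cast_injective]
  obtain ⟨T, hT⟩ : ∃ T, T = Polynomial.taylor ξ₀ (U.map (Int.castRingHom K)) := ⟨_, rfl⟩
  have hT0 : T ≠ 0 := fun h0 => hUK (Polynomial.taylor_injective ξ₀ (by rw [← hT, h0, map_zero]))
  refine ⟨T.natTrailingDegree, ?_, ?_⟩
  · obtain ⟨S, hS⟩ : Polynomial.X ^ T.natTrailingDegree ∣ T := by
      rw [Polynomial.X_pow_dvd_iff]
      intro d hd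
      exact Polynomial.coeff_eq_zero_of_lt_natTrailingDegree hd
    have h1 : Polynomial.taylor (-ξ₀) T = U.map (Int.castRingHom K) := by
      rw [hT, Polynomial.taylor_taylor]; simp
    rw [← h1]
    nth_rw 2 [hS]
    rw [Polynomial.taylor_mul, Polynomial.taylor_X_pow, sub_eq_add_neg, ← Polynomial.C_neg]
    exact Dvd.intro _ rfl
  · intro i hi h0
    have h1 := congrArg (fun p => ((bishift ξ₀ ξ p).coeff T.natTrailingDegree).coeff i) h
    have h2 : ∀ p : MvPolynomial (Fin m) ℤ, bishift ξ₀ ξ (Polynomial.C p) =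
        Polynomial.C (mvshift ξ p) := fun p => by simp [bishift]
    have h3 : bishift ξ₀ ξ (U.map C) = T.map C := by rw [bishift_map_C, hT]
    simp only [map_mul, h2, h3] at h1
    rw [Polynomial.coeff_C_mul, Polynomial.coeff_mul_C, Polynomial.coeff_map, coeff_C_mul] at h1
    have h4 : (mvshift ξ (C v) : MvPolynomial (Fin m) K) = C (v : K) := by
      simp [mvshift]
    rw [h4, coeff_C_mul, h0, mul_zero] at h1
    refine mul_ne_zero ?_ hi h1.symm
    rwa [← Polynomial.trailingCoeff, Ne, Polynomial.trailingCoeff_eq_zero]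

/-- Integral version of a factorisation into separated variables. -/
theorem exists_integral_factor {m : ℕ} {W : Polynomial (MvPolynomial (Fin m) ℤ)}
    {U : Polynomial ℚ} {V : MvPolynomial (Fin m) ℤ} (hU : U ≠ 0) (hV : V ≠ 0)
    (h : W.map (map (Int.castRingHom ℚ)) =
      U.map C * Polynomial.C (map (Int.castRingHom ℚ) V)) :
    ∃ (U' : Polynomial ℤ) (v : ℤ), U' ≠ 0 ∧
      Polynomial.C (C v) * W = U'.map C * Polynomial.C V ∧
      lonep U' ≤ pseminorm (lone (Fin m)) W := by
  obtain ⟨α, hα⟩ := ne_zero_iff.1 hV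
  have hcoef : ∀ n β, ((coeff β (W.coeff n) : ℤ) : ℚ) = U.coeff n * (coeff β V : ℤ) := by
    intro n β
    have := congrArg (fun p => (p.coeff n).coeff β) h
    simpa [Polynomial.coeff_map, coeff_map] using this
  let U' : Polynomial ℤ := ∑ n ∈ W.support, Polynomial.monomial n (coeff α (W.coeff n))
  have hU' : ∀ n, U'.coeff n = coeff α (W.coeff n) := by
    intro n
    simp only [U', Polynomial.finsetSum_coeff, Polynomial.coeff_monomial]
    rw [Finset.sum_ite_eq']
    split_ifs with hn
    · rfl
    · rw [Polynomial.notMem_support_iff.1 hn, coeff_zero]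
  refine ⟨U', coeff α V, fun h0 => ?_, ?_, ?_⟩
  · obtain ⟨n, hn⟩ : ∃ n, U.coeff n ≠ 0 := by
      by_contra! hc
      exact hU (Polynomial.ext fun n => by simpa using hc n)
    have h1 := hU' n
    rw [h0, Polynomial.coeff_zero] at h1
    have h2 := hcoef n α
    rw [← h1] at h2
    exact mul_ne_zero hn (Int.cast_ne_zero.2 hα) (by simpa using h2.symm)
  · ext n β
    rw [Polynomial.coeff_C_mul, Polynomial.coeff_mul_C, Polynomial.coeff_map, coeff_C_mul,
      coeff_C_mul, hU']
    have : ((coeff α V * coeff β (W.coeff n) : ℤ) : ℚ) =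
        (coeff α (W.coeff n) * coeff β V : ℤ) := by
      push_cast
      rw [hcoef, hcoef]
      ring
    exact_mod_cast this
  · rw [pseminorm_eq_sum (t := W.support) U' ?_, pseminorm_eq_sum_support]
    · refine Finset.sum_le_sum fun n _ => ?_
      rw [hU', intSeminorm_apply]
      exact coeff_le_lone _ _
    · intro n hn
      rw [Polynomial.mem_support_iff, hU'] at hn
      rw [Polynomial.mem_support_iff]
      rintro h0
      exact hn (by rw [h0, coeff_zero])

end Roth

section RothLemma

open MvPolynomial

theorem degreeOf_hasse_le {σ R : Type*} [CommRing R] (μ : σ →₀ ℕ) (p : MvPolynomial σ R) (l : σ) :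
    degreeOf l (hasse μ p) ≤ degreeOf l p := by
  rw [degreeOf_le_iff]
  intro i hi
  rw [mem_support_iff] at hi
  have h1 : coeff (i + μ) p ≠ 0 := fun h => hi (coeff_hasse_eq_zero h)
  refine le_trans ?_ (monomial_le_degreeOf l (mem_support_iff.2 h1))
  simp

theorem degreeOf_det_le {σ R κ : Type*} [CommRing R] [Fintype κ] [DecidableEq κ]
    (M : Matrix κ κ (MvPolynomial σ R)) (l : σ) {b : ℕ} (h : ∀ i j, degreeOf l (M i j) ≤ b) :
    degreeOf l M.det ≤ Fintype.card κ * b := by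
  rw [Matrix.det_apply]
  refine (degreeOf_sum_le _ _ _).trans (Finset.sup_le fun π _ => ?_)
  have h1 : degreeOf l (∏ i, M (π i) i) ≤ Fintype.card κ * b := by
    refine (degreeOf_prod_le _ _ _).trans ?_
    refine (Finset.sum_le_sum fun i _ => h (π i) i).trans ?_
    simp
  rcases Int.units_eq_one_or (Equiv.Perm.sign π) with h | h <;> rw [h]
  · simpa using h1
  · simpa [degreeOf_neg] using h1

theorem log_factorial_mul_pow_le {k d n : ℕ} (hk0 : 0 < k) (hk : k ≤ d + 1) {x L : ℝ} (hx : 1 ≤ x)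
    (hL : 0 < L) (h : L ≤ k.factorial * (2 ^ n * x) ^ k) :
    Real.log L ≤ k * (d + n + Real.log x) := by
  have h0 : (0 : ℝ) < k := by exact_mod_cast hk0
  have h1 : L ≤ ((k : ℝ) * (2 ^ n * x)) ^ k := by
    refine h.trans ?_
    rw [mul_pow (k : ℝ)]
    exact mul_le_mul_of_nonneg_right (by exact_mod_cast Nat.factorial_le_pow k) (by positivity)
  have h2 := Real.log_le_log hL h1
  rw [Real.log_pow, Real.log_mul (by positivity) (by positivity),
    Real.log_mul (by positivity) (by positivity), Real.log_pow] at h2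
  refine h2.trans ?_
  have h3 : Real.log k ≤ d := by
    have := Real.log_le_sub_one_of_pos h0
    have : (k : ℝ) ≤ d + 1 := by exact_mod_cast hk
    linarith
  have h4 : (n : ℝ) * Real.log 2 ≤ n := by
    have : Real.log 2 ≤ 1 := by linarith [Real.log_two_lt_d9]
    nlinarith [Nat.cast_nonneg (α := ℝ) n]
  exact mul_le_mul_of_nonneg_left (by linarith) h0.le

variable {K : Type*} [Field K] [CharZero K]

set_option maxHeartbeats 1000000 in
/-- Roth's lemma: a small polynomial does not vanish to high weighted order at a point whose
coordinates are expensive. -/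
theorem roth_lemma (m : ℕ) : ∀ θ : ℝ, 0 < θ → ∃ σ : ℝ, 0 < σ ∧
    ∀ (d : Fin m → ℕ) (η : Fin m → ℝ) (ξ : Fin m → K) (Q : MvPolynomial (Fin m) ℤ), Q ≠ 0 →
      (∀ k, 1 ≤ d k) → (∀ k, degreeOf k Q ≤ d k) →
      (∀ i j, i < j → (d i : ℝ) ≤ σ * d j) →
      (∀ k, Real.log (lone _ Q) ≤ σ * (d k * η k)) →
      (∀ k, ((∑ l, d l : ℕ) : ℝ) ≤ σ * (d k * η k)) →
      (∀ k, 0 < η k) → (∀ k, HB (ξ k) (η k)) →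
      ∃ i, wt d i < θ ∧ coeff i (mvshift ξ Q) ≠ 0 := by
  induction m with
  | zero =>
    intro θ hθ
    refine ⟨1, one_pos, fun d η ξ Q hQ _ _ _ _ _ _ _ => ⟨0, by simpa [wt] using hθ, ?_⟩⟩
    rw [eq_C_of_isEmpty Q] at hQ ⊢
    have : coeff 0 Q ≠ 0 := fun h => hQ (by rw [h, C_0])
    have h4 : (mvshift ξ (C (coeff 0 Q)) : MvPolynomial (Fin 0) K) = C ((coeff 0 Q : ℤ) : K) := by
      simp [mvshift]
    rw [h4]
    rw [coeff_C, if_pos rfl]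
    exact_mod_cast this
  | succ m ih =>
    intro θ hθ
    obtain ⟨θ₁, hθ₁⟩ : ∃ x, x = min θ 1 := ⟨_, rfl⟩
    have hθ₁0 : 0 < θ₁ := by rw [hθ₁]; exact lt_min hθ one_pos
    have hθ₁1 : θ₁ ≤ 1 := by rw [hθ₁]; exact min_le_right _ _
    have hθ₁θ : θ₁ ≤ θ := by rw [hθ₁]; exact min_le_left _ _
    obtain ⟨τ, hτ⟩ : ∃ x, x = θ₁ / 2 := ⟨_, rfl⟩
    have hτ0 : 0 < τ := by linarith
    obtain ⟨σ', hσ'0, hσ'⟩ := ih (τ ^ 2 / 32) (by positivity)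
    have hm0 : (0 : ℝ) < m + 1 := by positivity
    obtain ⟨σ, hσ⟩ : ∃ x, x = min (σ' / 3) (min (τ ^ 2 / 96) (τ / (m + 1))) := ⟨_, rfl⟩
    have hσ0 : 0 < σ := by
      rw [hσ]
      exact lt_min (by positivity) (lt_min (by positivity) (by positivity))
    have hσ1 : σ ≤ σ' / 3 := by rw [hσ]; exact min_le_left _ _
    have hσ2 : σ ≤ τ ^ 2 / 96 := by
      rw [hσ]; exact (min_le_right _ _).trans (min_le_left _ _)
    have hσ3 : σ * (m + 1) ≤ τ := by
      rw [← le_div_iff₀ hm0, hσ]; exact (min_le_right _ _).trans (min_le_right _ _)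
    refine ⟨σ, hσ0, fun d η ξ Q hQ hd hdeg hlac hlog hsum hη hHB => ?_⟩
    by_contra! hlow
    obtain ⟨d', hd'⟩ : ∃ d' : Fin m → ℕ, d' = fun j => d j.succ := ⟨_, rfl⟩
    have hd1 : ∀ j, (1 : ℝ) ≤ d' j := fun j => by rw [hd']; exact_mod_cast hd _
    have hd01 : (1 : ℝ) ≤ d 0 := by exact_mod_cast hd 0
    obtain ⟨q, hq⟩ : ∃ q : ℕ → MvPolynomial (Fin m) ℤ, q = (finSuccEquiv ℤ m Q).coeff := ⟨_, rfl⟩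
    have hnat : (finSuccEquiv ℤ m Q).natDegree < d 0 + 1 := by
      rw [natDegree_finSuccEquiv]; exact Nat.lt_succ_of_le (hdeg 0)
    have hQsum : ∑ s ∈ Finset.range (d 0 + 1), Polynomial.monomial s (q s) =
        finSuccEquiv ℤ m Q := by
      rw [hq]; exact (Polynomial.as_sum_range' _ _ hnat).symm
    have hQ' : finSuccEquiv ℤ m Q ≠ 0 := by simpa using hQ
    have hwt : ∀ (n : ℕ) (i : Fin m →₀ ℕ), wt d (i.cons n) = (n : ℝ) / d 0 + wt d' i := by
      intro n i
      simp [wt, Fin.sum_univ_succ, hd']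
    have hlowQ : IsLow (d 0) d' θ₁ (bishift (ξ 0) (fun i => ξ i.succ)
        (∑ s ∈ Finset.range (d 0 + 1), Polynomial.monomial s (q s))) := by
      intro n i hi
      rw [hQsum, bishift_finSuccEquiv, finSuccEquiv_coeff_coeff]
      apply hlow
      rw [hwt]
      exact hi.trans_le hθ₁θ
    have hqne : ∃ s < d 0 + 1, q s ≠ 0 := by
      by_contra! hc
      apply hQ'
      rw [← hQsum]
      exact Finset.sum_eq_zero fun s hs => by rw [hc s (Finset.mem_range.1 hs), map_zero]
    have hqdeg : ∀ s l, degreeOf l (q s) ≤ d' l := by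
      intro s l
      rw [hq, hd']
      exact (degreeOf_coeff_finSuccEquiv Q l s).trans (hdeg _)
    have hqsum : ∑ s ∈ Finset.range (d 0 + 1), lone _ (q s) ≤ lone _ Q := by
      refine le_trans (le_of_eq ?_) (pseminorm_finSuccEquiv_le Q)
      rw [hq, pseminorm_eq_sum]
      intro s hs
      rw [Finset.mem_range]
      exact (Polynomial.le_natDegree_of_mem_supp s hs).trans_lt hnat
    have hqs : ∀ s, lone _ (q s) ≤ lone _ Q := by
      intro s
      rw [hq]
      exact (coeff_le_pseminorm (lone (Fin m)) _ s).trans (pseminorm_finSuccEquiv_le Q)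
    obtain ⟨k, ν, μ, s, U, hk0, hk, hν, hνinj, hμ, hs, hU, hV, hfac⟩ :=
      exists_mixedDeriv_det_factor (d 0) q hqne
    obtain ⟨M, hM⟩ : ∃ M : Matrix (Fin k) (Fin k) _, M =
      Matrix.of fun i j => mixedDeriv (d 0) (ν i) (μ j) q := ⟨_, rfl⟩
    obtain ⟨V, hVdef⟩ : ∃ V, V = (Matrix.of fun i j => hasse (μ i) (q (s j))).det := ⟨_, rfl⟩
    rw [← hM, ← hVdef] at hfac
    rw [← hVdef] at hV
    obtain ⟨U', v, hU', hfac', hU'le⟩ := exists_integral_factor hU hV hfac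
    have hk0' : (0 : ℝ) < k := by exact_mod_cast hk0
    -- vanishing of the determinant
    have hμwt : ∀ j, wt d' (μ j) ≤ τ := by
      intro j
      have h1 : ∀ l, (μ j l : ℝ) / d' l ≤ σ := by
        intro l
        have h2 : (μ j l : ℝ) ≤ d 0 := by
          have h3 := hμ j
          have h4 : μ j l ≤ (μ j).degree := Finsupp.le_degree l (μ j)
          exact_mod_cast (by omega : μ j l ≤ d 0)
        rw [div_le_iff₀ (by linarith [hd1 l])]
        refine h2.trans ?_
        rw [hd']
        exact hlac 0 l.succ (Fin.succ_pos l)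
      refine (Finset.sum_le_sum fun l _ => h1 l).trans ?_
      simp only [Finset.sum_const, Finset.card_univ, Fintype.card_fin, nsmul_eq_mul]
      linarith
    have hWlow : IsLow (d 0) d' (k * τ ^ 2 / 8) (bishift (ξ 0) (fun i => ξ i.succ) M.det) := by
      have h1 : ∀ i j, IsLow (d 0) d' (max 0 (τ - (ν i : ℝ) / d 0))
          (bishift (ξ 0) (fun i => ξ i.succ) (M i j)) := by
        intro i j
        rcases max_choice 0 (τ - (ν i : ℝ) / d 0) with h | h
        · rw [h]; exact isLow_of_nonpos le_rfl _
        · rw [h, hM]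
          refine (isLow_bishift_mixedDeriv (ξ 0) (fun i => ξ i.succ) (ν i) (μ j) q hlowQ).mono ?_
          linarith [hμwt j]
      have h2 := IsLow.det (fun i => max 0 (τ - (ν i : ℝ) / d 0))
        (M.map (bishift (ξ 0) fun i => ξ i.succ)) fun i j => by rw [Matrix.map_apply]; exact h1 i j
      rw [← RingHom.mapMatrix_apply, ← RingHom.map_det] at h2
      refine h2.mono ?_
      have h3 : Finset.univ.image ν = Finset.range k := by
        apply Finset.eq_of_subset_of_card_le
        · intro x hx
          obtain ⟨i, -, rfl⟩ := Finset.mem_image.1 hx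
          exact Finset.mem_range.2 (hν i)
        · rw [Finset.card_image_of_injective _ hνinj]; simp
      have h4 := Finset.sum_image (s := Finset.univ) (g := ν)
        (f := fun n : ℕ => max 0 (τ - (n : ℝ) / d 0)) (fun _ _ _ _ h => hνinj h)
      rw [← h4, h3]
      exact sum_max_ge (by have := hd 0; omega) hτ0 (by linarith)
    -- sizes
    have hQ1 : 1 ≤ lone _ Q := one_le_lone hQ
    have hsumd : ((∑ l, d l : ℕ) : ℝ) = d 0 + ((∑ l, d' l : ℕ) : ℝ) := by
      rw [Fin.sum_univ_succ, hd']; push_cast; rfl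
    have hdV : (0 : ℝ) ≤ ((∑ l, d' l : ℕ) : ℝ) := Nat.cast_nonneg _
    have hVlog : Real.log (lone _ V) ≤ k * (d 0 + ((∑ l, d' l : ℕ) : ℝ) + Real.log (lone _ Q)) := by
      refine log_factorial_mul_pow_le hk0 hk hQ1 (by linarith [one_le_lone hV]) ?_
      have h1 := RingSeminorm.det_le (lone (Fin m)) (lone_one _).le
        (c := 2 ^ (∑ l, d' l) * lone _ Q) (Matrix.of fun i j => hasse (μ i) (q (s j)))
        (fun i j => (lone_hasse_le (μ i) (q (s j)) d' (hqdeg _)).trans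
          (mul_le_mul_of_nonneg_left (hqs _) (by positivity)))
      rwa [← hVdef, Fintype.card_fin] at h1
    have hUlog : Real.log (lonep U') ≤
        k * (d 0 + ((d 0 + ∑ l, d' l : ℕ) : ℝ) + Real.log (lone _ Q)) := by
      refine log_factorial_mul_pow_le hk0 hk hQ1 ?_ ?_
      · obtain ⟨n, hn⟩ : ∃ n, U'.coeff n ≠ 0 := by
          by_contra! hc
          exact hU' (Polynomial.ext fun n => by simpa using hc n)
        refine lt_of_lt_of_le ?_ (coeff_le_pseminorm _ _ n)
        rw [intSeminorm_apply]
        exact abs_pos.2 (by exact_mod_cast hn)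
      · refine hU'le.trans ?_
        have h1 := RingSeminorm.det_le (pseminorm (lone (Fin m)))
          (by rw [pseminorm_one, lone_one])
          (c := 2 ^ (d 0 + ∑ l, d' l) * lone _ Q) M
          (fun i j => by
            rw [hM]
            exact (pseminorm_mixedDeriv_le (d 0) (ν i) (μ j) q d' hqdeg).trans
              (mul_le_mul_of_nonneg_left hqsum (by positivity)))
        rwa [Fintype.card_fin] at h1
    have hVdeg : ∀ l, degreeOf l V ≤ k * d' l := by
      intro l
      have := degreeOf_det_le (Matrix.of fun i j => hasse (μ i) (q (s j))) l (b := d' l)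
        (fun i j => (degreeOf_hasse_le _ _ _).trans (hqdeg _ _))
      rwa [← hVdef, Fintype.card_fin] at this
    obtain ⟨i, hi, hine⟩ := hσ' (fun l => k * d' l) (fun l => η l.succ) (fun l => ξ l.succ) V hV
      (fun l => Nat.mul_pos hk0 (by rw [hd']; exact hd _)) hVdeg
      (fun i j hij => by
        push_cast
        have h1 := hlac i.succ j.succ (Fin.succ_lt_succ_iff.2 hij)
        have h2 : (d i.succ : ℝ) ≤ σ' * d j.succ := h1.trans (by gcongr; linarith)
        rw [hd']
        nlinarith)
      (fun l => by
        have h1 := hlog l.succ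
        have h2 := hsum l.succ
        rw [hsumd] at h2
        have h3 : 0 < (d l.succ : ℝ) * η l.succ := mul_pos (by
          have := hd1 l; rw [hd'] at this; exact one_pos.trans_le this) (hη _)
        refine hVlog.trans ?_
        push_cast
        have h4 : σ' * ((k : ℝ) * d' l * η l.succ) = k * (σ' * (d l.succ * η l.succ)) := by
          rw [hd']; ring
        rw [h4]
        gcongr
        push_cast at h1 h2 ⊢
        nlinarith)
      (fun l => by
        have h2 := hsum l.succ
        rw [hsumd] at h2
        have h3 : 0 < (d l.succ : ℝ) * η l.succ := mul_pos (by
          have := hd1 l; rw [hd'] at this; exact one_pos.trans_le this) (hη _)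
        have h4 : σ' * (((k * d' l : ℕ) : ℝ) * η l.succ) = k * (σ' * (d l.succ * η l.succ)) := by
          rw [hd']; push_cast; ring
        rw [h4, ← Finset.mul_sum, Nat.cast_mul]
        gcongr
        nlinarith)
      (fun l => hη _) (fun l => hHB _)
    obtain ⟨e, he, hcoeff⟩ := exists_order hU' hfac' (ξ 0) (fun l => ξ l.succ)
    have h1 := mt (hWlow e i) (hcoeff i hine)
    rw [not_lt] at h1
    have h2 : wt d' i = k * wt (fun l => k * d' l) i := by
      unfold wt
      rw [Finset.mul_sum]
      refine Finset.sum_congr rfl fun l _ => ?_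
      have : (d' l : ℝ) ≠ 0 := by linarith [hd1 l]
      push_cast
      field_simp
    have h3 : (e : ℝ) / d 0 ≤ 3 * k * σ := by
      have h4 := hHB 0 U' hU' e he
      have h5 := hlog 0
      have h6 := hsum 0
      have h7 : (0 : ℝ) < d 0 * η 0 := mul_pos (by linarith) (hη 0)
      rw [hsumd] at h6
      have h8 : (e : ℝ) * η 0 ≤ k * (3 * σ * (d 0 * η 0)) := by
        refine h4.trans (hUlog.trans ?_)
        gcongr
        push_cast at h6 hdV ⊢
        linarith
      rw [div_le_iff₀ (by linarith)]
      have h9 : (e : ℝ) * η 0 ≤ (3 * k * σ * d 0) * η 0 := by linarith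
      exact le_of_mul_le_mul_right h9 (hη 0)
    rw [h2] at h1
    nlinarith

end RothLemma

section Counting

/-- Second moment of a sum of independent mean-zero functions on a product. -/
theorem sum_sq_piFinset_le {κ α : Type*} [Fintype κ] [DecidableEq κ] (D : κ → Finset α)
    (f : κ → α → ℝ) (hf : ∀ k, ∑ x ∈ D k, f k x = 0) {M : ℝ}
    (hM : ∀ k, ∀ x ∈ D k, |f k x| ≤ M) :
    ∑ x ∈ Fintype.piFinset D, (∑ k, f k (x k)) ^ 2 ≤
      (Fintype.piFinset D).card * (Fintype.card κ * M ^ 2) := by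
  have h1 : ∀ k l, k ≠ l → ∑ x ∈ Fintype.piFinset D, f k (x k) * f l (x l) = 0 := by
    intro k l hkl
    have h2 := Finset.prod_univ_sum D fun i j =>
      (if i = k then f k j else 1) * (if i = l then f l j else 1)
    simp only [Finset.prod_mul_distrib, Finset.prod_ite_eq', Finset.mem_univ, if_true] at h2
    rw [← h2]
    refine Finset.prod_eq_zero (Finset.mem_univ k) ?_
    simp [hkl, hf]
  have h3 : ∑ x ∈ Fintype.piFinset D, (∑ k, f k (x k)) ^ 2 =
      ∑ k, ∑ x ∈ Fintype.piFinset D, f k (x k) ^ 2 := by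
    simp_rw [sq, Finset.sum_mul_sum]
    rw [Finset.sum_comm]
    refine Finset.sum_congr rfl fun k _ => ?_
    rw [Finset.sum_comm]
    exact Finset.sum_eq_single k (fun l _ hl => h1 k l hl.symm) (by simp)
  rw [h3]
  have h4 : ∀ k, ∑ x ∈ Fintype.piFinset D, f k (x k) ^ 2 ≤
      (Fintype.piFinset D).card * M ^ 2 := by
    intro k
    rw [← nsmul_eq_mul]
    refine Finset.sum_le_card_nsmul _ _ _ fun x hx => ?_
    exact sq_le_sq' (abs_le.1 (hM k _ (Fintype.mem_piFinset.1 hx k))).1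
      (abs_le.1 (hM k _ (Fintype.mem_piFinset.1 hx k))).2
  refine (Finset.sum_le_sum fun k _ => h4 k).trans (le_of_eq ?_)
  rw [Finset.sum_const, Finset.card_univ, nsmul_eq_mul]
  ring

theorem card_filter_piFinset_le {κ α : Type*} [Fintype κ] [DecidableEq κ] (D : κ → Finset α)
    (f : κ → α → ℝ) (hf : ∀ k, ∑ x ∈ D k, f k x = 0) {M δ : ℝ} (hδ : 0 < δ)
    (hM : ∀ k, ∀ x ∈ D k, |f k x| ≤ M) :
    (((Fintype.piFinset D).filter fun x => Fintype.card κ * δ < ∑ k, f k (x k)).card : ℝ) *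
      (Fintype.card κ * δ ^ 2) ≤ (Fintype.piFinset D).card * M ^ 2 := by
  rcases Nat.eq_zero_or_pos (Fintype.card κ) with h0 | h0
  · rw [h0]; simp; positivity
  have h0' : (0 : ℝ) < Fintype.card κ := by exact_mod_cast h0
  have h1 := sum_sq_piFinset_le D f hf hM
  have h2 : (((Fintype.piFinset D).filter fun x =>
      Fintype.card κ * δ < ∑ k, f k (x k)).card : ℝ) * (Fintype.card κ * δ) ^ 2 ≤
      ∑ x ∈ Fintype.piFinset D, (∑ k, f k (x k)) ^ 2 := by
    rw [← nsmul_eq_mul]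
    refine (Finset.card_nsmul_le_sum _ (fun x => (∑ k, f k (x k)) ^ 2) _ fun x hx => ?_).trans
      (Finset.sum_le_sum_of_subset_of_nonneg (Finset.filter_subset _ _) fun _ _ _ => sq_nonneg _)
    have := (Finset.mem_filter.1 hx).2
    gcongr
  have h3 := h2.trans h1
  have h4 : (Fintype.card κ : ℝ) * ((((Fintype.piFinset D).filter fun x =>
      Fintype.card κ * δ < ∑ k, f k (x k)).card : ℝ) * (Fintype.card κ * δ ^ 2)) ≤
      Fintype.card κ * ((Fintype.piFinset D).card * M ^ 2) := by
    refine le_trans (le_of_eq ?_) (h3.trans (le_of_eq ?_)) <;> ring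
  exact le_of_mul_le_mul_left h4 h0'

theorem sum_piAntidiag_apply {ι : Type*} [Fintype ι] [DecidableEq ι] (d : ℕ) (i j : ι) :
    ∑ e ∈ Finset.piAntidiag Finset.univ d, (e i : ℝ) =
      ∑ e ∈ Finset.piAntidiag Finset.univ d, (e j : ℝ) := by
  refine Finset.sum_bij' (fun e _ => e ∘ Equiv.swap i j) (fun e _ => e ∘ Equiv.swap i j)
    (fun e he => ?_) (fun e he => ?_) (fun e _ => ?_) (fun e _ => ?_) (fun e _ => ?_)
  · rw [Finset.mem_piAntidiag] at he ⊢
    exact ⟨by rw [← he.1]; exact Equiv.sum_comp _ e, by simp⟩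
  · rw [Finset.mem_piAntidiag] at he ⊢
    exact ⟨by rw [← he.1]; exact Equiv.sum_comp _ e, by simp⟩
  · ext; simp
  · ext; simp
  · simp

theorem sum_piAntidiag_weight {ι : Type*} [Fintype ι] [DecidableEq ι] [Nonempty ι] {d : ℕ}
    (hd : 1 ≤ d) (c : ι → ℝ) :
    ∑ e ∈ Finset.piAntidiag Finset.univ d,
      (∑ i, c i * ((e i : ℝ) / d) - (∑ i, c i) / Fintype.card ι) = 0 := by
  have hN : (Fintype.card ι : ℝ) ≠ 0 := Nat.cast_ne_zero.2 Fintype.card_ne_zero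
  have hd' : (d : ℝ) ≠ 0 := Nat.cast_ne_zero.2 (by omega)
  have h1 : ∀ i : ι, (Fintype.card ι : ℝ) * ∑ e ∈ Finset.piAntidiag Finset.univ d, (e i : ℝ) =
      (Finset.piAntidiag (Finset.univ : Finset ι) d).card * d := by
    intro i
    have h2 : ∑ j : ι, ∑ e ∈ Finset.piAntidiag Finset.univ d, (e j : ℝ) =
        (Fintype.card ι : ℝ) * ∑ e ∈ Finset.piAntidiag Finset.univ d, (e i : ℝ) := by
      rw [Finset.sum_congr rfl fun j _ => sum_piAntidiag_apply d j i]
      simp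
    rw [← h2, Finset.sum_comm, ← nsmul_eq_mul]
    refine Finset.sum_eq_card_nsmul fun e he => ?_
    exact_mod_cast (Finset.mem_piAntidiag.1 he).1
  rw [Finset.sum_sub_distrib, Finset.sum_comm, Finset.sum_const, nsmul_eq_mul, sub_eq_zero]
  rw [← mul_right_inj' hN]
  have h3 : ∀ i : ι, ∑ e ∈ Finset.piAntidiag Finset.univ d, c i * ((e i : ℝ) / d) =
      c i / d * ∑ e ∈ Finset.piAntidiag Finset.univ d, (e i : ℝ) := by
    intro i
    rw [Finset.mul_sum]
    exact Finset.sum_congr rfl fun _ _ => by ring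
  simp_rw [h3]
  rw [Finset.mul_sum]
  have h4 : ∀ i : ι, (Fintype.card ι : ℝ) *
      (c i / d * ∑ e ∈ Finset.piAntidiag Finset.univ d, (e i : ℝ)) =
      (Finset.piAntidiag (Finset.univ : Finset ι) d).card * c i := by
    intro i
    rw [mul_left_comm, h1]
    field_simp
  simp_rw [h4]
  rw [← Finset.mul_sum]
  field_simp

end Counting

section Siegel

attribute [local instance] Matrix.seminormedAddCommGroup

theorem exists_small_solution {α β : Type*} [Fintype α] [Fintype β] [Nonempty β]
    (A : Matrix α β ℤ) (h : 2 * Fintype.card α ≤ Fintype.card β) {c : ℝ} (hc : 1 ≤ c)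
    (hA : ∀ i j, |(A i j : ℝ)| ≤ c) :
    ∃ t : β → ℤ, t ≠ 0 ∧ A.mulVec t = 0 ∧ ∀ j, |(t j : ℝ)| ≤ Fintype.card β * c := by
  have hβ : 0 < Fintype.card β := Fintype.card_pos
  have hβ' : (1 : ℝ) ≤ Fintype.card β := by exact_mod_cast hβ
  rcases Nat.eq_zero_or_pos (Fintype.card α) with h0 | h0
  · have := Fintype.card_eq_zero_iff.1 h0
    refine ⟨1, one_ne_zero, Subsingleton.elim _ _, fun j => ?_⟩
    simp only [Pi.one_apply, Int.cast_one, abs_one]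
    nlinarith
  obtain ⟨t, ht, hAt, hb⟩ := Int.Matrix.exists_ne_zero_int_vec_norm_le A (by omega) h0
  refine ⟨t, ht, hAt, fun j => ?_⟩
  have h1 : max 1 ‖A‖ ≤ c := by
    refine max_le hc ?_
    rw [Matrix.norm_le_iff (by linarith)]
    intro i j
    simpa [Int.norm_eq_abs] using hA i j
  have h2 : ((Fintype.card α : ℝ) / (Fintype.card β - Fintype.card α)) ≤ 1 := by
    have h3 : (2 : ℝ) * Fintype.card α ≤ Fintype.card β := by exact_mod_cast h
    have h4 : (0 : ℝ) < Fintype.card α := by exact_mod_cast h0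
    rw [div_le_one (by linarith)]
    linarith
  have h5 : (1 : ℝ) ≤ Fintype.card β * max 1 ‖A‖ :=
    one_le_mul_of_one_le_of_one_le hβ' (le_max_left _ _)
  have h6 : |(t j : ℝ)| ≤ ‖t‖ := by
    have := norm_le_pi_norm t j
    rwa [Int.norm_eq_abs] at this
  refine h6.trans (hb.trans ?_)
  refine (Real.rpow_le_rpow_of_exponent_le h5 h2).trans ?_
  rw [Real.rpow_one]
  gcongr

end Siegel

section Auxiliary

open MvPolynomial

variable {κ ι : Type*} [Fintype κ] [Fintype ι] [DecidableEq κ]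

/-- The multidegree weight on variables arranged in blocks indexed by `κ`. -/
def blockWeight (κ ι : Type*) [DecidableEq κ] : κ × ι → κ → ℕ := fun p => Pi.single p.1 1

theorem weight_blockWeight (s : κ × ι →₀ ℕ) (k : κ) :
    Finsupp.weight (blockWeight κ ι) s k = ∑ i, s (k, i) := by
  rw [Finsupp.weight_apply, Finsupp.sum_fintype _ _ (by simp), Finset.sum_apply,
    Fintype.sum_prod_type]
  rw [Finset.sum_eq_single k]
  · simp [blockWeight]
  · intro l _ hl
    simp [blockWeight, hl.symm]
  · simp

theorem IsWeightedHomogeneous.aeval {σ τ R M : Type*} [CommRing R] [AddCommMonoid M] [Fintype σ]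
    {w : σ → M} {w' : τ → M} {d : M} {P : MvPolynomial σ R} (hP : IsWeightedHomogeneous w P d)
    (f : σ → MvPolynomial τ R) (hf : ∀ i, IsWeightedHomogeneous w' (f i) (w i)) :
    IsWeightedHomogeneous w' (MvPolynomial.aeval f P) d := by
  rw [aeval_def, eval₂_eq']
  refine IsWeightedHomogeneous.sum _ _ _ fun s hs => ?_
  rw [algebraMap_eq]
  refine IsWeightedHomogeneous.C_mul ?_ _
  have h1 := IsWeightedHomogeneous.prod Finset.univ (fun i => f i ^ s i) (fun i => s i • w i)
    (fun i _ => (hf i).pow (s i))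
  have h2 := hP (mem_support_iff.1 hs)
  rw [Finsupp.weight_apply, Finsupp.sum_fintype _ _ (by simp)] at h2
  rwa [h2] at h1

/-- Simultaneous linear substitution in all blocks of variables. -/
noncomputable def linSub (κ : Type*) (M : Matrix ι ι ℤ) :
    MvPolynomial (κ × ι) ℤ →ₐ[ℤ] MvPolynomial (κ × ι) ℤ :=
  aeval fun p => ∑ j, C (M p.2 j) * X (p.1, j)

theorem isWeightedHomogeneous_linSub (M : Matrix ι ι ℤ) {P : MvPolynomial (κ × ι) ℤ} {d : κ → ℕ}
    (hP : IsWeightedHomogeneous (blockWeight κ ι) P d) :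
    IsWeightedHomogeneous (blockWeight κ ι) (linSub κ M P) d :=
  IsWeightedHomogeneous.aeval hP _ fun p => IsWeightedHomogeneous.sum _ _ _ fun j _ =>
    (isWeightedHomogeneous_X ℤ (blockWeight κ ι) (p.1, j)).C_mul _

omit [DecidableEq κ] in
theorem lone_linSub_monomial_le (M : Matrix ι ι ℤ) {c : ℝ} (hc : ∀ i, ∑ j, |(M i j : ℝ)| ≤ c)
    (hc0 : 0 ≤ c) (s : κ × ι →₀ ℕ) : lone _ (linSub κ M (monomial s 1)) ≤ c ^ ∑ p, s p := by
  have h1 := RingSeminorm.eval₂_le intSeminorm (lone (κ × ι)) (lone_one _).le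
    (algebraMap ℤ (MvPolynomial (κ × ι) ℤ)) (fun a => by rw [algebraMap_eq, lone, wseminorm_C])
    (fun p : κ × ι => ∑ j, C (M p.2 j) * X (p.1, j)) (fun _ => c) (fun _ => hc0) (fun p => by
      refine (RingSeminorm.map_sum_le_sum _ _ _).trans (le_trans ?_ (hc p.2))
      refine Finset.sum_le_sum fun j _ => (map_mul_le_mul _ _ _).trans ?_
      rw [lone, wseminorm_C, wseminorm_X, intSeminorm_apply, intSeminorm_apply]
      simp) (monomial s 1)
  refine h1.trans (le_of_eq ?_)
  rw [wseminorm_monomial, intSeminorm_apply, Finsupp.prod_fintype _ _ (by simp),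
    Finset.prod_pow_eq_pow_sum]
  simp

/-- Exponents of multihomogeneous monomials. -/
noncomputable def blockExp (e : κ → ι → ℕ) : κ × ι →₀ ℕ := Finsupp.equivFunOnFinite.symm fun p => e p.1 p.2

omit [DecidableEq κ] in
theorem blockExp_injective : Function.Injective (blockExp : (κ → ι → ℕ) → _) := by
  intro e e' h
  ext k i
  exact DFunLike.congr_fun h (k, i)

theorem card_piFinset_piAntidiag_le [DecidableEq ι] (d : κ → ℕ) :
    ((Fintype.piFinset fun k => Finset.piAntidiag (Finset.univ : Finset ι) (d k)).card : ℝ) ≤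
      (2 ^ Fintype.card ι) ^ ∑ k, d k := by
  rw [Fintype.card_piFinset, ← Finset.prod_pow_eq_pow_sum, Nat.cast_prod]
  refine Finset.prod_le_prod (fun _ _ => by positivity) fun k _ => ?_
  have h1 : Finset.piAntidiag (Finset.univ : Finset ι) (d k) ⊆
      Fintype.piFinset fun _ => Finset.range (d k + 1) := by
    intro e he
    rw [Fintype.mem_piFinset]
    intro i
    rw [Finset.mem_range, Nat.lt_succ_iff, ← (Finset.mem_piAntidiag.1 he).1]
    exact Finset.single_le_sum (fun _ _ => Nat.zero_le _) (Finset.mem_univ i)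
  have h2 := Finset.card_le_card h1
  rw [Fintype.card_piFinset] at h2
  simp only [Finset.card_range, Finset.prod_const, Finset.card_univ] at h2
  have h3 : (d k + 1) ^ Fintype.card ι ≤ (2 ^ d k) ^ Fintype.card ι :=
    Nat.pow_le_pow_left (Nat.lt_two_pow_self) _
  rw [← pow_mul, mul_comm, pow_mul] at h3
  exact_mod_cast h2.trans h3

theorem card_unbalanced_le [DecidableEq ι] [Nonempty ι] (d : κ → ℕ) (hd : ∀ k, 1 ≤ d k)
    (c : ι → ℝ) {M δ : ℝ} (hδ : 0 < δ) (hM : 2 * ∑ i, |c i| ≤ M) :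
    (((Fintype.piFinset fun k => Finset.piAntidiag (Finset.univ : Finset ι) (d k)).filter fun x =>
      Fintype.card κ * δ < ∑ k, (∑ i, c i * ((x k i : ℝ) / d k) -
        (∑ i, c i) / Fintype.card ι)).card : ℝ) * (Fintype.card κ * δ ^ 2) ≤
      (Fintype.piFinset fun k => Finset.piAntidiag (Finset.univ : Finset ι) (d k)).card *
        M ^ 2 := by
  refine card_filter_piFinset_le _ (fun k (x : ι → ℕ) => ∑ i, c i * ((x i : ℝ) / d k) -
        (∑ i, c i) / Fintype.card ι) (fun k => sum_piAntidiag_weight (hd k) c) hδ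
        fun k x hx => ?_
  have hd' : (0 : ℝ) < d k := by exact_mod_cast hd k
  have h1 : |∑ i, c i * ((x i : ℝ) / d k)| ≤ ∑ i, |c i| := by
    refine (Finset.abs_sum_le_sum_abs _ _).trans (Finset.sum_le_sum fun i _ => ?_)
    rw [abs_mul]
    refine mul_le_of_le_one_right (abs_nonneg _) ?_
    rw [abs_of_nonneg (by positivity), div_le_one hd', ← (Finset.mem_piAntidiag.1 hx).1]
    exact_mod_cast Finset.single_le_sum (fun _ _ => Nat.zero_le _) (Finset.mem_univ i)
  have h2 : |(∑ i, c i) / Fintype.card ι| ≤ ∑ i, |c i| := by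
    rw [abs_div, Nat.abs_cast, div_le_iff₀ (by exact_mod_cast Fintype.card_pos)]
    refine (Finset.abs_sum_le_sum_abs _ _).trans ?_
    exact le_mul_of_one_le_right (Finset.sum_nonneg fun _ _ => abs_nonneg _)
      (by exact_mod_cast Fintype.card_pos)
  exact (abs_sub _ _).trans (by linarith)

/-- Construction of the auxiliary polynomial. -/
theorem exists_auxiliary {S : Type*} [Fintype S] [DecidableEq ι] [Nonempty ι]
    (M : S → Matrix ι ι ℤ) (c : S → ι → ℝ) {δ : ℝ} (hδ : 0 < δ) :
    ∃ (m : ℕ) (C₁ : ℝ), 0 < m ∧ 1 ≤ C₁ ∧ ∀ d : Fin m → ℕ, (∀ k, 1 ≤ d k) →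
      ∃ P : MvPolynomial (Fin m × ι) ℤ, P ≠ 0 ∧
        IsWeightedHomogeneous (blockWeight (Fin m) ι) P d ∧
        lone _ P ≤ C₁ ^ ∑ k, d k ∧
        ∀ v e, coeff e (linSub (Fin m) (M v) P) ≠ 0 →
          ∑ k, ∑ i, c v i * ((e (k, i) : ℝ) / d k) ≤
            m * ((∑ i, c v i) / Fintype.card ι + δ) := by
  classical
  obtain ⟨B, hB⟩ : ∃ x : ℝ, x = ∑ v, 2 * ∑ i, |c v i| := ⟨_, rfl⟩
  have hBv : ∀ v, 2 * ∑ i, |c v i| ≤ B := fun v => by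
    rw [hB]
    exact Finset.single_le_sum (f := fun v => 2 * ∑ i, |c v i|)
      (fun _ _ => by positivity) (Finset.mem_univ v)
  obtain ⟨m, hm⟩ := exists_nat_ge (2 * Fintype.card S * B ^ 2 / δ ^ 2 + 1)
  have hm1 : (1 : ℝ) ≤ m := le_trans (le_add_of_nonneg_left (by positivity)) hm
  have hm0 : 0 < m := by exact_mod_cast one_pos.trans_le hm1
  obtain ⟨C₀, hC₀⟩ : ∃ x : ℝ, x = 1 + ∑ v, ∑ i, ∑ j, |(M v i j : ℝ)| := ⟨_, rfl⟩
  have hC₀1 : 1 ≤ C₀ := by rw [hC₀]; exact le_add_of_nonneg_right (by positivity)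
  have hCM : ∀ v i, ∑ j, |(M v i j : ℝ)| ≤ C₀ := by
    intro v i
    have h1 : ∑ j, |(M v i j : ℝ)| ≤ ∑ i, ∑ j, |(M v i j : ℝ)| :=
      Finset.single_le_sum (f := fun i => ∑ j, |(M v i j : ℝ)|)
        (fun _ _ => by positivity) (Finset.mem_univ i)
    have h2 : ∑ i, ∑ j, |(M v i j : ℝ)| ≤ ∑ v, ∑ i, ∑ j, |(M v i j : ℝ)| :=
      Finset.single_le_sum (f := fun v => ∑ i, ∑ j, |(M v i j : ℝ)|)
        (fun _ _ => by positivity) (Finset.mem_univ v)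
    rw [hC₀]
    linarith
  refine ⟨m, (2 ^ Fintype.card ι) ^ 2 * C₀, hm0,
    one_le_mul_of_one_le_of_one_le (one_le_pow₀ (one_le_pow₀ one_le_two)) hC₀1, fun d hd => ?_⟩
  obtain ⟨T, hT⟩ : ∃ T, T = Fintype.piFinset fun k : Fin m =>
    Finset.piAntidiag (Finset.univ : Finset ι) (d k) := ⟨_, rfl⟩
  have hTmem : ∀ x, x ∈ T ↔ ∀ k, ∑ i, x k i = d k := by
    intro x
    rw [hT, Fintype.mem_piFinset]
    simp [Finset.mem_piAntidiag]
  have hTcard : (T.card : ℝ) ≤ (2 ^ Fintype.card ι) ^ ∑ k, d k := by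
    rw [hT]; exact card_piFinset_piAntidiag_le d
  let E : S → Finset (Fin m → ι → ℕ) := fun v => T.filter fun x =>
      m * δ < ∑ k, (∑ i, c v i * ((x k i : ℝ) / d k) - (∑ i, c v i) / Fintype.card ι)
  have hE : ∀ v, 2 * (Fintype.card S : ℝ) * (E v).card ≤ T.card := by
    intro v
    have h1 := card_unbalanced_le d hd (c v) hδ (hBv v)
    rw [← hT, Fintype.card_fin] at h1
    have h2 : 2 * Fintype.card S * B ^ 2 ≤ m * δ ^ 2 := by
      rw [← div_le_iff₀ (by positivity)]
      linarith
    have h3 : (2 * (Fintype.card S : ℝ) * (E v).card) * (m * δ ^ 2) ≤ T.card * (m * δ ^ 2) := by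
      calc _ = 2 * (Fintype.card S : ℝ) * ((E v).card * (m * δ ^ 2)) := by ring
        _ ≤ 2 * (Fintype.card S : ℝ) * (T.card * B ^ 2) := by gcongr
        _ = T.card * (2 * Fintype.card S * B ^ 2) := by ring
        _ ≤ _ := by gcongr
    exact le_of_mul_le_mul_right h3 (by positivity)
  have hTne : Nonempty T := by
    obtain ⟨i₀⟩ := (inferInstance : Nonempty ι)
    refine ⟨⟨fun k => Pi.single i₀ (d k), (hTmem _).2 fun k => ?_⟩⟩
    simp
  have hcard : 2 * Fintype.card (Finset.univ.sigma E) ≤ Fintype.card T := by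
    rw [Fintype.card_coe, Fintype.card_coe, Finset.card_sigma]
    rcases isEmpty_or_nonempty S with hS | hS
    · simp
    · have hS0 : (0 : ℝ) < Fintype.card S := by exact_mod_cast Fintype.card_pos
      have h1 : (Fintype.card S : ℝ) * (2 * ∑ v, ((E v).card : ℝ)) ≤
          Fintype.card S * T.card := by
        calc _ = ∑ v, 2 * (Fintype.card S : ℝ) * (E v).card := by
              rw [← Finset.mul_sum]; ring
          _ ≤ ∑ v : S, (T.card : ℝ) := Finset.sum_le_sum fun v _ => hE v
          _ = _ := by simp
      exact_mod_cast le_of_mul_le_mul_left h1 hS0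
  have hwt : ∀ x ∈ T, ∑ p : Fin m × ι, blockExp x p = ∑ k, d k := by
    intro x hx
    rw [Fintype.sum_prod_type]
    exact Finset.sum_congr rfl fun k _ => (hTmem x).1 hx k
  obtain ⟨t, ht, hAt, htb⟩ := exists_small_solution (β := T)
    (Matrix.of fun (p : Finset.univ.sigma E) (x : T) =>
      coeff (blockExp p.1.2) (linSub (Fin m) (M p.1.1) (monomial (blockExp x.1) 1))) hcard
    (c := C₀ ^ ∑ k, d k) (one_le_pow₀ hC₀1) fun p x => by
      refine (coeff_le_lone _ _).trans ?_
      rw [← hwt x.1 x.2]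
      exact lone_linSub_monomial_le _ (hCM _) (by linarith) _
  have hcoeff : ∀ x : T, coeff (blockExp x.1)
      (∑ x : T, monomial (blockExp x.1) (t x) : MvPolynomial (Fin m × ι) ℤ) = t x := by
    intro x
    rw [coeff_sum]
    simp only [coeff_monomial, blockExp_injective.eq_iff, Subtype.coe_inj]
    simp
  have hhom : IsWeightedHomogeneous (blockWeight (Fin m) ι)
      (∑ x : T, monomial (blockExp x.1) (t x) : MvPolynomial (Fin m × ι) ℤ) d := by
    refine IsWeightedHomogeneous.sum _ _ _ fun x _ => isWeightedHomogeneous_monomial _ _ _ ?_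
    funext k
    rw [weight_blockWeight]
    exact (hTmem x.1).1 x.2 k
  refine ⟨∑ x : T, monomial (blockExp x.1) (t x), fun h0 => ht ?_, hhom, ?_, ?_⟩
  · funext x
    rw [← hcoeff x, h0, coeff_zero, Pi.zero_apply]
  · refine (RingSeminorm.map_sum_le_sum _ _ _).trans ?_
    have h1 : ∀ x : T, lone (Fin m × ι) (monomial (blockExp x.1) (t x)) ≤
        T.card * C₀ ^ ∑ k, d k := by
      intro x
      rw [lone, wseminorm_monomial, intSeminorm_apply]
      simpa using htb x
    refine (Finset.sum_le_sum fun x _ => h1 x).trans ?_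
    rw [Finset.sum_const, Finset.card_univ, Fintype.card_coe, nsmul_eq_mul, mul_pow, ← mul_assoc,
      ← sq, ← pow_mul, mul_comm 2, pow_mul]
    gcongr
  · intro v e he
    by_contra! hlt
    apply he
    have h1 := isWeightedHomogeneous_linSub (M v) hhom he
    let x : Fin m → ι → ℕ := fun k i => e (k, i)
    have hxe : blockExp x = e := by ext p; rfl
    have hxT : x ∈ T := (hTmem x).2 fun k => by rw [← h1, weight_blockWeight]
    have hxE : x ∈ E v := by
      refine Finset.mem_filter.2 ⟨hxT, ?_⟩
      rw [Finset.sum_sub_distrib, Finset.sum_const, Finset.card_univ, Fintype.card_fin,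
        nsmul_eq_mul]
      rw [mul_add] at hlt
      linarith
    have h2 := congrFun hAt ⟨⟨v, x⟩, Finset.mem_sigma.2 ⟨Finset.mem_univ _, hxE⟩⟩
    rw [Matrix.mulVec, dotProduct] at h2
    simp only [Matrix.of_apply, Pi.zero_apply, hxe] at h2
    rw [map_sum, coeff_sum, ← h2]
    refine Finset.sum_congr rfl fun y _ => ?_
    rw [mul_comm, ← coeff_C_mul]
    congr 1
    have : (monomial (blockExp y.1) (t y) : MvPolynomial (Fin m × ι) ℤ) =
        C (t y) * monomial (blockExp y.1) 1 := by rw [C_mul_monomial, mul_one]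
    rw [this, map_mul]
    congr 1
    simp [linSub]

end Auxiliary

section Extraction

open MvPolynomial

variable {κ ι K : Type*} [Fintype κ] [Fintype ι] [DecidableEq κ] [DecidableEq ι] [Field K]

/-- Dehomogenise with respect to the coordinate `b`, separating off the coordinate `a`. -/
noncomputable def dehom (κ : Type*) (a b : ι) :
    MvPolynomial (κ × ι) ℤ →ₐ[ℤ] MvPolynomial (κ × ι) (MvPolynomial κ ℤ) :=
  aeval fun p => if p.2 = a then C (X p.1) else if p.2 = b then 1 else X p

omit [Fintype κ] [DecidableEq κ] [Fintype ι] [DecidableEq ι] [Field K] in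
theorem monomial_eq_C_mul_prod {σ R : Type*} [CommRing R] [Fintype σ] (s : σ →₀ ℕ) (c : R) :
    monomial s c = C c * ∏ i, X i ^ s i := by
  rw [monomial_eq, Finsupp.prod_fintype _ _ (by simp)]

omit [DecidableEq κ] in
theorem dehom_monomial (a b : ι) (e : κ × ι →₀ ℕ) (c : ℤ) :
    dehom κ a b (monomial e c) =
      monomial (e.filter fun p => p.2 ≠ a ∧ p.2 ≠ b)
        (monomial (Finsupp.equivFunOnFinite.symm fun k => e (k, a)) c) := by
  rw [dehom, aeval_monomial, Finsupp.prod_fintype _ _ (by simp), Fintype.prod_prod_type,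
    monomial_eq_C_mul_prod (Finsupp.filter _ _),
    monomial_eq_C_mul_prod (Finsupp.equivFunOnFinite.symm _), Fintype.prod_prod_type, map_mul,
    mul_assoc, map_prod, ← Finset.prod_mul_distrib, IsScalarTower.algebraMap_apply ℤ
      (MvPolynomial κ ℤ), algebraMap_eq, algebraMap_eq]
  congr 1
  refine Finset.prod_congr rfl fun k _ => ?_
  rw [← Finset.mul_prod_erase _ _ (Finset.mem_univ a),
    ← Finset.mul_prod_erase _ (fun i => X (k, i) ^ _) (Finset.mem_univ a)]
  rw [Finsupp.filter_apply_neg _ _ (by simp), pow_zero, one_mul]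
  simp only [if_true, map_pow, Finsupp.equivFunOnFinite_symm_apply_apply]
  congr 1
  refine Finset.prod_congr rfl fun i hi => ?_
  have hia := (Finset.mem_erase.1 hi).1
  rw [if_neg hia]
  by_cases hib : i = b
  · rw [if_pos hib, one_pow, Finsupp.filter_apply_neg _ _ (by simp [hib]), pow_zero]
  · rw [if_neg hib, Finsupp.filter_apply_pos _ _ (by exact ⟨hia, hib⟩)]

theorem coeff_coeff_dehom (a b : ι) (P : MvPolynomial (κ × ι) ℤ) (q : κ × ι →₀ ℕ) (r : κ →₀ ℕ) :
    coeff r (coeff q (dehom κ a b P)) = ∑ e ∈ P.support,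
      if (e.filter fun p => p.2 ≠ a ∧ p.2 ≠ b) = q ∧
        (Finsupp.equivFunOnFinite.symm fun k => e (k, a)) = r then coeff e P else 0 := by
  conv_lhs => rw [P.as_sum]
  rw [map_sum, coeff_sum, coeff_sum]
  refine Finset.sum_congr rfl fun e _ => ?_
  rw [dehom_monomial, coeff_monomial]
  by_cases h : (e.filter fun p => p.2 ≠ a ∧ p.2 ≠ b) = q
  · simp [h, coeff_monomial]
  · simp [h]

theorem dehom_ne_zero (a b : ι) {P : MvPolynomial (κ × ι) ℤ} (hP : P ≠ 0)
    {d : κ → ℕ} (hd : IsWeightedHomogeneous (blockWeight κ ι) P d) : dehom κ a b P ≠ 0 := by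
  obtain ⟨e₀, he₀⟩ := ne_zero_iff.1 hP
  intro h0
  have h1 := coeff_coeff_dehom a b P (e₀.filter fun p => p.2 ≠ a ∧ p.2 ≠ b)
    (Finsupp.equivFunOnFinite.symm fun k => e₀ (k, a))
  rw [h0, coeff_zero, coeff_zero, Finset.sum_eq_single e₀] at h1
  · rw [if_pos ⟨rfl, rfl⟩] at h1
    exact he₀ h1.symm
  · intro e he hne
    refine if_neg fun h => hne ?_
    have ha : ∀ k, e (k, a) = e₀ (k, a) := fun k => DFunLike.congr_fun h.2 k
    have ho : ∀ k i, i ≠ a → i ≠ b → e (k, i) = e₀ (k, i) := by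
      intro k i hia hib
      have := DFunLike.congr_fun h.1 (k, i)
      rwa [Finsupp.filter_apply_pos _ _ (by exact ⟨hia, hib⟩),
        Finsupp.filter_apply_pos _ _ (by exact ⟨hia, hib⟩)] at this
    ext ⟨k, i⟩
    by_cases hia : i = a
    · rw [hia, ha]
    by_cases hib : i = b
    · have h2 : ∑ i, e (k, i) = ∑ i, e₀ (k, i) := by
        rw [← weight_blockWeight, ← weight_blockWeight, hd (mem_support_iff.1 he), hd he₀]
      rw [← Finset.add_sum_erase _ _ (Finset.mem_univ b),
        ← Finset.add_sum_erase _ (fun i => e₀ (k, i)) (Finset.mem_univ b)] at h2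
      have h3 : ∑ i ∈ Finset.univ.erase b, e (k, i) = ∑ i ∈ Finset.univ.erase b, e₀ (k, i) := by
        refine Finset.sum_congr rfl fun i hi => ?_
        by_cases hia : i = a
        · rw [hia, ha]
        · exact ho k i hia (Finset.mem_erase.1 hi).1
      rw [h3] at h2
      rw [hib]
      exact Nat.add_right_cancel h2
    · exact ho k i hia hib
  · intro h
    rw [notMem_support_iff.1 h, ite_self]

omit [Fintype ι] [Fintype κ] [DecidableEq κ] in
theorem lone_coeff_dehom_le (a b : ι) (P : MvPolynomial (κ × ι) ℤ) (q : κ × ι →₀ ℕ) :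
    lone κ (coeff q (dehom κ a b P)) ≤ lone _ P := by
  let N : RingSeminorm (MvPolynomial (κ × ι) (MvPolynomial κ ℤ)) :=
    wseminorm (lone κ) (fun _ => 1) (fun _ => zero_le_one)
  have hC : ∀ x, N (C x) = lone κ x := fun x => wseminorm_C _ _ _ _
  have h1 : lone κ (coeff q (dehom κ a b P)) ≤ N (dehom κ a b P) := by
    have := coeff_le_wseminorm (lone κ) (fun _ : κ × ι => (1 : ℝ)) (fun _ => zero_le_one)
      (dehom κ a b P) q
    simpa using this
  refine h1.trans ?_
  refine RingSeminorm.eval₂_le intSeminorm N ?_ _ (fun c => ?_) _ _ _ (fun p => ?_) P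
  · rw [← C_1, hC, lone_one]
  · rw [IsScalarTower.algebraMap_apply ℤ (MvPolynomial κ ℤ), algebraMap_eq, algebraMap_eq, hC, lone,
      wseminorm_C]
  · split_ifs
    · rw [hC, lone, wseminorm_X, intSeminorm_apply]; simp
    · rw [← C_1, hC, lone_one]
    · simp only [N]
      rw [wseminorm_X, lone_one, one_mul]

/-- The restriction of a form to a family of affine hyperplanes transverse to the `a`-th
coordinates. -/
noncomputable def restrict (a b : ι) (ξ : κ → K) (η : κ → ι → K) :
    MvPolynomial (κ × ι) ℤ →ₐ[ℤ] MvPolynomial (κ × ι) (MvPolynomial κ K) :=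
  aeval fun p => if p.2 = a then C (X p.1 + C (ξ p.1)) +
    ∑ o ∈ Finset.univ.filter (fun o => o ≠ a ∧ o ≠ b), C (C (η p.1 o)) * X (p.1, o)
    else if p.2 = b then 1 else X p

theorem exists_coeff_restrict (a b : ι) {P : MvPolynomial (κ × ι) ℤ} (hP : P ≠ 0)
    {d : κ → ℕ} (hd : IsWeightedHomogeneous (blockWeight κ ι) P d) (ξ : κ → K) (η : κ → ι → K) :
    ∃ (Q : MvPolynomial κ ℤ) (q : κ × ι →₀ ℕ), Q ≠ 0 ∧ (∀ k, degreeOf k Q ≤ d k) ∧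
      lone _ Q ≤ lone _ P ∧ coeff q (restrict a b ξ η P) = mvshift ξ Q := by
  have h0 := dehom_ne_zero a b hP hd
  obtain ⟨q, hq, hmin⟩ := Finset.exists_min_image (dehom κ a b P).support Finsupp.degree
    (support_nonempty.2 h0)
  refine ⟨coeff q (dehom κ a b P), q, mem_support_iff.1 hq, fun k => ?_,
    lone_coeff_dehom_le a b P q, ?_⟩
  · rw [degreeOf_le_iff]
    intro r hr
    rw [mem_support_iff, coeff_coeff_dehom] at hr
    obtain ⟨e, he, hne⟩ := Finset.exists_ne_zero_of_sum_ne_zero hr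
    have h1 : (Finsupp.equivFunOnFinite.symm fun k => e (k, a)) = r := by
      by_contra hc
      exact hne (if_neg fun h => hc h.2)
    rw [← h1, ← hd (mem_support_iff.1 he), weight_blockWeight]
    exact Finset.single_le_sum (f := fun i => e (k, i)) (fun _ _ => Nat.zero_le _)
      (Finset.mem_univ a)
  · let ψ : MvPolynomial κ ℤ →+* MvPolynomial (κ × ι) (MvPolynomial κ K) :=
      (aeval fun k => C (X k + C (ξ k)) + ∑ o ∈ Finset.univ.filter (fun o => o ≠ a ∧ o ≠ b),
        C (C (η k o)) * X (k, o) : MvPolynomial κ ℤ →ₐ[ℤ] _).toRingHom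
    have hψ : ∀ p, coeff 0 (ψ p) = mvshift ξ p := by
      have : (constantCoeff : MvPolynomial (κ × ι) (MvPolynomial κ K) →+* _).comp ψ =
          (mvshift ξ : MvPolynomial κ ℤ →ₐ[ℤ] _).toRingHom := by
        apply ringHom_ext
        · intro c; simp
        · intro k
          simp [ψ, mvshift]
      intro p
      have h2 := DFunLike.congr_fun this p
      exact h2
    have hcomp : restrict a b ξ η P = eval₂ ψ X (dehom κ a b P) := by
      have : (restrict a b ξ η).toRingHom = (eval₂Hom ψ X).comp (dehom κ a b).toRingHom := by
        apply ringHom_ext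
        · intro c; simp
        · intro p
          simp only [restrict, dehom, AlgHom.toRingHom_eq_coe, RingHom.coe_coe, aeval_X,
            RingHom.comp_apply]
          split_ifs <;> simp [ψ]
      exact DFunLike.congr_fun this P
    rw [hcomp, eval₂_eq, coeff_sum, Finset.sum_eq_single q]
    · have h3 : (∏ i ∈ q.support, X i ^ q i : MvPolynomial (κ × ι) (MvPolynomial κ K)) =
          monomial q 1 := by rw [monomial_eq, C_1, one_mul]; rfl
      rw [h3, coeff_mul_monomial', if_pos le_rfl, tsub_self, mul_one, hψ]
    · intro q' hq' hne
      have h3 : (∏ i ∈ q'.support, X i ^ q' i : MvPolynomial (κ × ι) (MvPolynomial κ K)) =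
          monomial q' 1 := by rw [monomial_eq, C_1, one_mul]; rfl
      rw [h3, coeff_mul_monomial', if_neg]
      intro hle
      have h4 := hmin q' hq'
      obtain ⟨s, rfl⟩ := exists_add_of_le hle
      rw [map_add] at h4
      have h5 : s.degree = 0 := by omega
      rw [Finsupp.degree_eq_zero_iff] at h5
      exact hne (by rw [h5, add_zero])
    · intro h
      exact absurd hq h

end Extraction

section LowIdeal

open MvPolynomial

variable {K : Type*} [Field K] {m : ℕ}

/-- Polynomials all of whose coefficients of weighted degree less than `t` vanish. -/
def lowIdeal (K : Type*) [Field K] (d : Fin m → ℕ) (t : ℝ) : Ideal (MvPolynomial (Fin m) K) where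
  carrier := {p | ∀ i, wt d i < t → coeff i p = 0}
  add_mem' hp hq i hi := by rw [coeff_add, hp i hi, hq i hi, add_zero]
  zero_mem' i _ := coeff_zero i
  smul_mem' p q hq i hi := by
    classical
    rw [smul_eq_mul, coeff_mul]
    refine Finset.sum_eq_zero fun x hx => ?_
    have h1 := Finset.HasAntidiagonal.mem_antidiagonal.1 hx
    rw [hq x.2, mul_zero]
    refine lt_of_le_of_lt ?_ hi
    rw [← h1, wt_add]
    exact le_add_of_nonneg_left (wt_nonneg d x.1)

theorem mem_lowIdeal {d : Fin m → ℕ} {t : ℝ} {p : MvPolynomial (Fin m) K} :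
    p ∈ lowIdeal K d t ↔ ∀ i, wt d i < t → coeff i p = 0 := Iff.rfl

theorem coeff_eval₂_C_mem {A σ τ : Type*} [CommRing A] (I : Ideal A)
    (f : σ → MvPolynomial τ A) {p : MvPolynomial σ A} (hp : ∀ r, coeff r p ∈ I) (r : τ →₀ ℕ) :
    coeff r (eval₂ C f p) ∈ I := by
  rw [eval₂_eq, coeff_sum]
  refine Ideal.sum_mem _ fun s _ => ?_
  rw [coeff_C_mul]
  exact Ideal.mul_mem_right _ _ (hp s)

end LowIdeal

section Param

open MvPolynomial

variable {κ ι μ K : Type*} [Fintype κ] [Fintype ι] [DecidableEq ι] [Fintype μ] [Field K]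

/-- Evaluation of a form at generic points of the spans of the vectors `g k l`, perturbed in the
direction of the coordinate `a`. -/
noncomputable def spanSub (a : ι) (g : κ → μ → ι → K) :
    MvPolynomial (κ × ι) ℤ →ₐ[ℤ] MvPolynomial (κ × μ) (MvPolynomial κ K) :=
  aeval fun p => (∑ l, C (C (g p.1 l p.2)) * X (p.1, l)) + if p.2 = a then C (X p.1) else 0

omit [Fintype κ] in
theorem exists_restrict_eq {a b : ι} (hab : a ≠ b) {g : κ → μ → ι → K} {y : κ → ι → K}
    (hy : ∀ k, y k a ≠ 0)
    (hg : ∀ k x, ∑ i, y k i * x i = 0 → x ∈ Submodule.span K (Set.range (g k))) :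
    ∃ f : κ × μ → MvPolynomial (κ × ι) (MvPolynomial κ K), ∀ P : MvPolynomial (κ × ι) ℤ,
      restrict a b (fun k => -(y k b / y k a)) (fun k o => -(y k o / y k a)) P =
        eval₂ C f (spanSub a g P) := by
  have h1 : ∀ k o, ∃ G : μ → K, o ≠ a →
      ∑ l, G l • g k l = Pi.single o 1 - (y k o / y k a) • Pi.single a 1 := by
    intro k o
    by_cases hoa : o = a
    · exact ⟨0, fun h => absurd hoa h⟩
    · have h2 := hg k (Pi.single o 1 - (y k o / y k a) • Pi.single a 1) (by
        simp only [Pi.sub_apply, Pi.smul_apply, smul_eq_mul, mul_sub, Finset.sum_sub_distrib,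
          Pi.single_apply, mul_ite, mul_one, mul_zero, Finset.sum_ite_eq', Finset.mem_univ, if_true]
        rw [mul_div_cancel₀ _ (hy k), sub_self])
      obtain ⟨G, hG⟩ := (Submodule.mem_span_range_iff_exists_fun K).1 h2
      exact ⟨G, fun _ => hG⟩
  choose G hG using h1
  let s : κ → ι → MvPolynomial (κ × ι) (MvPolynomial κ K) := fun k o =>
    if o = b then 1 else X (k, o)
  refine ⟨fun p => ∑ o ∈ Finset.univ.erase a, C (C (G p.1 o p.2)) * s p.1 o, fun P => ?_⟩
  have h3 : (restrict a b (fun k => -(y k b / y k a)) (fun k o => -(y k o / y k a)) :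
      MvPolynomial (κ × ι) ℤ →ₐ[ℤ] MvPolynomial (κ × ι) (MvPolynomial κ K)).toRingHom =
      (eval₂Hom C fun p : κ × μ => ∑ o ∈ Finset.univ.erase a, C (C (G p.1 o p.2)) * s p.1 o).comp
        (spanSub a g).toRingHom := by
    apply ringHom_ext
    · intro c; simp
    · rintro ⟨k, i⟩
      simp only [restrict, spanSub, AlgHom.toRingHom_eq_coe, RingHom.coe_coe, aeval_X,
        RingHom.comp_apply, map_add, map_sum, map_mul, eval₂Hom_C, eval₂Hom_X']
      have h4 : ∑ l, C (C (g k l i)) * ∑ o ∈ Finset.univ.erase a, C (C (G k o l)) * s k o =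
          ∑ o ∈ Finset.univ.erase a, C (C (((Pi.single o 1 : ι → K) - (y k o / y k a) • Pi.single a 1 : ι → K) i))
            * s k o := by
        simp only [Finset.mul_sum]
        rw [Finset.sum_comm]
        refine Finset.sum_congr rfl fun o ho => ?_
        rw [← hG k o (Finset.ne_of_mem_erase ho), Finset.sum_apply, map_sum, map_sum,
          Finset.sum_mul]
        refine Finset.sum_congr rfl fun l _ => ?_
        rw [Pi.smul_apply, smul_eq_mul, map_mul, map_mul]
        ring
      rw [h4]
      by_cases hia : i = a
      · subst hia
        have h5 : (Finset.univ.erase i).filter (fun o => o ≠ b) =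
            Finset.univ.filter (fun o => o ≠ i ∧ o ≠ b) := by
          ext o; simp
        rw [if_pos rfl, if_pos rfl, eval₂Hom_C, add_comm, ← h5,
          ← Finset.sum_erase_add _ _ (Finset.mem_erase.2 ⟨hab.symm, Finset.mem_univ b⟩),
          Finset.filter_ne']
        have h6 : ∀ x, x ≠ i → ((Pi.single x 1 - (y k x / y k i) • Pi.single i 1 : ι → K) i) =
            -(y k x / y k i) := fun x hx => by simp [hx.symm]
        have h7 : s k b = 1 := if_pos rfl
        have h8 : ∑ x ∈ (Finset.univ.erase i).erase b, C (C ((Pi.single x 1 -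
            (y k x / y k i) • Pi.single i 1 : ι → K) i)) * s k x =
            ∑ x ∈ (Finset.univ.erase i).erase b, C (C (-(y k x / y k i))) * X (k, x) := by
          refine Finset.sum_congr rfl fun x hx => ?_
          have hx' := Finset.mem_erase.1 hx
          rw [h6 x (Finset.ne_of_mem_erase hx'.2)]
          exact congrArg _ (if_neg hx'.1)
        rw [h6 b hab.symm, h7, mul_one, h8, add_assoc, add_comm (C (X k))]
      · rw [if_neg hia, if_neg hia, map_zero, add_zero]
        rw [Finset.sum_eq_single i]
        · simp [s, hia]
        · intro o _ hoi
          simp [hia, Ne.symm hoi]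
        · intro h; simp [hia] at h
  exact DFunLike.congr_fun h3 P

end Param

section SizeEstimates

open MvPolynomial

/-- The ring seminorm underlying an absolute value. -/
def AbsoluteValue.toRingSeminorm {K : Type*} [CommRing K] (f : AbsoluteValue K ℝ) :
    RingSeminorm K where
  toFun := f
  map_zero' := f.map_zero
  add_le' := f.add_le
  neg' := f.map_neg
  mul_le' x y := (f.map_mul x y).le

theorem AbsoluteValue.intCast_le {K : Type*} [CommRing K] [IsDomain K] (f : AbsoluteValue K ℝ)
    (n : ℤ) : f n ≤ |(n : ℝ)| := by
  have h : ∀ n : ℕ, f n ≤ n := fun n => by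
    induction n with
    | zero => simp
    | succ k ih =>
      push_cast
      exact (f.add_le _ _).trans (add_le_add ih f.map_one.le)
  obtain ⟨k, rfl | rfl⟩ := n.eq_nat_or_neg
  · simpa using h k
  · simpa using h k

theorem RingSeminorm.aeval_le_exp {σ A : Type*} [Fintype σ] [CommRing A] [Algebra ℤ A] (N : RingSeminorm A)
    (h1 : N 1 ≤ 1) (hN : ∀ n : ℤ, N n ≤ |(n : ℝ)|) (P : MvPolynomial σ ℤ) (z : σ → A) (w : σ → ℝ)
    (hz : ∀ p, N (z p) ≤ Real.exp (w p)) (W : ℝ)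
    (hW : ∀ e, coeff e P ≠ 0 → ∑ p, w p * e p ≤ W) :
    N (aeval z P) ≤ lone σ P * Real.exp W := by
  refine (RingSeminorm.eval₂_le intSeminorm N h1 (algebraMap ℤ A) (fun n => ?_) z
    (fun p => Real.exp (w p)) (fun _ => (Real.exp_pos _).le) hz P).trans ?_
  · rw [eq_intCast, intSeminorm_apply]; exact hN n
  · rw [wseminorm_le_sum_of_support, lone_eq_sum, Finset.sum_mul]
    refine Finset.sum_le_sum fun e he => ?_
    rw [intSeminorm_apply]
    refine mul_le_mul_of_nonneg_left ?_ (abs_nonneg _)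
    rw [Finsupp.prod_fintype _ _ (by simp)]
    simp only [← Real.exp_nat_mul]
    rw [← Real.exp_sum]
    refine Real.exp_le_exp.2 (le_trans (le_of_eq ?_) (hW e (mem_support_iff.1 he)))
    exact Finset.sum_congr rfl fun p _ => mul_comm _ _

theorem lone_linSub_le {κ ι : Type*} [Fintype κ] [Fintype ι] [DecidableEq κ] (M : Matrix ι ι ℤ) {c : ℝ}
    (hc : ∀ i, ∑ j, |(M i j : ℝ)| ≤ c) (hc0 : 0 < c) {P : MvPolynomial (κ × ι) ℤ} {d : κ → ℕ}
    (hP : IsWeightedHomogeneous (blockWeight κ ι) P d) :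
    lone _ (linSub κ M P) ≤ lone _ P * c ^ ∑ k, d k := by
  have h := RingSeminorm.aeval_le_exp (lone (κ × ι)) (lone_one _).le (fun n => by
    rw [← eq_intCast (C : ℤ →+* MvPolynomial (κ × ι) ℤ), lone, wseminorm_C, intSeminorm_apply]) P
    (fun p : κ × ι => ∑ j, C (M p.2 j) * X (p.1, j)) (fun _ => Real.log c) (fun p => by
      rw [Real.exp_log hc0]
      refine ((lone (κ × ι)).map_sum_le_sum _ _).trans (le_trans (Finset.sum_le_sum fun j _ => ?_)
        (hc p.2))
      refine (map_mul_le_mul _ _ _).trans (le_of_eq ?_)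
      rw [lone, wseminorm_C, wseminorm_X]
      simp [intSeminorm_apply]) ((∑ k, d k : ℕ) * Real.log c) (fun e he => by
        rw [← Finset.mul_sum, mul_comm]
        refine le_of_eq ?_
        congr 1
        rw [← hP he]
        push_cast
        rw [Fintype.sum_prod_type]
        refine Finset.sum_congr rfl fun k _ => ?_
        rw [weight_blockWeight]
        push_cast
        rfl)
  rwa [Real.exp_nat_mul, Real.exp_log hc0] at h

theorem aeval_linSub {κ ι A : Type*} [Fintype κ] [Fintype ι] [DecidableEq ι] [CommRing A]
    [Algebra ℤ A] (L M : Matrix ι ι ℤ)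
    (h : M * L = 1) (x : κ × ι → A) (P : MvPolynomial (κ × ι) ℤ) :
    aeval (fun p : κ × ι => ∑ j, (L p.2 j : A) * x (p.1, j)) (linSub κ M P) = aeval x P := by
  have : (aeval (fun p : κ × ι => ∑ j, (L p.2 j : A) * x (p.1, j))).comp (linSub κ M) =
      (aeval x : MvPolynomial (κ × ι) ℤ →ₐ[ℤ] A) := by
    apply algHom_ext
    rintro ⟨k, i⟩
    have h1 : ∀ j, ∑ l, ((M i l : ℤ) : A) * ((L l j : ℤ) : A) = ((1 : Matrix ι ι ℤ) i j : ℤ) := by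
      intro j
      rw [← h, Matrix.mul_apply]
      push_cast
      rfl
    have h2 : ∀ n : ℤ, aeval (fun p : κ × ι => ∑ j, (L p.2 j : A) * x (p.1, j)) (C n : MvPolynomial (κ × ι) ℤ) = (n : A) :=
      fun n => by rw [aeval_C, eq_intCast]
    rw [linSub, AlgHom.comp_apply, aeval_X, aeval_X, map_sum]
    simp only [map_mul, h2, aeval_X, Finset.mul_sum, ← mul_assoc]
    rw [Finset.sum_comm]
    simp only [← Finset.sum_mul, h1, Matrix.one_apply]
    simp
  exact DFunLike.congr_fun this P

end SizeEstimates

section Machine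

open MvPolynomial

variable {ι μ K : Type*} [Fintype ι] [DecidableEq ι] [Fintype μ] [Field K] {m : ℕ}

theorem linear_spanSub (a : ι) (g : Fin m → μ → ι → K) (r : ι → ℤ) (k : Fin m) :
    ∑ j, (r j : MvPolynomial (Fin m × μ) (MvPolynomial (Fin m) K)) *
      ((∑ l, C (C (g k l j)) * X (k, l)) + if j = a then C (X k) else 0) =
    (∑ l, C (C (∑ j, (r j : K) * g k l j)) * X (k, l)) + C (C ((r a : K)) * X k) := by
  simp only [mul_add, Finset.sum_add_distrib, Finset.mul_sum, mul_ite, mul_zero,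
    Finset.sum_ite_eq', Finset.mem_univ, if_true]
  congr 1
  · rw [Finset.sum_comm]
    refine Finset.sum_congr rfl fun l _ => ?_
    rw [map_sum, map_sum, Finset.sum_mul]
    refine Finset.sum_congr rfl fun j _ => ?_
    simp only [map_mul, map_intCast]
    ring
  · simp

theorem abv_coeff_spanSub_le (f : AbsoluteValue K ℝ) {L M : Matrix ι ι ℤ} (hML : M * L = 1)
    {P : MvPolynomial (Fin m × ι) ℤ} {d : Fin m → ℕ}
    (hP : IsWeightedHomogeneous (blockWeight (Fin m) ι) P d)
    {C₀ C₂ B D ε W : ℝ} (hC₀ : 0 < C₀) (hM : ∀ i, ∑ j, |(M i j : ℝ)| ≤ C₀)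
    (hC₂ : 0 < C₂) (a : ι) (hL : ∀ i, Fintype.card μ + |(L i a : ℝ)| ≤ C₂) (c : ι → ℝ)
    (hB : ∀ i, |c i| ≤ B) (hε : 0 ≤ ε) {h : Fin m → ℝ} (hd : ∀ k, 1 ≤ d k)
    (hh : ∀ k, 0 ≤ h k) (hD : ∀ k, h k * d k ≤ D) (hD' : ∀ k, D - h k ≤ h k * d k)
    {g : Fin m → μ → ι → K}
    (hg : ∀ k l i, f (∑ j, (L i j : K) * g k l j) ≤ Real.exp ((c i + ε) * h k))
    (hW : ∀ e, coeff e (linSub (Fin m) M P) ≠ 0 →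
      ∑ k, ∑ i, c i * ((e (k, i) : ℝ) / d k) ≤ W) (hB0 : 0 ≤ B) (hD0 : 0 ≤ D)
    (r : Fin m × μ →₀ ℕ) (s : Fin m →₀ ℕ) :
    f (coeff s (coeff r (spanSub a g P))) ≤ lone _ P * C₀ ^ (∑ k, d k) *
      Real.exp ((∑ k, d k : ℕ) * Real.log C₂ + B * ∑ k, h k + D * W + ε * D * m +
        B * D * wt d s) := by
  obtain ⟨R, hR⟩ : ∃ R : Fin m → ℝ, R = fun k => Real.exp (-(B * h k)) := ⟨_, rfl⟩
  have hR0 : ∀ k, 0 ≤ R k := fun k => by rw [hR]; exact (Real.exp_pos _).le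
  obtain ⟨N₁, hN₁⟩ : ∃ N₁ : RingSeminorm (MvPolynomial (Fin m) K),
    N₁ = wseminorm f.toRingSeminorm R hR0 := ⟨_, rfl⟩
  obtain ⟨N, hN⟩ : ∃ N : RingSeminorm (MvPolynomial (Fin m × μ) (MvPolynomial (Fin m) K)),
    N = wseminorm N₁ (fun _ => 1) (fun _ => zero_le_one) := ⟨_, rfl⟩
  have hNC : ∀ x, N (C x) = N₁ x := fun x => by rw [hN, wseminorm_C]
  have hN₁C : ∀ x, N₁ (C x) = f x := fun x => by rw [hN₁, wseminorm_C]; rfl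
  have hN₁X : ∀ k, N₁ (X k) = R k := fun k => by
    rw [hN₁, wseminorm_X]
    change f 1 * _ = _
    rw [f.map_one, one_mul]
  have hN₁1 : N₁ 1 = 1 := by rw [← C_1, hN₁C, f.map_one]
  have hN1 : N 1 = 1 := by rw [← C_1, hNC, hN₁1]
  have hNX : ∀ p, N (X p) = 1 := fun p => by rw [hN, wseminorm_X, hN₁1, one_mul]
  -- size of the substituted linear forms
  have hz : ∀ p : Fin m × ι, N (∑ j, (L p.2 j : MvPolynomial (Fin m × μ) (MvPolynomial (Fin m) K)) *
      ((∑ l, C (C (g p.1 l j)) * X (p.1, l)) + if j = a then C (X p.1) else 0)) ≤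
      Real.exp (Real.log C₂ + (c p.2 + ε) * h p.1) := by
    rintro ⟨k, i⟩
    rw [linear_spanSub, Real.exp_add, Real.exp_log hC₂]
    refine (map_add_le_add _ _ _).trans ?_
    refine le_trans ?_ (mul_le_mul_of_nonneg_right (hL i) (Real.exp_pos _).le)
    rw [add_mul]
    refine add_le_add ?_ ?_
    · refine (N.map_sum_le_sum _ _).trans ?_
      rw [← nsmul_eq_mul, Fintype.card, ← Finset.sum_const]
      refine Finset.sum_le_sum fun l _ => (map_mul_le_mul _ _ _).trans ?_
      rw [hNC, hN₁C, hNX, mul_one]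
      exact hg k l i
    · rw [hNC]
      refine (map_mul_le_mul _ _ _).trans ?_
      rw [hN₁C, hN₁X, hR]
      refine mul_le_mul (f.intCast_le _) (Real.exp_le_exp.2 ?_) (Real.exp_pos _).le (abs_nonneg _)
      have := neg_le_of_abs_le (hB i)
      nlinarith [hh k]
  have hsum : ∀ e, coeff e (linSub (Fin m) M P) ≠ 0 → ∀ k, ∑ i, e (k, i) = d k := fun e he k => by
    rw [← weight_blockWeight, isWeightedHomogeneous_linSub M hP he]
  have hWt : ∀ e, coeff e (linSub (Fin m) M P) ≠ 0 →
      ∑ p : Fin m × ι, (Real.log C₂ + (c p.2 + ε) * h p.1) * e p ≤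
        (∑ k, d k : ℕ) * Real.log C₂ + B * ∑ k, h k + D * W + ε * D * m := by
    intro e he
    have h1 : ∑ p : Fin m × ι, (Real.log C₂ + (c p.2 + ε) * h p.1) * e p =
        (∑ k, d k : ℕ) * Real.log C₂ + ε * (∑ k, h k * d k) + ∑ k, ∑ i, c i * h k * e (k, i) := by
      rw [Fintype.sum_prod_type]
      push_cast
      rw [Finset.sum_mul, Finset.mul_sum, ← Finset.sum_add_distrib, ← Finset.sum_add_distrib]
      refine Finset.sum_congr rfl fun k _ => ?_
      rw [← hsum e he k]
      push_cast
      rw [Finset.sum_mul, Finset.mul_sum, Finset.mul_sum, ← Finset.sum_add_distrib,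
        ← Finset.sum_add_distrib]
      exact Finset.sum_congr rfl fun i _ => by ring
    have h2 : ∑ k, h k * d k ≤ D * m := by
      refine (Finset.sum_le_sum fun k _ => hD k).trans (le_of_eq ?_)
      simp [mul_comm]
    have h3 : ∑ k, ∑ i, c i * h k * e (k, i) ≤ D * W + B * ∑ k, h k := by
      refine le_trans ?_ (add_le_add (mul_le_mul_of_nonneg_left (hW e he) hD0) le_rfl)
      rw [Finset.mul_sum, Finset.mul_sum, ← Finset.sum_add_distrib]
      refine Finset.sum_le_sum fun k _ => ?_
      have hdk : (0 : ℝ) < d k := by exact_mod_cast hd k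
      have h4 : B * h k = ∑ i, B * h k * ((e (k, i) : ℝ) / d k) := by
        rw [← Finset.mul_sum, ← Finset.sum_div]
        have : (∑ i, (e (k, i) : ℝ)) = d k := by exact_mod_cast hsum e he k
        rw [this, div_self hdk.ne', mul_one]
      rw [h4, Finset.mul_sum, ← Finset.sum_add_distrib]
      refine Finset.sum_le_sum fun i _ => ?_
      have h5 : (e (k, i) : ℝ) = d k * ((e (k, i) : ℝ) / d k) := by field_simp
      have h6 : 0 ≤ (e (k, i) : ℝ) / d k := by positivity
      have h7 : c i * h k * (e (k, i) : ℝ) = c i * (h k * d k) * ((e (k, i) : ℝ) / d k) := by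
        conv_lhs => rw [h5]
        ring
      rw [h7]
      have h8 : c i * (h k * d k) ≤ D * c i + B * h k := by
        have h9 := abs_le.1 (hB i)
        have h10 : 0 ≤ D - h k * d k := sub_nonneg.2 (hD k)
        have h11 : D - h k * d k ≤ h k := by linarith [hD' k]
        nlinarith [mul_nonneg h10 (by linarith [h9.1] : 0 ≤ c i + B),
          mul_nonneg (sub_nonneg.2 h11) hB0]
      calc _ ≤ (D * c i + B * h k) * ((e (k, i) : ℝ) / d k) := mul_le_mul_of_nonneg_right h8 h6
        _ = _ := by ring
    rw [h1]
    nlinarith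
  have key := RingSeminorm.aeval_le_exp N hN1.le (fun n => by
    rw [← map_intCast (C : MvPolynomial (Fin m) K →+* _), hNC, ← map_intCast (C : K →+* _), hN₁C]
    exact f.intCast_le n) (linSub (Fin m) M P) _ _ hz _ hWt
  have h12 : aeval (fun p : Fin m × ι => ∑ j,
      (L p.2 j : MvPolynomial (Fin m × μ) (MvPolynomial (Fin m) K)) *
      ((∑ l, C (C (g p.1 l j)) * X (p.1, l)) + if j = a then C (X p.1) else 0))
      (linSub (Fin m) M P) = spanSub a g P :=
    aeval_linSub L M hML (fun x : Fin m × ι => (∑ l, C (C (g x.1 l x.2)) * X (x.1, l)) +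
      if x.2 = a then C (X x.1) else 0) P
  rw [h12] at key
  have h13 := key.trans (mul_le_mul_of_nonneg_right (lone_linSub_le M hM hC₀ hP)
    (Real.exp_pos _).le)
  have h14 : N₁ (coeff r (spanSub a g P)) ≤ N (spanSub a g P) := by
    have := coeff_le_wseminorm N₁ (fun _ : Fin m × μ => (1 : ℝ)) (fun _ => zero_le_one)
      (spanSub a g P) r
    rw [← hN] at this
    simpa using this
  have h15 : f (coeff s (coeff r (spanSub a g P))) * Real.exp (-(B * D * wt d s)) ≤
      N₁ (coeff r (spanSub a g P)) := by
    have := coeff_le_wseminorm f.toRingSeminorm R hR0 (coeff r (spanSub a g P)) s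
    rw [← hN₁, Finsupp.prod_fintype _ _ (by simp), hR] at this
    refine le_trans (mul_le_mul_of_nonneg_left ?_ (f.nonneg _)) this
    simp only [← Real.exp_nat_mul]
    rw [← Real.exp_sum]
    refine Real.exp_le_exp.2 ?_
    rw [wt, Finset.mul_sum, ← Finset.sum_neg_distrib]
    refine Finset.sum_le_sum fun k _ => ?_
    have hdk : (0 : ℝ) < d k := by exact_mod_cast hd k
    have h16 : (s k : ℝ) * (B * h k) ≤ B * D * ((s k : ℝ) / d k) := by
      have h17 : (s k : ℝ) = d k * ((s k : ℝ) / d k) := by field_simp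
      calc (s k : ℝ) * (B * h k) = B * (h k * d k) * ((s k : ℝ) / d k) := by
            conv_lhs => rw [h17]
            ring
        _ ≤ _ := mul_le_mul_of_nonneg_right (mul_le_mul_of_nonneg_left (hD k) hB0)
            (by positivity)
    linarith
  rw [Real.exp_neg, ← div_eq_mul_inv, div_le_iff₀ (Real.exp_pos _)] at h15
  refine h15.trans ?_
  rw [Real.exp_add _ (B * D * wt d s), ← mul_assoc]
  exact mul_le_mul_of_nonneg_right (h14.trans h13) (Real.exp_pos _).le

omit [Fintype ι] in
theorem coeff_spanSub_mem (O : Subring K) (a : ι) {g : Fin m → μ → ι → K}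
    (hg : ∀ k l i, g k l i ∈ O) (P : MvPolynomial (Fin m × ι) ℤ) (r : Fin m × μ →₀ ℕ)
    (s : Fin m →₀ ℕ) : coeff s (coeff r (spanSub a g P)) ∈ O := by
  have h : spanSub a g P = map (map O.subtype)
      (aeval (fun p : Fin m × ι => (∑ l, C (C (⟨g p.1 l p.2, hg _ _ _⟩ : O)) * X (p.1, l)) +
        if p.2 = a then C (X p.1) else 0) P :
        MvPolynomial (Fin m × μ) (MvPolynomial (Fin m) O)) := by
    have : (spanSub a g).toRingHom = (map (map O.subtype)).comp
        (aeval (fun p : Fin m × ι => (∑ l, C (C (⟨g p.1 l p.2, hg _ _ _⟩ : O)) * X (p.1, l)) +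
        if p.2 = a then C (X p.1) else 0) : MvPolynomial (Fin m × ι) ℤ →ₐ[ℤ]
        MvPolynomial (Fin m × μ) (MvPolynomial (Fin m) O)).toRingHom := by
      apply ringHom_ext
      · intro c; simp
      · rintro ⟨k, i⟩
        simp only [spanSub, AlgHom.toRingHom_eq_coe, RingHom.coe_coe, aeval_X,
          RingHom.comp_apply, map_add, map_sum, map_mul, map_C, map_X]
        split_ifs <;> simp
    exact DFunLike.congr_fun this P
  rw [h, coeff_map, coeff_map]
  exact Subtype.property _

end Machine

/-- A finite family of absolute values on a field together with a subring on which the weighted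
product of these absolute values is at least one, and for which Minkowski's theorem on linear
forms holds. -/
structure PlaceData (K : Type*) [Field K] (S : Type*) [Fintype S] where
  abv : S → AbsoluteValue K ℝ
  e : S → ℕ
  e_pos : ∀ v, 0 < e v
  O : Subring K
  one_le_prod : ∀ x ∈ O, x ≠ 0 → 1 ≤ ∏ v, abv v x ^ e v
  exists_small : ∀ (n : ℕ) (L : S → Matrix (Fin n) (Fin n) ℤ), 0 < n → (∀ v, IsUnit (L v).det) →
    ∃ C : ℝ, 0 < C ∧ ∀ r : S → Fin n → ℝ, (∀ v i, 0 < r v i) → C ≤ ∏ v, ∏ i, r v i ^ e v →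
      ∃ x : Fin n → K, x ≠ 0 ∧ (∀ i, x i ∈ O) ∧ ∀ v i, abv v (∑ j, (L v i j : K) * x j) ≤ r v i

section Machine

open MvPolynomial

variable {ι μ K S : Type*} [Fintype ι] [DecidableEq ι] [Fintype μ] [Field K] [CharZero K]
  [Fintype S]

set_option maxHeartbeats 1000000 in
theorem PlaceData.parametric_bound [Nonempty ι] (𝔖 : PlaceData K S) (L M : S → Matrix ι ι ℤ)
    (hML : ∀ v, M v * L v = 1) (c : S → ι → ℝ) (hc : ∑ v, 𝔖.e v * ∑ i, c v i < 0) {c₀ : ℝ}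
    (hc₀ : 0 < c₀) : ∃ (m : ℕ) (ε A ω : ℝ), 0 < m ∧ 0 < ε ∧ ∀ (h : Fin m → ℝ)
      (g : Fin m → μ → ι → K) (y : Fin m → ι → K) (a b : ι), a ≠ b → (∀ k, A ≤ h k) →
      (∀ i j, i < j → ω * h j ≤ h i) → (∀ k l i, g k l i ∈ 𝔖.O) →
      (∀ v k l i, 𝔖.abv v (∑ j, (L v i j : K) * g k l j) ≤ Real.exp ((c v i + ε) * h k)) →
      (∀ k, y k a ≠ 0) →
      (∀ k x, ∑ i, y k i * x i = 0 → x ∈ Submodule.span K (Set.range (g k))) →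
      (∀ k, HB (-(y k b / y k a)) (c₀ * h k)) → False := by
  obtain ⟨κ, hκ⟩ : ∃ κ : ℝ, κ = -∑ v, 𝔖.e v * ∑ i, c v i := ⟨_, rfl⟩
  have hκ0 : 0 < κ := by rw [hκ]; linarith
  obtain ⟨n, hn⟩ : ∃ n : ℝ, n = Fintype.card ι := ⟨_, rfl⟩
  have hn0 : 0 < n := by rw [hn]; exact_mod_cast Fintype.card_pos
  obtain ⟨E, hE⟩ : ∃ E : ℝ, E = ∑ v, (𝔖.e v : ℝ) := ⟨_, rfl⟩
  have hE0 : 0 ≤ E := by rw [hE]; positivity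
  obtain ⟨B, hB⟩ : ∃ B : ℝ, B = 1 + ∑ v, ∑ i, |c v i| := ⟨_, rfl⟩
  have hcB : ∀ v i, |c v i| ≤ B := fun v i => by
    have h1 : |c v i| ≤ ∑ i, |c v i| :=
      Finset.single_le_sum (f := fun i => |c v i|) (fun _ _ => abs_nonneg _) (Finset.mem_univ i)
    have h2 : ∑ i, |c v i| ≤ ∑ v, ∑ i, |c v i| :=
      Finset.single_le_sum (f := fun v => ∑ i, |c v i|) (fun _ _ => by positivity)
        (Finset.mem_univ v)
    linarith
  have hB1 : 1 ≤ B := by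
    have : 0 ≤ ∑ v, ∑ i, |c v i| := by positivity
    linarith
  obtain ⟨C₀, hC₀⟩ : ∃ C : ℝ, C = 1 + ∑ v, ∑ i, ∑ j, |(M v i j : ℝ)| := ⟨_, rfl⟩
  have hMC : ∀ v i, ∑ j, |(M v i j : ℝ)| ≤ C₀ := fun v i => by
    have h1 : ∑ j, |(M v i j : ℝ)| ≤ ∑ i, ∑ j, |(M v i j : ℝ)| :=
      Finset.single_le_sum (f := fun i => ∑ j, |(M v i j : ℝ)|) (fun _ _ => by positivity)
        (Finset.mem_univ i)
    have h2 : ∑ i, ∑ j, |(M v i j : ℝ)| ≤ ∑ v, ∑ i, ∑ j, |(M v i j : ℝ)| :=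
      Finset.single_le_sum (f := fun v => ∑ i, ∑ j, |(M v i j : ℝ)|) (fun _ _ => by positivity)
        (Finset.mem_univ v)
    linarith
  have hC₀1 : 1 ≤ C₀ := by
    have : 0 ≤ ∑ v, ∑ i, ∑ j, |(M v i j : ℝ)| := by positivity
    linarith
  obtain ⟨C₂, hC₂⟩ : ∃ C : ℝ, C = 1 + Fintype.card μ + ∑ v, ∑ i, ∑ j, |(L v i j : ℝ)| := ⟨_, rfl⟩
  have hLC : ∀ v i a, Fintype.card μ + |(L v i a : ℝ)| ≤ C₂ := fun v i a => by
    have h0 : |(L v i a : ℝ)| ≤ ∑ j, |(L v i j : ℝ)| :=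
      Finset.single_le_sum (f := fun j => |(L v i j : ℝ)|) (fun _ _ => by positivity)
        (Finset.mem_univ a)
    have h1 : ∑ j, |(L v i j : ℝ)| ≤ ∑ i, ∑ j, |(L v i j : ℝ)| :=
      Finset.single_le_sum (f := fun i => ∑ j, |(L v i j : ℝ)|) (fun _ _ => by positivity)
        (Finset.mem_univ i)
    have h2 : ∑ i, ∑ j, |(L v i j : ℝ)| ≤ ∑ v, ∑ i, ∑ j, |(L v i j : ℝ)| :=
      Finset.single_le_sum (f := fun v => ∑ i, ∑ j, |(L v i j : ℝ)|) (fun _ _ => by positivity)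
        (Finset.mem_univ v)
    linarith
  have hC₂1 : 1 ≤ C₂ := by
    have : 0 ≤ ∑ v, ∑ i, ∑ j, |(L v i j : ℝ)| := by positivity
    have : (0 : ℝ) ≤ Fintype.card μ := by positivity
    linarith
  obtain ⟨δ, hδ⟩ : ∃ δ : ℝ, δ = κ / (4 * n * (E + 1)) := ⟨_, rfl⟩
  have hδ0 : 0 < δ := by rw [hδ]; positivity
  obtain ⟨m, C₁, hm, hC₁, haux⟩ := exists_auxiliary M c hδ0
  have hm0 : (1 : ℝ) ≤ m := by exact_mod_cast hm
  have hθ0 : 0 < δ / B * m := by positivity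
  obtain ⟨σ, hσ, hroth⟩ := roth_lemma (K := K) m (δ / B * m) hθ0
  obtain ⟨Λ, hΛ⟩ : ∃ Λ : ℝ, Λ = Real.log C₁ + Real.log C₀ + Real.log C₂ := ⟨_, rfl⟩
  have hC₁l := Real.log_nonneg hC₁
  have hC₀l := Real.log_nonneg hC₀1
  have hC₂l := Real.log_nonneg hC₂1
  have hΛ0 : 0 ≤ Λ := by rw [hΛ]; positivity
  obtain ⟨A, hA⟩ : ∃ A : ℝ, A = 1 + 16 * n * E * Λ / κ + 2 * m * Real.log C₁ / (σ * c₀) +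
      2 * m / (σ * c₀) := ⟨_, rfl⟩
  have hA1 : 0 < A := by rw [hA]; positivity
  have hAΛ : E * Λ ≤ A * (κ / (16 * n)) := by
    have : E * Λ = 16 * n * E * Λ / κ * (κ / (16 * n)) := by field_simp
    rw [this]
    refine mul_le_mul_of_nonneg_right ?_ (by positivity)
    have h1 : 0 ≤ 2 * m * Real.log C₁ / (σ * c₀) := by positivity
    have h2 : 0 ≤ 2 * m / (σ * c₀) := by positivity
    linarith
  have hAC : m * Real.log C₁ ≤ A * (σ * c₀ / 2) := by
    have : m * Real.log C₁ = 2 * m * Real.log C₁ / (σ * c₀) * (σ * c₀ / 2) := by field_simp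
    rw [this]
    refine mul_le_mul_of_nonneg_right ?_ (by positivity)
    have h1 : 0 ≤ 16 * n * E * Λ / κ := by positivity
    have h2 : 0 ≤ 2 * m / (σ * c₀) := by positivity
    linarith
  have hAm : m ≤ A * (σ * c₀ / 2) := by
    have : (m : ℝ) = 2 * m / (σ * c₀) * (σ * c₀ / 2) := by field_simp
    conv_lhs => rw [this]
    refine mul_le_mul_of_nonneg_right ?_ (by positivity)
    have h1 : 0 ≤ 16 * n * E * Λ / κ := by positivity
    have h2 : 0 ≤ 2 * m * Real.log C₁ / (σ * c₀) := by positivity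
    linarith
  refine ⟨m, δ, A, 2 / σ, hm, hδ0, ?_⟩
  intro h g y a b hab hAh hω hgO hg hy hspan hHB
  have hh : ∀ k, 0 < h k := fun k => hA1.trans_le (hAh k)
  obtain ⟨D, hD⟩ : ∃ D : ℝ, D = 1 + 2 * ∑ k, h k + 16 * n * E * B * (∑ k, h k) / κ := ⟨_, rfl⟩
  have hsum0 : 0 ≤ ∑ k, h k := Finset.sum_nonneg fun k _ => (hh k).le
  have hD0 : 0 < D := by rw [hD]; positivity
  have hDh : ∀ k, 2 * h k ≤ D := fun k => by
    have h1 : h k ≤ ∑ k, h k := Finset.single_le_sum (fun k _ => (hh k).le) (Finset.mem_univ k)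
    have h2 : 0 ≤ 16 * n * E * B * (∑ k, h k) / κ := by positivity
    linarith
  have hDE : E * B * ∑ k, h k ≤ D * m * (κ / (16 * n)) := by
    have : E * B * ∑ k, h k = 16 * n * E * B * (∑ k, h k) / κ * (κ / (16 * n)) := by field_simp
    rw [this]
    refine mul_le_mul_of_nonneg_right ?_ (by positivity)
    nlinarith
  obtain ⟨d, hd⟩ : ∃ d : Fin m → ℕ, d = fun k => ⌊D / h k⌋₊ := ⟨_, rfl⟩
  have hdle : ∀ k, (d k : ℝ) ≤ D / h k := fun k => by
    rw [hd]; exact Nat.floor_le (div_nonneg hD0.le (hh k).le)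
  have hdlt : ∀ k, D / h k < d k + 1 := fun k => by rw [hd]; exact Nat.lt_floor_add_one _
  have hd1 : ∀ k, 1 ≤ d k := fun k => by
    have h1 : 2 ≤ D / h k := (le_div_iff₀ (hh k)).2 (hDh k)
    have h2 := hdlt k
    have : (1 : ℝ) < d k + 1 := by linarith
    have : (0 : ℝ) < d k := by linarith
    exact_mod_cast this
  have hhd : ∀ k, h k * d k ≤ D := fun k => by
    have := hdle k
    rw [le_div_iff₀ (hh k)] at this
    linarith
  have hhd' : ∀ k, D - h k ≤ h k * d k := fun k => by
    have := hdlt k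
    rw [div_lt_iff₀ (hh k)] at this
    linarith
  have hhd2 : ∀ k, D / 2 ≤ h k * d k := fun k => by linarith [hhd' k, hDh k]
  have hsumd : A * (∑ k, d k : ℕ) ≤ m * D := by
    push_cast
    rw [Finset.mul_sum]
    calc ∑ k, A * (d k : ℝ) ≤ ∑ k : Fin m, D := Finset.sum_le_sum fun k _ =>
          (mul_le_mul_of_nonneg_right (hAh k) (Nat.cast_nonneg _)).trans (hhd k)
      _ = m * D := by simp
  obtain ⟨P, hP0, hPd, hPl, hPv⟩ := haux d hd1
  obtain ⟨f, hf⟩ := exists_restrict_eq hab hy hspan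
  have hvan : ∀ r, coeff r (spanSub a g P) ∈ lowIdeal K d (δ / B * m) := by
    intro r
    rw [mem_lowIdeal]
    intro s hs
    by_contra hne
    have hlow := 𝔖.one_le_prod _ (coeff_spanSub_mem 𝔖.O a hgO P r s) hne
    have hub : ∀ v, 𝔖.abv v (coeff s (coeff r (spanSub a g P))) ≤ Real.exp
        ((∑ k, d k : ℕ) * Λ + B * ∑ k, h k + D * m * ((∑ i, c v i) / n) + D * m * (3 * δ)) := by
      intro v
      refine (abv_coeff_spanSub_le (𝔖.abv v) (hML v) hPd (by linarith) (hMC v) (by linarith) a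
        (fun i => hLC v i a) (c v) (hcB v) hδ0.le hd1 (fun k => (hh k).le) hhd hhd' (hg v) (hPv v)
        (by linarith) hD0.le r s).trans ?_
      have h1 : C₀ ^ (∑ k, d k) = Real.exp ((∑ k, d k : ℕ) * Real.log C₀) := by
        rw [Real.exp_nat_mul, Real.exp_log (by linarith)]
      have h2 : lone _ P ≤ Real.exp ((∑ k, d k : ℕ) * Real.log C₁) := by
        rw [Real.exp_nat_mul, Real.exp_log (by linarith)]
        exact hPl
      rw [h1]
      refine (mul_le_mul_of_nonneg_right (mul_le_mul_of_nonneg_right h2 (Real.exp_pos _).le)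
        (Real.exp_pos _).le).trans ?_
      rw [← Real.exp_add, ← Real.exp_add]
      refine Real.exp_le_exp.2 ?_
      have h3 : B * D * wt d s ≤ D * m * δ := by
        have : D * m * δ = B * D * (δ / B * m) := by field_simp
        rw [this]
        exact mul_le_mul_of_nonneg_left hs.le (by positivity)
      rw [hΛ, ← hn]
      nlinarith
    have h4 : ∏ v, 𝔖.abv v (coeff s (coeff r (spanSub a g P))) ^ 𝔖.e v ≤ Real.exp (∑ v, 𝔖.e v *
        ((∑ k, d k : ℕ) * Λ + B * ∑ k, h k + D * m * ((∑ i, c v i) / n) + D * m * (3 * δ))) := by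
      rw [Real.exp_sum]
      refine Finset.prod_le_prod (fun v _ => by positivity) fun v _ => ?_
      rw [Real.exp_nat_mul]
      exact pow_le_pow_left₀ ((𝔖.abv v).nonneg _) (hub v) _
    have h5 : ∑ v, 𝔖.e v * ((∑ k, d k : ℕ) * Λ + B * ∑ k, h k + D * m * ((∑ i, c v i) / n) +
        D * m * (3 * δ)) = E * Λ * (∑ k, d k : ℕ) + E * B * ∑ k, h k + D * m * (-(κ / n)) +
        D * m * (3 * (E * δ)) := by
      simp only [mul_add, Finset.sum_add_distrib, ← Finset.sum_mul, ← hE]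
      have : ∑ v, (𝔖.e v : ℝ) * (D * m * ((∑ i, c v i) / n)) = D * m * (-(κ / n)) := by
        rw [hκ, neg_div, neg_neg, Finset.sum_div, Finset.mul_sum]
        exact Finset.sum_congr rfl fun v _ => by ring
      rw [this]
      ring
    have h6 : E * δ ≤ κ / (4 * n) := by
      rw [hδ]
      have : κ / (4 * n) = (E + 1) * (κ / (4 * n * (E + 1))) := by field_simp
      rw [this]
      exact mul_le_mul_of_nonneg_right (by linarith) (by positivity)
    have h7 : E * Λ * (∑ k, d k : ℕ) ≤ D * m * (κ / (16 * n)) := by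
      calc E * Λ * (∑ k, d k : ℕ) ≤ A * (κ / (16 * n)) * (∑ k, d k : ℕ) :=
            mul_le_mul_of_nonneg_right hAΛ (Nat.cast_nonneg _)
        _ = (κ / (16 * n)) * (A * (∑ k, d k : ℕ)) := by ring
        _ ≤ (κ / (16 * n)) * (m * D) := mul_le_mul_of_nonneg_left hsumd (by positivity)
        _ = _ := by ring
    have h8 : Real.exp (∑ v, 𝔖.e v * ((∑ k, d k : ℕ) * Λ + B * ∑ k, h k +
        D * m * ((∑ i, c v i) / n) + D * m * (3 * δ))) < 1 := by
      rw [Real.exp_lt_one_iff, h5]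
      obtain ⟨q, hq⟩ : ∃ q, q = κ / (16 * n) := ⟨_, rfl⟩
      have hq0 : 0 < q := by rw [hq]; positivity
      have e1 : κ / n = 16 * q := by rw [hq]; field_simp
      have e2 : κ / (4 * n) = 4 * q := by rw [hq]; field_simp; norm_num
      rw [e2] at h6
      rw [← hq] at h7 hDE
      rw [e1]
      have h9 : D * m * (3 * (E * δ)) ≤ D * m * (12 * q) :=
        mul_le_mul_of_nonneg_left (by linarith) (by positivity)
      have h10 : 0 < D * m * q := by positivity
      nlinarith
    exact absurd hlow (not_le.2 (h4.trans_lt h8))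
  obtain ⟨Q, q, hQ0, hQd, hQl, hQ⟩ := exists_coeff_restrict a b hP0 hPd
    (fun k => -(y k b / y k a)) (fun k o => -(y k o / y k a))
  have hQlow : mvshift (fun k => -(y k b / y k a)) Q ∈ lowIdeal K d (δ / B * m) := by
    rw [← hQ, hf]
    exact coeff_eval₂_C_mem _ f hvan q
  have hσd : ∀ k, σ * c₀ / 2 * D ≤ σ * (d k * (c₀ * h k)) := fun k => by
    have := mul_le_mul_of_nonneg_left (hhd2 k) (by positivity : 0 ≤ σ * c₀)
    linarith
  obtain ⟨i, hi, hne⟩ := hroth d (fun k => c₀ * h k) (fun k => -(y k b / y k a)) Q hQ0 hd1 hQd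
    (fun i j hij => by
      have h1 : (d i : ℝ) * (2 / σ * h j) ≤ D :=
        (mul_le_mul_of_nonneg_left (hω i j hij) (Nat.cast_nonneg _)).trans
          (by linarith [hhd i])
      have h2 := hhd2 j
      have h3 : (d i : ℝ) * (2 / σ * h j) ≤ 2 * (h j * d j) := by linarith
      have h4 : (d i : ℝ) * (2 / σ * h j) * σ = 2 * (d i * h j) := by field_simp
      have h5 := mul_le_mul_of_nonneg_right h3 hσ.le
      rw [h4] at h5
      have h6 : h j * d i ≤ h j * (σ * d j) := by linarith
      exact le_of_mul_le_mul_left h6 (hh j))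
    (fun k => by
      refine le_trans ?_ (hσd k)
      have h1 : Real.log (lone _ Q) ≤ (∑ k, d k : ℕ) * Real.log C₁ := by
        rw [← Real.log_pow]
        exact Real.log_le_log (by linarith [one_le_lone hQ0]) (hQl.trans hPl)
      refine h1.trans (le_of_mul_le_mul_left ?_ hA1)
      calc A * ((∑ k, d k : ℕ) * Real.log C₁) = A * (∑ k, d k : ℕ) * Real.log C₁ := by ring
        _ ≤ m * D * Real.log C₁ := mul_le_mul_of_nonneg_right hsumd hC₁l
        _ = m * Real.log C₁ * D := by ring
        _ ≤ A * (σ * c₀ / 2) * D := mul_le_mul_of_nonneg_right hAC hD0.le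
        _ = _ := by ring)
    (fun k => by
      refine le_trans (le_of_mul_le_mul_left ?_ hA1) (hσd k)
      calc A * (∑ k, d k : ℕ) ≤ m * D := hsumd
        _ ≤ A * (σ * c₀ / 2) * D := mul_le_mul_of_nonneg_right hAm hD0.le
        _ = _ := by ring)
    (fun k => mul_pos hc₀ (hh k)) hHB
  exact hne (mem_lowIdeal.1 hQlow i hi)

end Machine

/-- A filtration of a field by additive subgroups indexed by the reals which behaves like the
logarithm of a valuation, allowing elements of infinite size. -/
structure LogFiltration (L : Type*) [Field L] where
  bd : ℝ → AddSubgroup L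
  mono : ∀ {a b}, a ≤ b → bd a ≤ bd b
  one_mem : 1 ∈ bd 0
  mul_mem : ∀ {a b x y}, x ∈ bd a → y ∈ bd b → x * y ∈ bd (a + b)
  mem_or_inv_mem : ∀ (a : ℝ) (x : L), x ≠ 0 → x ∈ bd a ∨ x⁻¹ ∈ bd (-a)

namespace LogFiltration

variable {L : Type*} [Field L] (B : LogFiltration L)

theorem mem_of_le {a b : ℝ} {x : L} (h : x ∈ B.bd a) (hab : a ≤ b) : x ∈ B.bd b := B.mono hab h

theorem intCast_mem (n : ℤ) : (n : L) ∈ B.bd 0 := by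
  have := (B.bd 0).zsmul_mem B.one_mem n
  simpa using this

theorem prod_mem {ι : Type*} (s : Finset ι) (f : ι → L) (c : ι → ℝ) (h : ∀ i ∈ s, f i ∈ B.bd (c i)) :
    ∏ i ∈ s, f i ∈ B.bd (∑ i ∈ s, c i) := by
  classical
  induction s using Finset.induction_on with
  | empty => simpa using B.one_mem
  | insert a s ha ih =>
    rw [Finset.prod_insert ha, Finset.sum_insert ha]
    exact B.mul_mem (h a (by simp)) (ih fun i hi => h i (by simp [hi]))

theorem det_mem {ι : Type*} [Fintype ι] [DecidableEq ι] (A : Matrix ι ι L) (c s : ι → ℝ)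
    (h : ∀ i j, A i j ∈ B.bd (c i + s j)) : A.det ∈ B.bd (∑ i, c i + ∑ j, s j) := by
  rw [Matrix.det_apply]
  refine (B.bd _).sum_mem fun σ _ => ?_
  rw [Units.smul_def]
  refine (B.bd _).zsmul_mem ?_ _
  have := B.prod_mem Finset.univ (fun i => A (σ i) i) (fun i => c (σ i) + s i) fun i _ => h _ _
  rwa [Finset.sum_add_distrib, Equiv.sum_comp σ c] at this

theorem exists_dominant {ι : Type*} (T : Finset ι) (hT : T.Nonempty) (b : ι → L)
    (hb : ∀ t ∈ T, b t ≠ 0) (r : ι → ℝ) : ∃ i ∈ T, ∀ t ∈ T, b t / b i ∈ B.bd (r i - r t) := by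
  classical
  induction hT using Finset.Nonempty.cons_induction with
  | singleton a =>
    refine ⟨a, by simp, fun t ht => ?_⟩
    rw [Finset.mem_singleton] at ht
    rw [ht, div_self (hb a (by simp)), sub_self]
    exact B.one_mem
  | cons a s ha hs ih =>
    obtain ⟨i, hi, h⟩ := ih fun t ht => hb t (by simp [ht])
    have hbi : b i ≠ 0 := hb i (by simp [hi])
    have hba : b a ≠ 0 := hb a (by simp)
    rcases B.mem_or_inv_mem (r i - r a) (b a / b i) (div_ne_zero hba hbi) with h1 | h1
    · refine ⟨i, by simp [hi], fun t ht => ?_⟩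
      rcases Finset.mem_cons.1 ht with rfl | ht
      · exact h1
      · exact h t ht
    · refine ⟨a, by simp, fun t ht => ?_⟩
      rcases Finset.mem_cons.1 ht with rfl | ht
      · rw [div_self hba, sub_self]
        exact B.one_mem
      · have h2 := B.mul_mem (h t ht) h1
        rw [inv_div, div_mul_div_cancel₀ hbi] at h2
        convert h2 using 2
        ring

variable {V ι : Type*} [AddCommGroup V] [Module L V] [FiniteDimensional L V]

/-- Given a flag of subspaces and a family of linear forms with weights, the forms can be ordered in
such a way that on each member of the flag all forms are controlled by the first ones. -/
theorem exists_flag_aux (W : ℕ → Submodule L V) (hW : Monotone W)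
    (hr : ∀ l, Module.finrank L (W l) ≤ l) (f : ι → V →ₗ[L] L) (r : ι → ℝ) [DecidableEq ι] :
    ∀ (n : ℕ) (T : Finset ι), T.card = n → ∃ π : ℕ → ι ⊕ Unit,
      (∀ t ∈ T, ∃ l < n, π l = Sum.inl t) ∧ ∀ l < n, ∀ x ∈ W (l + 1), ∀ a : ℝ,
        (∀ l' ≤ l, ∀ t, π l' = Sum.inl t → f t x ∈ B.bd (a + r t)) →
          ∀ t ∈ T, f t x ∈ B.bd (a + r t) := by
  classical
  intro n
  induction n with
  | zero =>
    intro T hT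
    rw [Finset.card_eq_zero] at hT
    exact ⟨fun _ => Sum.inr (), by simp [hT], by simp⟩
  | succ n ih =>
    intro T hT
    have hdep : ¬ LinearIndependent L fun t : T => (f t).domRestrict (W n) := by
      intro h
      have h1 := h.fintype_card_le_finrank
      rw [Fintype.card_coe, hT, Subspace.dual_finrank_eq] at h1
      have := hr n
      omega
    rw [Fintype.not_linearIndependent_iff] at hdep
    obtain ⟨b, hb, i₀, hi₀⟩ := hdep
    obtain ⟨b', hb'⟩ : ∃ b' : ι → L, b' = fun t => if h : t ∈ T then b ⟨t, h⟩ else 0 := ⟨_, rfl⟩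
    have hrel : ∀ x ∈ W n, ∑ t ∈ T, b' t * f t x = 0 := by
      intro x hx
      have := LinearMap.congr_fun hb ⟨x, hx⟩
      simp only [LinearMap.sum_apply, LinearMap.smul_apply, LinearMap.domRestrict_apply,
        smul_eq_mul, LinearMap.zero_apply] at this
      rw [← this, ← Finset.sum_coe_sort]
      refine Finset.sum_congr rfl fun t _ => ?_
      simp [hb']
    obtain ⟨i, hi, hdom⟩ := B.exists_dominant (T.filter fun t => b' t ≠ 0)
      ⟨i₀, by simp [hb', hi₀]⟩ b' (fun t ht => (Finset.mem_filter.1 ht).2) r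
    rw [Finset.mem_filter] at hi
    obtain ⟨hiT, hbi⟩ := hi
    have hdom' : ∀ t ∈ T, b' t / b' i ∈ B.bd (r i - r t) := fun t ht => by
      by_cases h0 : b' t = 0
      · rw [h0, zero_div]
        exact zero_mem _
      · exact hdom t (Finset.mem_filter.2 ⟨ht, h0⟩)
    obtain ⟨π, hπ, hfl⟩ := ih (T.erase i) (by rw [Finset.card_erase_of_mem hiT, hT]; rfl)
    refine ⟨Function.update π n (Sum.inl i), fun t ht => ?_, fun l hl x hx a hx' t ht => ?_⟩
    · by_cases hti : t = i
      · exact ⟨n, by omega, by simp [hti]⟩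
      · obtain ⟨l, hl, h⟩ := hπ t (Finset.mem_erase.2 ⟨hti, ht⟩)
        exact ⟨l, by omega, by rw [Function.update_of_ne (by omega), h]⟩
    · rcases Nat.lt_succ_iff_lt_or_eq.1 hl with hl | rfl
      · have h1 : ∀ t ∈ T.erase i, f t x ∈ B.bd (a + r t) := by
          refine hfl l hl x hx a fun l' hl' t ht => hx' l' hl' t ?_
          rw [Function.update_of_ne (by omega), ht]
        by_cases hti : t = i
        · subst hti
          have h2 := hrel x (hW (by omega : l + 1 ≤ n) hx)
          rw [← Finset.add_sum_erase _ _ ht] at h2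
          have h3 : f t x = -∑ s ∈ T.erase t, b' s / b' t * f s x := by
            have : b' t * (f t x + ∑ s ∈ T.erase t, b' s / b' t * f s x) = 0 := by
              rw [mul_add, Finset.mul_sum, ← h2]
              congr 1
              refine Finset.sum_congr rfl fun s _ => ?_
              field_simp
            rcases mul_eq_zero.1 this with h | h
            · exact absurd h hbi
            · exact eq_neg_of_add_eq_zero_left h
          rw [h3]
          refine neg_mem (sum_mem fun s hs => ?_)
          have := B.mul_mem (hdom' s (Finset.mem_of_mem_erase hs)) (h1 s hs)
          convert this using 2
          ring
        · exact h1 t (Finset.mem_erase.2 ⟨hti, ht⟩)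
      · by_cases hti : t = i
        · exact hx' l le_rfl t (by simp [hti])
        · obtain ⟨l', hl', h⟩ := hπ t (Finset.mem_erase.2 ⟨hti, ht⟩)
          exact hx' l' hl'.le t (by rw [Function.update_of_ne (by omega), h])

theorem exists_flag {n : ℕ} (W : ℕ → Submodule L V) (hW : Monotone W)
    (hr : ∀ l, Module.finrank L (W l) ≤ l) (f : Fin n → V →ₗ[L] L) (r : Fin n → ℝ) :
    ∃ π : Equiv.Perm (Fin n), ∀ l : Fin n, ∀ x ∈ W (l + 1), ∀ a : ℝ,
      (∀ l' ≤ l, f (π l') x ∈ B.bd (a + r (π l'))) → ∀ t, f t x ∈ B.bd (a + r t) := by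
  obtain ⟨π, hπ, hfl⟩ := B.exists_flag_aux W hW hr f r n Finset.univ (by simp)
  choose ρ hρ hρ' using fun t => hπ t (Finset.mem_univ t)
  have hinj : Function.Injective fun t => (⟨ρ t, hρ t⟩ : Fin n) := by
    intro t s hts
    have : ρ t = ρ s := by simpa using hts
    have h := hρ' t
    rw [this, hρ' s] at h
    exact (Sum.inl_injective h).symm
  obtain ⟨τ, hτ⟩ : ∃ τ : Equiv.Perm (Fin n), ∀ t, τ t = ⟨ρ t, hρ t⟩ :=
    ⟨Equiv.ofBijective _ (Finite.injective_iff_bijective.1 hinj), fun _ => rfl⟩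
  refine ⟨τ.symm, fun l x hx a h t => hfl l l.2 x hx a (fun l' hl' t ht => ?_) t (Finset.mem_univ t)⟩
  have h1 := h ⟨l', by omega⟩ (Fin.mk_le_of_le_val hl')
  have h2 : τ.symm ⟨l', by omega⟩ = t := by
    rw [Equiv.symm_apply_eq, hτ, Fin.mk.injEq]
    have hs := hρ' (τ.symm ⟨l', by omega⟩)
    have h3 := hτ (τ.symm ⟨l', by omega⟩)
    rw [Equiv.apply_symm_apply, Fin.mk.injEq] at h3
    rw [← h3, ht] at hs
    have h4 := Sum.inl_injective hs
    rw [h4, ← h3]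
  rwa [h2] at h1

end LogFiltration

/-- The linear map given by an integer matrix. -/
def intForm {L : Type*} [Field L] {ι : Type*} [Fintype ι] (A : Matrix ι ι ℤ) :
    (ι → L) →ₗ[L] (ι → L) := (A.map (Int.castRingHom L)).mulVecLin

theorem intForm_apply {L : Type*} [Field L] {ι : Type*} [Fintype ι] (A : Matrix ι ι ℤ) (x : ι → L)
    (i : ι) : intForm A x i = ∑ j, (A i j : L) * x j := by
  simp [intForm, Matrix.mulVec, dotProduct]

/-- A family of logarithmic filtrations subject to a product formula, a theorem on the existence
of small solutions of systems of linear inequalities, and a compactness property. -/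
structure AsymptoticPlaces (L : Type*) [Field L] (S : Type*) [Fintype S] where
  B : S → LogFiltration L
  e : S → ℕ
  e_pos : ∀ v, 0 < e v
  O : Subring L
  sum_nonneg : ∀ x ∈ O, x ≠ 0 → ∀ c : S → ℝ, (∀ v, x ∈ (B v).bd (c v)) → 0 ≤ ∑ v, e v * c v
  exists_small : ∀ (n : ℕ) (A : S → Matrix (Fin n) (Fin n) ℤ), 0 < n → (∀ v, IsUnit (A v).det) →
    ∀ c : S → Fin n → ℝ, 0 < ∑ v, e v * ∑ i, c v i → ∃ x : Fin n → L, x ≠ 0 ∧ (∀ i, x i ∈ O) ∧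
      ∀ v i, intForm (A v) x i ∈ (B v).bd (c v i)
  closed : ∀ (n : ℕ) (A : S → Matrix (Fin n) (Fin n) ℤ) (c : S → Fin n → Fin n → ℝ),
    (∀ ε > 0, ∃ z : Fin n → Fin n → L, (Matrix.of z).det ≠ 0 ∧ (∀ l i, z l i ∈ O) ∧
      ∀ v l i, intForm (A v) (z l) i ∈ (B v).bd (c v l i + ε)) →
    ∃ z : Fin n → Fin n → L, (Matrix.of z).det ≠ 0 ∧ (∀ l i, z l i ∈ O) ∧
      ∀ v l i, intForm (A v) (z l) i ∈ (B v).bd (c v l i)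

section LinearAlgebra

variable {L : Type*} [Field L] {n : ℕ} {z : Fin n → Fin n → L}

theorem det_ne_zero_iff_linearIndependent :
    (Matrix.of z).det ≠ 0 ↔ LinearIndependent L z := by
  rw [← isUnit_iff_ne_zero, ← Matrix.isUnit_iff_isUnit_det,
    ← Matrix.linearIndependent_rows_iff_isUnit]
  rfl

theorem LinearIndependent.exists_sum_eq (hz : LinearIndependent L z) (x : Fin n → L) :
    ∃ a : Fin n → L, x = ∑ l, a l • z l := by
  have h := hz.span_eq_top_of_card_eq_finrank' (by simp)
  have hx : x ∈ Submodule.span L (Set.range z) := by rw [h]; trivial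
  rw [Submodule.mem_span_range_iff_exists_fun] at hx
  obtain ⟨a, ha⟩ := hx
  exact ⟨a, ha.symm⟩

theorem LinearIndependent.update_sum (hz : LinearIndependent L z) {a : Fin n → L} {l : Fin n}
    (ha : a l ≠ 0) : LinearIndependent L (Function.update z l (∑ l, a l • z l)) := by
  refine hz.update l _ ⟨1, one_mem _, Finsupp.equivFunOnFinite.symm a, ?_, ?_⟩
  · simpa using ha
  · rw [one_smul, Finsupp.linearCombination_apply, Finsupp.sum_fintype _ _ (by simp)]
    rfl

/-- The flag of subspaces spanned by the first members of a family. -/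
def flagOf (L : Type*) [Field L] {n : ℕ} (z : Fin n → Fin n → L) (k : ℕ) :
    Submodule L (Fin n → L) :=
  Submodule.span L (z '' {l | (l : ℕ) < k})

theorem flagOf_mono : Monotone (flagOf L z) := fun _ _ hkl =>
  Submodule.span_mono (Set.image_mono fun _ hx => lt_of_lt_of_le hx hkl)

theorem finrank_flagOf_le (k : ℕ) : Module.finrank L (flagOf L z k) ≤ k := by
  classical
  have h : z '' {l | (l : ℕ) < k} =
      ((Finset.univ.filter fun l : Fin n => (l : ℕ) < k).image z : Finset (Fin n → L)) := by
    ext; simp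
  rw [flagOf, h]
  refine (finrank_span_finset_le_card _).trans (Finset.card_image_le.trans ?_)
  have : (Finset.univ.filter fun l : Fin n => (l : ℕ) < k).card ≤ (Finset.range k).card :=
    Finset.card_le_card_of_injOn (fun l : Fin n => (l : ℕ)) (fun l hl => by simpa using hl)
      (fun a _ b _ h => Fin.ext h)
  simpa using this

theorem exists_last_coeff {a : Fin n → L} (hx : ∑ l, a l • z l ≠ 0) :
    ∃ l : Fin n, a l ≠ 0 ∧ (∀ l', l < l' → a l' = 0) ∧ ∑ l, a l • z l ∈ flagOf L z (l + 1) := by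
  classical
  have hne : (Finset.univ.filter fun l => a l ≠ 0).Nonempty := by
    by_contra h
    rw [Finset.not_nonempty_iff_eq_empty, Finset.filter_eq_empty_iff] at h
    exact hx (Finset.sum_eq_zero fun l hl => by rw [not_not.1 (h hl), zero_smul])
  have hmax := Finset.max'_mem _ hne
  refine ⟨Finset.max' _ hne, (Finset.mem_filter.1 hmax).2, fun l' hl' => ?_, ?_⟩
  · by_contra h
    exact absurd (Finset.le_max' _ l' (Finset.mem_filter.2 ⟨Finset.mem_univ _, h⟩)) (not_le.2 hl')
  · refine sum_mem fun l _ => ?_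
    by_cases h : a l = 0
    · rw [h, zero_smul]
      exact zero_mem _
    · refine Submodule.smul_mem _ _ (Submodule.subset_span ?_)
      exact ⟨l, Nat.lt_succ_of_le (Fin.le_iff_val_le_val.1
        (Finset.le_max' _ l (Finset.mem_filter.2 ⟨Finset.mem_univ _, h⟩))), rfl⟩

end LinearAlgebra

namespace AsymptoticPlaces

variable {L : Type*} [Field L] {S : Type*} [Fintype S] (𝔸 : AsymptoticPlaces L S)

theorem det_lower_bound {n : ℕ} {A M : S → Matrix (Fin n) (Fin n) ℤ} (hMA : ∀ v, M v * A v = 1)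
    {z : Fin n → Fin n → L} (hz : LinearIndependent L z) (hO : ∀ l i, z l i ∈ 𝔸.O)
    {c s : S → Fin n → ℝ} (hb : ∀ v l i, intForm (A v) (z l) i ∈ (𝔸.B v).bd (c v i + s v l)) :
    0 ≤ ∑ v, 𝔸.e v * (∑ i, c v i + ∑ l, s v l) := by
  refine 𝔸.sum_nonneg (Matrix.of z).det ?_ (det_ne_zero_iff_linearIndependent.2 hz) _ fun v => ?_
  · rw [Matrix.det_apply]
    refine sum_mem fun σ _ => ?_
    rw [Units.smul_def]
    exact zsmul_mem (prod_mem fun i _ => hO _ _) _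
  · have h1 : ((A v).map (Int.castRingHom L) * (Matrix.of z).transpose).det ∈
        (𝔸.B v).bd (∑ i, c v i + ∑ l, s v l) := by
      refine (𝔸.B v).det_mem _ _ _ fun i j => ?_
      have := hb v j i
      rw [intForm_apply] at this
      simpa [Matrix.mul_apply] using this
    have h2 : (Matrix.of z).det = ((M v).det : L) *
        ((A v).map (Int.castRingHom L) * (Matrix.of z).transpose).det := by
      rw [Matrix.det_mul, Matrix.det_transpose, ← mul_assoc]
      have : ((A v).map (Int.castRingHom L)).det = ((A v).det : L) := by
        rw [← RingHom.mapMatrix_apply, ← RingHom.map_det]; rfl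
      rw [this, ← Int.cast_mul, ← Matrix.det_mul, hMA, Matrix.det_one, Int.cast_one, one_mul]
    rw [h2]
    have := (𝔸.B v).mul_mem ((𝔸.B v).intCast_mem (M v).det) h1
    rwa [zero_add] at this

/-- A basis of integral vectors whose size is bounded by given weights at all places except for one
place, where the bounds are relaxed by prescribed exponents. -/
def Adm {n : ℕ} (A : S → Matrix (Fin n) (Fin n) ℤ) (c : S → Fin n → ℝ) [DecidableEq S] (v₀ : S)
    (ℓ : Fin n → ℝ) (z : Fin n → Fin n → L) : Prop :=
  LinearIndependent L z ∧ (∀ l i, z l i ∈ 𝔸.O) ∧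
    ∀ v l i, intForm (A v) (z l) i ∈ (𝔸.B v).bd (c v i + if v = v₀ then ℓ l else 0)

variable {𝔸} {n : ℕ} {A M : S → Matrix (Fin n) (Fin n) ℤ} {c : S → Fin n → ℝ} [DecidableEq S]
  {v₀ : S} {ℓ : Fin n → ℝ} {z : Fin n → Fin n → L}

theorem Adm.lower_bound (hMA : ∀ v, M v * A v = 1) (h : 𝔸.Adm A c v₀ ℓ z) :
    0 ≤ ∑ v, 𝔸.e v * ∑ i, c v i + 𝔸.e v₀ * ∑ l, ℓ l := by
  have := 𝔸.det_lower_bound hMA h.1 h.2.1 (c := c) (s := fun v l => if v = v₀ then ℓ l else 0) h.2.2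
  simp only [mul_add, Finset.sum_add_distrib] at this
  convert this using 2
  rw [Finset.sum_eq_single v₀]
  · simp
  · intro v _ hv
    simp [hv]
  · simp

theorem Adm.comp_perm (h : 𝔸.Adm A c v₀ ℓ z) (σ : Equiv.Perm (Fin n)) :
    𝔸.Adm A c v₀ (ℓ ∘ σ) (z ∘ σ) :=
  ⟨h.1.comp _ σ.injective, fun _ _ => h.2.1 _ _, fun v _ _ => h.2.2 v _ _⟩

theorem Adm.update (h : 𝔸.Adm A c v₀ ℓ z) {a : Fin n → L} {l : Fin n} (ha : a l ≠ 0)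
    (hO : ∀ i, (∑ l, a l • z l) i ∈ 𝔸.O) {s : ℝ}
    (hx : ∀ v i, intForm (A v) (∑ l, a l • z l) i ∈
      (𝔸.B v).bd (c v i + if v = v₀ then s else 0)) :
    𝔸.Adm A c v₀ (Function.update ℓ l s) (Function.update z l (∑ l, a l • z l)) := by
  refine ⟨h.1.update_sum ha, fun l' i => ?_, fun v l' i => ?_⟩
  · by_cases hl : l' = l
    · subst hl; simpa using hO i
    · simpa [hl] using h.2.1 l' i
  · by_cases hl : l' = l
    · subst hl; simpa using hx v i
    · simpa [hl] using h.2.2 v l' i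

variable (𝔸)

theorem exists_adm (A : S → Matrix (Fin n) (Fin n) ℤ) (c : S → Fin n → ℝ) (v₀ : S) :
    ∃ ℓ z, 𝔸.Adm A c v₀ ℓ z := by
  obtain ⟨m, hm⟩ : ∃ m : ℝ, m = ∑ v, ∑ i, |c v i| := ⟨_, rfl⟩
  have hcm : ∀ v i, -m ≤ c v i := fun v i => by
    have h1 : |c v i| ≤ ∑ i, |c v i| :=
      Finset.single_le_sum (f := fun i => |c v i|) (fun _ _ => abs_nonneg _) (Finset.mem_univ i)
    have h2 : ∑ i, |c v i| ≤ ∑ v, ∑ i, |c v i| :=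
      Finset.single_le_sum (f := fun v => ∑ i, |c v i|) (fun _ _ => by positivity)
        (Finset.mem_univ v)
    linarith [neg_abs_le (c v i)]
  have hm0 : 0 ≤ m := by rw [hm]; positivity
  obtain ⟨R, hR⟩ : ∃ R : ℝ, R = m * ∑ v, (𝔸.e v : ℝ) + 1 := ⟨_, rfl⟩
  obtain ⟨x, hx0, hxO, hx⟩ := 𝔸.exists_small 1 (fun _ => 1) one_pos (by simp)
    (fun v _ => -m + if v = v₀ then R else 0) (by
      simp only [Finset.univ_unique, Finset.sum_singleton, mul_add, Finset.sum_add_distrib]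
      rw [Finset.sum_eq_single (f := fun v => (𝔸.e v : ℝ) * if v = v₀ then R else 0) v₀
        (fun v _ hv => by simp [hv]) (by simp), if_pos rfl, ← Finset.sum_mul]
      have h1 : (1 : ℝ) ≤ 𝔸.e v₀ := by exact_mod_cast 𝔸.e_pos v₀
      have h2 : 0 ≤ ∑ v, (𝔸.e v : ℝ) := by positivity
      have h3 : R ≤ 𝔸.e v₀ * R := le_mul_of_one_le_left (by rw [hR]; positivity) h1
      nlinarith)
  have hx0' : x 0 ≠ 0 := fun h => hx0 (funext fun i => by rw [Subsingleton.elim i 0, h]; rfl)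
  refine ⟨fun _ => R, fun l => Pi.single l (x 0), ?_, fun l i => ?_, fun v l i => ?_⟩
  · have : (fun l : Fin n => (Pi.single l (x 0) : Fin n → L)) =
        fun l => (Units.mk0 (x 0) hx0') • (Pi.basisFun L (Fin n) l) := by
      funext l
      ext i
      simp [Units.smul_def, Pi.single_apply]
    rw [this]
    exact (Pi.basisFun L (Fin n)).linearIndependent.units_smul fun _ => Units.mk0 (x 0) hx0'
  · by_cases h : i = l
    · subst h; simpa using hxO 0
    · simp [h, zero_mem]
  · rw [intForm_apply, Finset.sum_eq_single l (fun j _ hj => by simp [hj]) (by simp)]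
    have h1 := hx v 0
    rw [intForm_apply] at h1
    simp only [Finset.univ_unique, Fin.default_eq_zero, Matrix.one_apply_eq, Int.cast_one, one_mul,
      Finset.sum_singleton] at h1
    have h2 := (𝔸.B v).mul_mem ((𝔸.B v).intCast_mem (A v i l)) h1
    simp only [Pi.single_eq_same]
    refine (𝔸.B v).mem_of_le h2 ?_
    linarith [hcm v i]

theorem adm_closed (c : S → Fin n → ℝ) (v₀ : S) : IsClosed {ℓ | ∃ z, 𝔸.Adm A c v₀ ℓ z} := by
  rw [← closure_subset_iff_isClosed]
  intro ℓ hℓ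
  obtain ⟨z, h1, h2, h3⟩ := 𝔸.closed n A (fun v l i => c v i + if v = v₀ then ℓ l else 0)
    fun ε hε => by
      obtain ⟨ℓ', ⟨z, hz⟩, hd⟩ := Metric.mem_closure_iff.1 hℓ ε hε
      obtain ⟨h1, h2, h3⟩ := hz
      refine ⟨z, det_ne_zero_iff_linearIndependent.2 h1, h2, fun v l i =>
        (𝔸.B v).mem_of_le (h3 v l i) ?_⟩
      have h4 : |ℓ l - ℓ' l| < ε := (dist_le_pi_dist ℓ ℓ' l).trans_lt hd
      have h5 := (abs_lt.1 h4).1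
      split_ifs
      · linarith
      · linarith
  exact ⟨z, det_ne_zero_iff_linearIndependent.1 h1, h2, h3⟩

end AsymptoticPlaces

theorem Finset.sum_update_univ {n : ℕ} (ℓ : Fin n → ℝ) (l : Fin n) (s : ℝ) :
    ∑ i, Function.update ℓ l s i = ∑ i, ℓ i - ℓ l + s := by
  rw [Finset.sum_update_of_mem (Finset.mem_univ l), Finset.sdiff_singleton_eq_erase,
    ← Finset.add_sum_erase Finset.univ ℓ (Finset.mem_univ l)]
  ring

namespace AsymptoticPlaces

variable {L : Type*} [Field L] {S : Type*} [Fintype S] {𝔸 : AsymptoticPlaces L S} {n : ℕ}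
  {A M : S → Matrix (Fin n) (Fin n) ℤ} {c : S → Fin n → ℝ} [DecidableEq S] {v₀ : S}
  {ℓ : Fin n → ℝ} {z : Fin n → Fin n → L}

theorem mem_of_intForm_mem {A M : Matrix (Fin n) (Fin n) ℤ} (hMA : M * A = 1) {B : LogFiltration L}
    {a : ℝ} {x : Fin n → L} (h : ∀ i, intForm A x i ∈ B.bd a) (i : Fin n) : x i ∈ B.bd a := by
  have h1 : x = intForm M (intForm A x) := by
    simp only [intForm, Matrix.mulVecLin_apply, Matrix.mulVec_mulVec, ← Matrix.map_mul, hMA]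
    simp
  rw [h1, intForm_apply]
  refine sum_mem fun j _ => ?_
  have := B.mul_mem (B.intCast_mem (M i j)) (h j)
  rwa [zero_add] at this

theorem Adm.neg_le (hMA : ∀ v, M v * A v = 1) (h : 𝔸.Adm A c v₀ ℓ z) (l : Fin n) :
    -((∑ v, 𝔸.e v) * ∑ v, ∑ i, |c v i|) ≤ ℓ l := by
  obtain ⟨m, hm⟩ : ∃ m : ℝ, m = ∑ v, ∑ i, |c v i| := ⟨_, rfl⟩
  have hcm : ∀ v i, c v i ≤ m := fun v i => by
    have h1 : |c v i| ≤ ∑ i, |c v i| :=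
      Finset.single_le_sum (f := fun i => |c v i|) (fun _ _ => abs_nonneg _) (Finset.mem_univ i)
    have h2 : ∑ i, |c v i| ≤ ∑ v, ∑ i, |c v i| :=
      Finset.single_le_sum (f := fun v => ∑ i, |c v i|) (fun _ _ => by positivity)
        (Finset.mem_univ v)
    linarith [le_abs_self (c v i)]
  have hm0 : 0 ≤ m := by rw [hm]; positivity
  obtain ⟨i, hi⟩ := Function.ne_iff.1 (h.1.ne_zero l)
  have h1 := 𝔸.sum_nonneg (z l i) (h.2.1 l i) hi (fun v => m + if v = v₀ then ℓ l else 0)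
    fun v => mem_of_intForm_mem (hMA v) (fun i => (𝔸.B v).mem_of_le (h.2.2 v l i)
      (by linarith [hcm v i])) i
  simp only [mul_add, Finset.sum_add_distrib] at h1
  rw [Finset.sum_eq_single (f := fun v => (𝔸.e v : ℝ) * if v = v₀ then ℓ l else 0) v₀
    (fun v _ hv => by simp [hv]) (by simp), if_pos rfl, ← Finset.sum_mul] at h1
  rw [← hm]
  push_cast
  by_cases hl : 0 ≤ ℓ l
  · have : 0 ≤ (∑ v, (𝔸.e v : ℝ)) * m := by positivity
    linarith
  · have : (1 : ℝ) ≤ 𝔸.e v₀ := by exact_mod_cast 𝔸.e_pos v₀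
    nlinarith

theorem exists_min_adm (𝔸 : AsymptoticPlaces L S) (hMA : ∀ v, M v * A v = 1) (c : S → Fin n → ℝ)
    (v₀ : S) :
    ∃ ℓ z, 𝔸.Adm A c v₀ ℓ z ∧ ∀ ℓ' z', 𝔸.Adm A c v₀ ℓ' z' → ∑ l, ℓ l ≤ ∑ l, ℓ' l := by
  obtain ⟨ℓ₀, z₀, h₀⟩ := 𝔸.exists_adm A c v₀
  obtain ⟨b, hb⟩ : ∃ b : ℝ, b = (∑ v, 𝔸.e v) * ∑ v, ∑ i, |c v i| := ⟨_, rfl⟩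
  have hb0 : 0 ≤ b := by rw [hb]; positivity
  have hcont : Continuous fun ℓ : Fin n → ℝ => ∑ l, ℓ l := by fun_prop
  have hK : IsCompact ({ℓ | ∃ z, 𝔸.Adm A c v₀ ℓ z} ∩ {ℓ | ∑ l, ℓ l ≤ ∑ l, ℓ₀ l}) := by
    refine (isCompact_Icc (a := fun _ : Fin n => -b)
      (b := fun _ : Fin n => ∑ l, ℓ₀ l + n * b)).of_isClosed_subset
      ((𝔸.adm_closed c v₀).inter (isClosed_le hcont continuous_const)) ?_
    rintro ℓ ⟨⟨z, hz⟩, hs⟩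
    have h1 : ∀ l, -b ≤ ℓ l := fun l => by rw [hb]; exact hz.neg_le hMA l
    refine ⟨fun l => h1 l, fun l => ?_⟩
    have h2 : ℓ l + b ≤ ∑ l, (ℓ l + b) :=
      Finset.single_le_sum (f := fun l => ℓ l + b) (fun l _ => by linarith [h1 l])
        (Finset.mem_univ l)
    simp only [Finset.sum_add_distrib, Finset.sum_const, Finset.card_univ, Fintype.card_fin,
      nsmul_eq_mul] at h2
    have h3 : ∑ l, ℓ l ≤ ∑ l, ℓ₀ l := hs
    linarith
  obtain ⟨ℓ, ⟨⟨z, hz⟩, hs⟩, hmin⟩ := hK.exists_isMinOn ⟨ℓ₀, ⟨z₀, h₀⟩, le_refl (∑ l, ℓ₀ l)⟩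
    hcont.continuousOn
  refine ⟨ℓ, z, hz, fun ℓ' z' h' => ?_⟩
  by_cases h : ∑ l, ℓ' l ≤ ∑ l, ℓ₀ l
  · exact hmin ⟨⟨z', h'⟩, h⟩
  · have h3 : ∑ l, ℓ l ≤ ∑ l, ℓ₀ l := hs
    linarith

/-- A basis of integral vectors whose exponents at the distinguished place are as small as the
product formula permits. -/
theorem exists_reduced (𝔸 : AsymptoticPlaces L S) (hn : 0 < n) (hMA : ∀ v, M v * A v = 1)
    (c : S → Fin n → ℝ) (v₀ : S) :
    ∃ ℓ z, 𝔸.Adm A c v₀ ℓ z ∧ ∑ v, 𝔸.e v * ∑ i, c v i + 𝔸.e v₀ * ∑ l, ℓ l = 0 := by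
  obtain ⟨ℓ₀, z₀, h₀, hmin₀⟩ := 𝔸.exists_min_adm hMA c v₀
  refine ⟨ℓ₀, z₀, h₀, le_antisymm ?_ (h₀.lower_bound hMA)⟩
  by_contra! hpos
  obtain ⟨ℓ, hℓ⟩ : ∃ ℓ, ℓ = ℓ₀ ∘ Tuple.sort ℓ₀ := ⟨_, rfl⟩
  have hmono : Monotone ℓ := by rw [hℓ]; exact Tuple.monotone_sort ℓ₀
  have hsum : ∑ l, ℓ l = ∑ l, ℓ₀ l := by rw [hℓ]; exact Equiv.sum_comp _ ℓ₀
  obtain ⟨z, h⟩ : ∃ z, 𝔸.Adm A c v₀ ℓ z := ⟨_, by rw [hℓ]; exact h₀.comp_perm _⟩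
  rw [← hsum] at hpos
  obtain ⟨π, hπ⟩ := (𝔸.B v₀).exists_flag (flagOf L z) flagOf_mono finrank_flagOf_le
    (fun i => (LinearMap.proj i).comp (intForm (A v₀))) (c v₀)
  have he : (0 : ℝ) < 𝔸.e v₀ := by exact_mod_cast 𝔸.e_pos v₀
  have hn' : (0 : ℝ) < n := by exact_mod_cast hn
  obtain ⟨t, ht⟩ : ∃ t : ℝ, t = (∑ v, 𝔸.e v * ∑ i, c v i + 𝔸.e v₀ * ∑ l, ℓ l) /
    (2 * (𝔸.e v₀ * n)) := ⟨_, rfl⟩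
  have ht0 : 0 < t := by rw [ht]; positivity
  obtain ⟨x, hx0, hxO, hx⟩ := 𝔸.exists_small n A hn
    (fun v => Matrix.isUnit_det_of_left_inverse (hMA v))
    (fun v i => c v i + if v = v₀ then ℓ (π.symm i) - t else 0) (by
      simp only [mul_add, Finset.sum_add_distrib]
      rw [Finset.sum_eq_single (f := fun v => (𝔸.e v : ℝ) * ∑ i : Fin n, if v = v₀ then _ else 0)
        v₀ (fun v _ hv => by simp [hv]) (by simp)]
      simp only [if_true, Finset.sum_sub_distrib, Finset.sum_const, Finset.card_univ,
        Fintype.card_fin, nsmul_eq_mul, Equiv.sum_comp π.symm ℓ]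
      have : 𝔸.e v₀ * (n * t) = (∑ v, 𝔸.e v * ∑ i, c v i + 𝔸.e v₀ * ∑ l, ℓ l) / 2 := by
        rw [ht]; field_simp
      linarith)
  obtain ⟨a, rfl⟩ := h.1.exists_sum_eq x
  obtain ⟨l, hal, -, hmem⟩ := exists_last_coeff hx0
  have h1 := hπ l _ hmem (ℓ l - t) fun l' hl' => by
    refine (𝔸.B v₀).mem_of_le (hx v₀ (π l')) ?_
    rw [if_pos rfl, Equiv.symm_apply_apply]
    linarith [hmono hl']
  have h2 := hmin₀ _ _ (h.update (l := l) (s := ℓ l - t) hal hxO fun v i => by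
    by_cases hv : v = v₀
    · subst hv
      rw [if_pos rfl, add_comm]
      exact h1 i
    · rw [if_neg hv]
      have := hx v i
      rwa [if_neg hv] at this)
  rw [← hsum, Finset.sum_update_univ] at h2
  linarith

/-- A vector which is small at all places has no component along the members of a reduced basis
with positive exponent. -/
theorem Adm.exponent_nonpos (hMA : ∀ v, M v * A v = 1) (h : 𝔸.Adm A c v₀ ℓ z)
    (heq : ∑ v, 𝔸.e v * ∑ i, c v i + 𝔸.e v₀ * ∑ l, ℓ l = 0) {a : Fin n → L}
    (hO : ∀ i, (∑ l, a l • z l) i ∈ 𝔸.O)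
    (hx : ∀ v i, intForm (A v) (∑ l, a l • z l) i ∈ (𝔸.B v).bd (c v i)) {l : Fin n}
    (ha : a l ≠ 0) : ℓ l ≤ 0 := by
  have h1 := (h.update (s := 0) ha hO fun v i => by simpa using hx v i).lower_bound hMA
  rw [Finset.sum_update_univ] at h1
  have he : (0 : ℝ) < 𝔸.e v₀ := by exact_mod_cast 𝔸.e_pos v₀
  nlinarith

end AsymptoticPlaces

theorem LinearIndependent.coeff_eq {L : Type*} [Field L] {n : ℕ} {z : Fin n → Fin n → L}
    (hz : LinearIndependent L z) {a b : Fin n → L} (h : ∑ l, a l • z l = ∑ l, b l • z l)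
    (l : Fin n) : a l = b l := by
  rw [Fintype.linearIndependent_iff] at hz
  refine sub_eq_zero.1 (hz (fun l => a l - b l) ?_ l)
  simp only [sub_smul, Finset.sum_sub_distrib, h, sub_self]

namespace AsymptoticPlaces

variable {L : Type*} [Field L] {S : Type*} [Fintype S] {𝔸 : AsymptoticPlaces L S} {n : ℕ}
  {A M : S → Matrix (Fin n) (Fin n) ℤ} {c : S → Fin n → ℝ} [DecidableEq S] {v₀ : S}
  {μ : Fin n → ℝ} {z : Fin n → Fin n → L}

theorem Adm.exists_hyperplane_of_monotone (hMA : ∀ v, M v * A v = 1) (h : 𝔸.Adm A c v₀ μ z)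
    (heq : ∑ v, 𝔸.e v * ∑ i, c v i + 𝔸.e v₀ * ∑ l, μ l = 0) (hmono : Monotone μ) {b : Fin n}
    {δ : ℝ} (hδ : 0 < δ) (hb : ∀ i, i ≠ b → μ i ≤ μ b - δ) :
    ∃ (c' : S → Fin n → ℝ) (g : Fin n → Fin n → L), ∑ v, 𝔸.e v * ∑ i, c' v i < 0 ∧
      (∀ l i, g l i ∈ 𝔸.O) ∧ (∀ v l i, intForm (A v) (g l) i ∈ (𝔸.B v).bd (c' v i)) ∧
      ∀ a : Fin n → L, a b = 0 → ∑ l, a l • z l ∈ Submodule.span L (Set.range g) := by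
  have he : (0 : ℝ) < 𝔸.e v₀ := by exact_mod_cast 𝔸.e_pos v₀
  have hlast : ∀ i, i ≤ b := fun i => by
    by_contra! hi
    have := hb i hi.ne'
    linarith [hmono hi.le]
  obtain ⟨π, hπ⟩ := (𝔸.B v₀).exists_flag (flagOf L z) flagOf_mono finrank_flagOf_le
    (fun i => (LinearMap.proj i).comp (intForm (A v₀))) (c v₀)
  obtain ⟨ν, hν⟩ : ∃ ν : Fin n → ℝ, ν = Function.update μ b (μ b - δ) := ⟨_, rfl⟩
  have hνmono : Monotone ν := by
    intro i j hij
    rw [hν]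
    by_cases hj : j = b
    · by_cases hi : i = b
      · rw [hi, hj]
      · rw [hj, Function.update_self, Function.update_of_ne hi]
        exact hb i hi
    · have hi : i ≠ b := fun hi => hj (le_antisymm (hlast j) (hi ▸ hij))
      rw [Function.update_of_ne hi, Function.update_of_ne hj]
      exact hmono hij
  obtain ⟨c', hc'⟩ : ∃ c' : S → Fin n → ℝ,
      c' = fun v i => c v i + if v = v₀ then ν (π.symm i) else 0 := ⟨_, rfl⟩
  have hsum : ∑ v, 𝔸.e v * ∑ i, c' v i = -(𝔸.e v₀ * δ) := by
    simp only [hc', mul_add, Finset.sum_add_distrib]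
    rw [Finset.sum_eq_single (f := fun v => (𝔸.e v : ℝ) * ∑ i : Fin n, if v = v₀ then _ else 0)
      v₀ (fun v _ hv => by simp [hv]) (by simp)]
    simp only [if_true, Equiv.sum_comp π.symm ν]
    rw [hν, Finset.sum_update_univ]
    linarith
  obtain ⟨s, g, hg, hs⟩ := 𝔸.exists_reduced b.pos hMA c' v₀
  rw [hsum] at hs
  have hs' : ∑ l, s l = δ := by
    have : 𝔸.e v₀ * (∑ l, s l - δ) = 0 := by linarith
    rcases mul_eq_zero.1 this with h | h <;> linarith
  choose α hα using fun l => h.1.exists_sum_eq (g l)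
  have hkey : ∀ l, 0 ≤ s l ∧ (α l b ≠ 0 → δ ≤ s l) := by
    intro l
    obtain ⟨k, hk, hk', hmem⟩ := exists_last_coeff (L := L) (z := z) (a := α l)
      (by rw [← hα]; exact hg.1.ne_zero l)
    have hgb := fun v => hg.2.2 v l
    have hgO := hg.2.1 l
    rw [hα l] at hgb hgO
    have h1 := hπ k _ hmem (ν k + s l) fun l' hl' => by
      refine (𝔸.B v₀).mem_of_le (hgb v₀ (π l')) ?_
      simp only [hc', if_true, Equiv.symm_apply_apply]
      linarith [hνmono hl']
    have h2 := (h.update (l := k) (s := ν k + s l) hk hgO fun v i => by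
      by_cases hv : v = v₀
      · subst hv
        rw [if_pos rfl, add_comm]
        exact h1 i
      · have := hgb v i
        simp only [hc', if_neg hv, add_zero] at this ⊢
        exact this).lower_bound hMA
    rw [Finset.sum_update_univ] at h2
    have h3 : μ k - ν k ≤ s l := by nlinarith
    rw [hν] at h3
    by_cases hkb : k = b
    · rw [hkb, Function.update_self] at h3
      exact ⟨by linarith, fun _ => by linarith⟩
    · rw [Function.update_of_ne hkb] at h3
      exact ⟨by linarith, fun h => absurd (hk' b (lt_of_le_of_ne (hlast k) hkb)) h⟩
  have hcoeff : ∀ (β a : Fin n → L), ∑ l, a l • z l = ∑ l, β l • g l → a b = ∑ l, β l * α l b := by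
    intro β a hβ
    refine h.1.coeff_eq (b := fun k => ∑ l, β l * α l k) (hβ.trans ?_) b
    simp only [Finset.sum_smul]
    rw [Finset.sum_comm]
    refine Finset.sum_congr rfl fun l _ => ?_
    conv_lhs => rw [hα l]
    rw [Finset.smul_sum]
    simp only [mul_smul]
  obtain ⟨l₀, hl₀⟩ : ∃ l, α l b ≠ 0 := by
    by_contra! hall
    obtain ⟨β, hβ⟩ := hg.1.exists_sum_eq (∑ l, (1 : Fin n → L) l • z l)
    have := hcoeff β 1 hβ
    simp [hall] at this
  have hothers : ∀ l, l ≠ l₀ → s l ≤ 0 ∧ α l b = 0 := by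
    intro l hl
    have h1 : s l₀ + s l ≤ ∑ l, s l := by
      rw [← Finset.add_sum_erase _ _ (Finset.mem_univ l₀)]
      have := Finset.single_le_sum (f := s) (fun i _ => (hkey i).1)
        (Finset.mem_erase.2 ⟨hl, Finset.mem_univ l⟩)
      linarith
    have h2 := (hkey l₀).2 hl₀
    refine ⟨by linarith, ?_⟩
    by_contra hne
    have := (hkey l).2 hne
    linarith
  refine ⟨c', fun l => if l = l₀ then 0 else g l, ?_, fun l i => ?_, fun v l i => ?_,
    fun a ha => ?_⟩
  · rw [hsum]
    have := mul_pos he hδ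
    linarith
  · by_cases hl : l = l₀
    · simp [hl, zero_mem]
    · simpa [hl] using hg.2.1 l i
  · by_cases hl : l = l₀
    · simp [hl, zero_mem]
    · simp only [if_neg hl]
      refine (𝔸.B v).mem_of_le (hg.2.2 v l i) ?_
      split_ifs
      · linarith [(hothers l hl).1]
      · rw [add_zero]
  · obtain ⟨β, hβ⟩ := hg.1.exists_sum_eq (∑ l, a l • z l)
    have h1 := hcoeff β a hβ
    rw [ha, Finset.sum_eq_single l₀ (fun l _ hl => by rw [(hothers l hl).2, mul_zero]) (by simp)]
      at h1
    have h2 : β l₀ = 0 := by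
      rcases mul_eq_zero.1 h1.symm with h | h
      · exact h
      · exact absurd h hl₀
    rw [hβ]
    refine sum_mem fun l _ => ?_
    by_cases hl : l = l₀
    · rw [hl, h2, zero_smul]
      exact zero_mem _
    · exact Submodule.smul_mem _ _ (Submodule.subset_span ⟨l, by simp [hl]⟩)

/-- If the last exponent of a reduced basis is isolated, the hyperplane spanned by the other members
can be spanned by vectors satisfying a system of inequalities of negative total weight. -/
theorem Adm.exists_hyperplane (hMA : ∀ v, M v * A v = 1) (h : 𝔸.Adm A c v₀ μ z)
    (heq : ∑ v, 𝔸.e v * ∑ i, c v i + 𝔸.e v₀ * ∑ l, μ l = 0) {b : Fin n}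
    {δ : ℝ} (hδ : 0 < δ) (hb : ∀ i, i ≠ b → μ i ≤ μ b - δ) :
    ∃ (c' : S → Fin n → ℝ) (g : Fin n → Fin n → L), ∑ v, 𝔸.e v * ∑ i, c' v i < 0 ∧
      (∀ l i, g l i ∈ 𝔸.O) ∧ (∀ v l i, intForm (A v) (g l) i ∈ (𝔸.B v).bd (c' v i)) ∧
      ∀ a : Fin n → L, a b = 0 → ∑ l, a l • z l ∈ Submodule.span L (Set.range g) := by
  obtain ⟨c', g, h1, h2, h3, h4⟩ := (h.comp_perm (Tuple.sort μ)).exists_hyperplane_of_monotone hMA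
    (by rw [← heq]; congr 2; exact Equiv.sum_comp _ μ) (Tuple.monotone_sort μ)
    (b := (Tuple.sort μ).symm b) hδ (fun i hi => by
      simp only [Function.comp_apply, Equiv.apply_symm_apply]
      exact hb _ fun h => hi (by rw [← h, Equiv.symm_apply_apply]))
  refine ⟨c', g, h1, h2, h3, fun a ha => ?_⟩
  have := h4 (a ∘ Tuple.sort μ) (by simpa using ha)
  rwa [show ∑ l, (a ∘ Tuple.sort μ) l • (z ∘ Tuple.sort μ) l = ∑ l, a l • z l from
    Equiv.sum_comp (Tuple.sort μ) fun l => a l • z l] at this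

end AsymptoticPlaces

namespace Matrix

variable {R : Type*} [CommRing R] {p n : ℕ}

noncomputable instance : Fintype (Fin p ↪o Fin n) := Fintype.ofFinite _

theorem det_mul_eq_sum_fun (A : Matrix (Fin p) (Fin n) R) (B : Matrix (Fin n) (Fin p) R) :
    (A * B).det = ∑ g : Fin p → Fin n, (∏ i, B (g i) i) * (A.submatrix id g).det := by
  have h : (A * B)ᵀ = fun i => ∑ k, B k i • Aᵀ k := by
    ext i j
    simp [Matrix.mul_apply, mul_comm]
  rw [← Matrix.det_transpose, h]
  change detRowAlternating.toMultilinearMap _ = _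
  rw [MultilinearMap.map_sum]
  refine Finset.sum_congr rfl fun g _ => ?_
  rw [MultilinearMap.map_smul_univ, smul_eq_mul, ← Matrix.det_transpose (A.submatrix id g)]
  rfl

/-- The Cauchy–Binet formula. -/
theorem det_mul_eq_sum_orderEmbedding (A : Matrix (Fin p) (Fin n) R)
    (B : Matrix (Fin n) (Fin p) R) :
    (A * B).det = ∑ f : Fin p ↪o Fin n, (A.submatrix id f).det * (B.submatrix f id).det := by
  have h1 : ∀ f : Fin p ↪o Fin n, (A.submatrix id f).det * (B.submatrix f id).det =
      ∑ σ : Equiv.Perm (Fin p), (∏ i, B (f (σ i)) i) * (A.submatrix id (f ∘ σ)).det := by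
    intro f
    rw [Matrix.det_apply (B.submatrix f id), Finset.mul_sum]
    refine Finset.sum_congr rfl fun σ _ => ?_
    rw [show A.submatrix id (f ∘ σ) = (A.submatrix id f).submatrix id σ from rfl,
      Matrix.det_permute']
    simp only [submatrix_apply, id, Units.smul_def, zsmul_eq_mul]
    ring
  simp only [h1, det_mul_eq_sum_fun]
  rw [← Finset.sum_product', Finset.univ_product_univ]
  symm
  refine Finset.sum_of_injOn (fun x : (Fin p ↪o Fin n) × Equiv.Perm (Fin p) => x.1 ∘ x.2) ?_
    (fun _ _ => Finset.mem_univ _) ?_ (fun _ _ => rfl)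
  · rintro ⟨f, σ⟩ - ⟨f', σ'⟩ - h
    have hf : f = f' := by
      have : Set.range f = Set.range f' := by
        rw [← σ.surjective.range_comp f, ← σ'.surjective.range_comp f']
        exact congrArg Set.range h
      exact OrderEmbedding.range_inj.1 this
    subst hf
    refine Prod.ext rfl (Equiv.ext fun i => f.injective (congrFun h i))
  · intro g _ hg
    have hni : ¬ Function.Injective g := by
      intro hinj
      refine hg ⟨⟨OrderEmbedding.ofStrictMono (g ∘ Tuple.sort g)
        ((Tuple.monotone_sort g).strictMono_of_injective (hinj.comp (Equiv.injective _))),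
        (Tuple.sort g).symm⟩, Finset.mem_coe.2 (Finset.mem_univ _), ?_⟩
      ext i
      simp
    rw [Function.not_injective_iff] at hni
    obtain ⟨i, j, hij, hne⟩ := hni
    rw [Matrix.det_zero_of_column_eq hne (fun k => by simp [hij]), mul_zero]

/-- The number of `p`-element subsets, indexing the rows of compound matrices. -/
noncomputable def compoundCard (p n : ℕ) : ℕ := Fintype.card (Fin p ↪o Fin n)

/-- An enumeration of the strictly increasing tuples. -/
noncomputable def compoundIndex (p n : ℕ) : Fin (compoundCard p n) ≃ (Fin p ↪o Fin n) :=
  (Fintype.equivFin _).symm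

/-- The matrix of minors of size `p`. -/
noncomputable def compound (p : ℕ) (A : Matrix (Fin n) (Fin n) R) :
    Matrix (Fin (compoundCard p n)) (Fin (compoundCard p n)) R :=
  Matrix.of fun i j => (A.submatrix (compoundIndex p n i) (compoundIndex p n j)).det

theorem compound_mul (A B : Matrix (Fin n) (Fin n) R) :
    compound p (A * B) = compound p A * compound p B := by
  ext i j
  rw [Matrix.mul_apply, ← Equiv.sum_comp (compoundIndex p n).symm]
  simp only [compound, of_apply, Equiv.apply_symm_apply]
  rw [Matrix.submatrix_mul _ _ _ id _ Function.bijective_id, det_mul_eq_sum_orderEmbedding]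
  rfl

theorem compound_one : compound p (1 : Matrix (Fin n) (Fin n) R) = 1 := by
  ext i j
  by_cases h : i = j
  · subst h
    rw [compound, of_apply, Matrix.submatrix_one _ (RelEmbedding.injective _), Matrix.one_apply_eq,
      Matrix.det_one]
  · rw [compound, of_apply, Matrix.one_apply_ne h]
    have : ∃ k, compoundIndex p n i k ∉ Set.range (compoundIndex p n j) := by
      by_contra! hall
      have h1 : Finset.univ.image (compoundIndex p n i) = Finset.univ.image (compoundIndex p n j) := by
        refine Finset.eq_of_subset_of_card_le (fun x hx => ?_) ?_
        · obtain ⟨k, -, rfl⟩ := Finset.mem_image.1 hx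
          obtain ⟨l, hl⟩ := hall k
          exact Finset.mem_image.2 ⟨l, Finset.mem_univ _, hl⟩
        · rw [Finset.card_image_of_injective _ (RelEmbedding.injective _),
            Finset.card_image_of_injective _ (RelEmbedding.injective _)]
      have h2 : Set.range (compoundIndex p n i) = Set.range (compoundIndex p n j) := by
        have := congrArg (fun s : Finset (Fin n) => (s : Set (Fin n))) h1
        simpa using this
      exact h ((compoundIndex p n).injective (OrderEmbedding.range_inj.1 h2))
    obtain ⟨k, hk⟩ := this
    refine Matrix.det_eq_zero_of_row_eq_zero k fun l => ?_
    rw [submatrix_apply, Matrix.one_apply_ne]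
    exact fun h => hk ⟨l, h.symm⟩

theorem compound_map {R' : Type*} [CommRing R'] (f : R →+* R') (A : Matrix (Fin n) (Fin n) R) :
    compound p (A.map f) = (compound p A).map f := by
  ext i j
  simp only [compound, of_apply, map_apply]
  rw [RingHom.map_det]
  rfl

end Matrix

namespace Matrix

variable {R : Type*} [CommRing R] {p n : ℕ}

theorem compound_transpose (A : Matrix (Fin n) (Fin n) R) : compound p Aᵀ = (compound p A)ᵀ := by
  ext i j
  simp only [compound, of_apply, transpose_apply]
  rw [← Matrix.det_transpose]
  rfl

theorem sum_compoundIndex_eq_zero {f : Fin n → ℝ} (hf : ∑ i, f i = 0) :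
    ∑ T, ∑ k, f (compoundIndex p n T k) = 0 := by
  rw [Equiv.sum_comp (compoundIndex p n) (fun T => ∑ k, f (T k))]
  have h1 : ∑ T : Fin p ↪o Fin n, ∑ k, f (T k) =
      ∑ s ∈ (Finset.univ : Finset (Fin n)).powersetCard p, ∑ i ∈ s, f i := by
    refine Finset.sum_bij' (fun T _ => Finset.univ.image T)
      (fun s hs => s.orderEmbOfFin (Finset.mem_powersetCard.1 hs).2) ?_ ?_ ?_ ?_ ?_
    · intro T _
      rw [Finset.mem_powersetCard, Finset.card_image_of_injective _ T.injective]
      simp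
    · simp
    · intro T _
      refine OrderEmbedding.range_inj.1 ?_
      simp
    · intro s hs
      ext x
      rw [← Finset.mem_coe]
      simp
    · intro T _
      rw [Finset.sum_image fun _ _ _ _ h => T.injective h]
  rw [h1]
  have h2 : ∀ s ∈ (Finset.univ : Finset (Fin n)).powersetCard p, ∑ i ∈ s, f i =
      ∑ i, if {i} ⊆ s then f i else 0 := by
    intro s _
    rw [← Finset.sum_filter]
    simp
  rw [Finset.sum_congr rfl h2, Finset.sum_comm]
  have h3 : ∀ i : Fin n, (∑ s ∈ (Finset.univ : Finset (Fin n)).powersetCard p,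
      if {i} ⊆ s then f i else 0) = (if 1 ≤ p then (n - 1).choose (p - 1) else 0 : ℕ) * f i := by
    intro i
    rw [← Finset.sum_filter, Finset.sum_const, nsmul_eq_mul]
    split_ifs with hp
    · rw [Finset.card_filter_powersetCard_subset _ _ _ (Finset.subset_univ _) (by simpa using hp)]
      simp
    · rw [Finset.filter_eq_empty_iff.2]
      · simp
      · intro s hs h
        have := (Finset.card_le_card h).trans_eq (Finset.mem_powersetCard.1 hs).2
        simp at this
        omega
  rw [Finset.sum_congr rfl fun i _ => h3 i, ← Finset.mul_sum, hf, mul_zero]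

end Matrix

open Matrix

theorem intForm_compound {L : Type*} [Field L] {p n : ℕ} (A : Matrix (Fin n) (Fin n) ℤ)
    (z : Fin n → Fin n → L) (I T : Fin (compoundCard p n)) :
    intForm (compound p A) (compound p (Matrix.of z) I) T =
      (Matrix.of fun k l => intForm A (z (compoundIndex p n I l)) (compoundIndex p n T k)).det := by
  have h1 : intForm (compound p A) (compound p (Matrix.of z) I) T =
      (compound p (A.map (Int.castRingHom L)) * compound p (Matrix.of z)ᵀ) T I := by
    rw [intForm_apply, Matrix.mul_apply, compound_transpose, compound_map]
    rfl
  rw [h1, ← compound_mul]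
  simp only [compound, of_apply]
  congr 1

theorem linearIndependent_compound {L : Type*} [Field L] {p n : ℕ} {z : Fin n → Fin n → L}
    (hz : LinearIndependent L z) :
    compound p (Matrix.of z) * compound p (Matrix.of z)⁻¹ = 1 ∧
      LinearIndependent L fun I => compound p (Matrix.of z) I := by
  have h1 : compound p (Matrix.of z) * compound p (Matrix.of z)⁻¹ = 1 := by
    rw [← compound_mul, Matrix.mul_nonsing_inv _
      (isUnit_iff_ne_zero.2 (det_ne_zero_iff_linearIndependent.2 hz)), compound_one]
  refine ⟨h1, det_ne_zero_iff_linearIndependent.1 ?_⟩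
  have h2 := congrArg Matrix.det h1
  rw [Matrix.det_mul, Matrix.det_one] at h2
  exact left_ne_zero_of_mul_eq_one h2

theorem sum_compound_eq_zero {S : Type*} [Fintype S] {n : ℕ} (p : ℕ) {e : S → ℕ}
    {c : S → Fin n → ℝ} {ℓ : Fin n → ℝ} {v₀ : S}
    (heq : ∑ v, e v * ∑ i, c v i + e v₀ * ∑ l, ℓ l = 0) :
    ∑ v, e v * ∑ T, ∑ k, c v (compoundIndex p n T k) +
      e v₀ * ∑ I, ∑ k, ℓ (compoundIndex p n I k) = 0 := by
  rw [← sum_compoundIndex_eq_zero (p := p)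
    (f := fun i => ∑ v, e v * c v i + e v₀ * ℓ i) (by
      rw [← heq, Finset.sum_add_distrib, Finset.sum_comm]
      simp only [Finset.mul_sum])]
  simp only [Finset.sum_add_distrib, Finset.mul_sum]
  congr 1
  rw [Finset.sum_comm]
  refine Finset.sum_congr rfl fun T _ => ?_
  rw [Finset.sum_comm]

namespace AsymptoticPlaces

variable {L : Type*} [Field L] {S : Type*} [Fintype S] {𝔸 : AsymptoticPlaces L S} {n : ℕ}
  {A M : S → Matrix (Fin n) (Fin n) ℤ} {c : S → Fin n → ℝ} [DecidableEq S] {v₀ : S}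
  {ℓ : Fin n → ℝ} {z : Fin n → Fin n → L}

theorem Adm.compound (p : ℕ) (h : 𝔸.Adm A c v₀ ℓ z) :
    𝔸.Adm (fun v => Matrix.compound p (A v))
      (fun v T => ∑ k, c v (compoundIndex p n T k)) v₀
      (fun I => ∑ k, ℓ (compoundIndex p n I k)) (fun I => Matrix.compound p (Matrix.of z) I) := by
  refine ⟨(linearIndependent_compound h.1).2, fun I T => ?_, fun v I T => ?_⟩
  · simp only [Matrix.compound, of_apply]
    rw [Matrix.det_apply]
    refine sum_mem fun σ _ => ?_
    rw [Units.smul_def]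
    exact zsmul_mem (prod_mem fun i _ => h.2.1 _ _) _
  · rw [intForm_compound]
    refine (𝔸.B v).mem_of_le ((𝔸.B v).det_mem _ (fun k => c v (compoundIndex p n T k))
      (fun l => if v = v₀ then ℓ (compoundIndex p n I l) else 0) fun k l => h.2.2 v _ _) ?_
    split_ifs <;> simp

end AsymptoticPlaces

/-- Among the tuples of a given length, the one enumerating the indices with positive value has
isolated maximal sum. -/
theorem exists_isolated_compoundIndex {n : ℕ} (ℓ : Fin n → ℝ) (hℓ : ∃ l, 0 < ℓ l) :
    ∃ (p : ℕ) (b : Fin (compoundCard p n)) (δ : ℝ), 0 < p ∧ 0 < δ ∧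
      (∀ l, 0 < ℓ l ↔ l ∈ Set.range (compoundIndex p n b)) ∧
      ∀ I, I ≠ b → ∑ k, ℓ (compoundIndex p n I k) ≤ ∑ k, ℓ (compoundIndex p n b k) - δ := by
  obtain ⟨P, hP⟩ : ∃ P : Finset (Fin n), P = Finset.univ.filter fun l => 0 < ℓ l := ⟨_, rfl⟩
  have hmem : ∀ l, l ∈ P ↔ 0 < ℓ l := by simp [hP]
  have hne : P.Nonempty := hℓ.imp fun l hl => (hmem l).2 hl
  obtain ⟨m, hm, hmin⟩ := P.exists_min_image ℓ hne
  have himage : ∀ I, (Finset.univ.image (compoundIndex P.card n I)).card = P.card := fun I => by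
    rw [Finset.card_image_of_injective _ (RelEmbedding.injective _)]
    simp
  obtain ⟨b, hb⟩ : ∃ b, b = (compoundIndex P.card n).symm (P.orderEmbOfFin rfl) := ⟨_, rfl⟩
  have hbr : Finset.univ.image (compoundIndex P.card n b) = P := by
    ext x
    rw [← Finset.mem_coe, hb]
    simp
  have hsum : ∀ I, ∑ k, ℓ (compoundIndex P.card n I k) =
      ∑ l ∈ Finset.univ.image (compoundIndex P.card n I), ℓ l := fun I => by
    rw [Finset.sum_image fun _ _ _ _ h => RelEmbedding.injective _ h]
  refine ⟨P.card, b, ℓ m, hne.card_pos, (hmem m).1 hm, fun l => ?_, fun I hI => ?_⟩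
  · rw [← hmem]
    simpa [eq_comm] using (Finset.ext_iff.1 hbr l).symm
  · rw [hsum, hsum, hbr]
    obtain ⟨s, hs⟩ : ∃ s, s = Finset.univ.image (compoundIndex P.card n I) := ⟨_, rfl⟩
    rw [← hs]
    have hsP : s ≠ P := by
      intro h
      refine hI ((compoundIndex P.card n).injective (OrderEmbedding.range_inj.1 ?_))
      have := congrArg (fun s : Finset (Fin n) => (s : Set (Fin n))) (hs.symm.trans (h.trans hbr.symm))
      simpa using this
    obtain ⟨t, htP, hts⟩ : ∃ t ∈ P, t ∉ s := by
      by_contra! hall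
      exact hsP (Finset.eq_of_subset_of_card_le hall (by rw [hs, himage])).symm
    have h1 : ∑ l ∈ s, ℓ l ≤ ∑ l ∈ s ∩ P, ℓ l := by
      rw [← Finset.sum_inter_add_sum_sdiff s P]
      have : ∑ l ∈ s \ P, ℓ l ≤ 0 := Finset.sum_nonpos fun l hl => by
        rw [Finset.mem_sdiff, hmem, not_lt] at hl
        exact hl.2
      linarith
    have h2 : ∑ l ∈ s ∩ P, ℓ l + ℓ t ≤ ∑ l ∈ P, ℓ l := by
      rw [add_comm, ← Finset.sum_insert (by simp [hts])]
      refine Finset.sum_le_sum_of_subset_of_nonneg ?_ fun l hl _ => ((hmem l).1 hl).le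
      intro l hl
      rcases Finset.mem_insert.1 hl with rfl | hl
      · exact htP
      · exact (Finset.mem_inter.1 hl).2
    linarith [hmin t htP]

/-- A minor with repeated or permuted rows is, up to sign, zero or an ordered minor. -/
theorem Matrix.det_submatrix_row {R : Type*} [CommRing R] {p n : ℕ} (W : Matrix (Fin n) (Fin n) R)
    (g h : Fin p → Fin n) : (W.submatrix g h).det = 0 ∨ ∃ (f : Fin p ↪o Fin n) (σ : ℤˣ),
      (W.submatrix g h).det = ((σ : ℤ) : R) * (W.submatrix f h).det := by
  by_cases hg : Function.Injective g
  · refine Or.inr ⟨OrderEmbedding.ofStrictMono (g ∘ Tuple.sort g)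
        ((Tuple.monotone_sort g).strictMono_of_injective (hg.comp (Equiv.injective _))),
        Equiv.Perm.sign (Tuple.sort g).symm, ?_⟩
    rw [← Matrix.det_permute]
    congr 1
    ext i j
    simp
  · rw [Function.not_injective_iff] at hg
    obtain ⟨i, j, hij, hne⟩ := hg
    exact Or.inl (Matrix.det_zero_of_row_eq hne (by ext k; simp [hij]))

/-- If the columns of `W` indexed by `h` are orthogonal to a vector `w` which is linearly independent
over the subfield `F`, then the minors of `W` in these columns are not proportional to a vector
over `F`. -/
theorem exists_minor_ratio_notMem {L : Type*} [Field L] (F : Subfield L) {p n : ℕ} (hp : 0 < p)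
    (W : Matrix (Fin n) (Fin n) L) (h : Fin p → Fin n) (w : Fin n → L)
    (hw : ∀ j, ∑ i, w i * W i (h j) = 0)
    (hind : ∀ d : Fin n → L, (∀ i, d i ∈ F) → ∑ i, d i * w i = 0 → ∀ i, d i = 0)
    (f₁ : Fin p ↪o Fin n) (hf₁ : (W.submatrix f₁ h).det ≠ 0) :
    ∃ f : Fin p ↪o Fin n, (W.submatrix f h).det / (W.submatrix f₁ h).det ∉ F := by
  by_contra! hall
  obtain ⟨k₀⟩ : Nonempty (Fin p) := ⟨⟨0, hp⟩⟩
  have h1 := hind (fun r => (W.submatrix (Function.update f₁ k₀ r) h).det / (W.submatrix f₁ h).det)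
    (fun r => ?_) ?_ (f₁ k₀)
  · rw [Function.update_eq_self, div_self hf₁] at h1
    exact one_ne_zero h1
  · rcases W.det_submatrix_row (Function.update f₁ k₀ r) h with h0 | ⟨f, σ, h0⟩
    · rw [h0, zero_div]
      exact zero_mem _
    · rw [h0, mul_div_assoc]
      exact mul_mem (intCast_mem _ _) (hall f)
  · simp only [div_mul_eq_mul_div]
    rw [← Finset.sum_div, div_eq_zero_iff]
    left
    have h2 : ∀ r, (W.submatrix (Function.update f₁ k₀ r) h).det * w r =
        ((W.submatrix f₁ h).updateRow k₀ (w r • fun j => W r (h j))).det := by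
      intro r
      rw [Matrix.det_updateRow_smul, mul_comm]
      congr 2
      ext i j
      by_cases hi : i = k₀
      · subst hi
        simp
      · simp [hi]
    simp only [h2]
    have h3 : ∀ s : Finset (Fin n), ∑ r ∈ s,
        ((W.submatrix f₁ h).updateRow k₀ (w r • fun j => W r (h j))).det =
        ((W.submatrix f₁ h).updateRow k₀ (∑ r ∈ s, w r • fun j => W r (h j))).det := by
      intro s
      classical
      induction s using Finset.induction_on with
      | empty =>
        rw [Finset.sum_empty, Finset.sum_empty]
        exact (Matrix.det_eq_zero_of_row_eq_zero k₀ fun j => by simp).symm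
      | insert r s hr ih => rw [Finset.sum_insert hr, Finset.sum_insert hr, ih,
          Matrix.det_updateRow_add]
    rw [h3]
    refine Matrix.det_eq_zero_of_row_eq_zero k₀ fun j => ?_
    simpa using hw j

/-- From a vector of small size, linearly independent over `F`, one obtains a system of inequalities
of negative weight satisfied by vectors spanning a hyperplane not defined over `F`. -/
theorem AsymptoticPlaces.exists_hyperplane_system {L : Type*} [Field L] {S : Type*} [Fintype S]
    (𝔸 : AsymptoticPlaces L S) (F : Subfield L) {n : ℕ} (A M : S → Matrix (Fin n) (Fin n) ℤ)
    (hMA : ∀ v, M v * A v = 1) (c : S → Fin n → ℝ) (hc : ∑ v, 𝔸.e v * ∑ i, c v i < 0)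
    (w : Fin n → L) (hwO : ∀ i, w i ∈ 𝔸.O) (hw : ∀ v i, intForm (A v) w i ∈ (𝔸.B v).bd (c v i))
    (hind : ∀ d : Fin n → L, (∀ i, d i ∈ F) → ∑ i, d i * w i = 0 → ∀ i, d i = 0) :
    ∃ (N : ℕ) (A' M' : S → Matrix (Fin N) (Fin N) ℤ) (c' : S → Fin N → ℝ)
      (g : Fin N → Fin N → L) (y : Fin N → L) (a b : Fin N), (∀ v, M' v * A' v = 1) ∧
      ∑ v, 𝔸.e v * ∑ i, c' v i < 0 ∧ (∀ l i, g l i ∈ 𝔸.O) ∧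
      (∀ v l i, intForm (A' v) (g l) i ∈ (𝔸.B v).bd (c' v i)) ∧ y a ≠ 0 ∧
      (∀ x : Fin N → L, ∑ i, y i * x i = 0 → x ∈ Submodule.span L (Set.range g)) ∧
      y b / y a ∉ F := by
  classical
  rcases Nat.eq_zero_or_pos n with rfl | hn
  · simp at hc
  obtain ⟨v₀⟩ : Nonempty S := by
    by_contra hS
    rw [not_nonempty_iff] at hS
    simp at hc
  obtain ⟨ℓ, z, hz, heq⟩ := 𝔸.exists_reduced hn hMA c v₀
  obtain ⟨a, ha⟩ := hz.1.exists_sum_eq w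
  have ha0 : ∀ l, 0 < ℓ l → a l = 0 := by
    intro l hl
    by_contra hne
    have := hz.exponent_nonpos hMA heq (a := a) (by rwa [← ha]) (by rwa [← ha]) hne
    linarith
  have hpos : ∃ l, 0 < ℓ l := by
    by_contra! hall
    have h1 : ∑ l, ℓ l ≤ 0 := Finset.sum_nonpos fun l _ => hall l
    have h2 : (0 : ℝ) ≤ 𝔸.e v₀ := Nat.cast_nonneg _
    nlinarith
  obtain ⟨p, b, δ, hp, hδ, hb, hiso⟩ := exists_isolated_compoundIndex ℓ hpos
  have hMA' : ∀ v, compound p (M v) * compound p (A v) = 1 := fun v => by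
    rw [← compound_mul, hMA, compound_one]
  obtain ⟨c', g, h1, h2, h3, h4⟩ := (hz.compound p).exists_hyperplane hMA'
    (sum_compound_eq_zero p heq) hδ hiso
  have hinv := (linearIndependent_compound (p := p) hz.1).1
  obtain ⟨T₁, hT₁⟩ : ∃ T, compound p (Matrix.of z)⁻¹ T b ≠ 0 := by
    by_contra! hall
    have := congrFun (congrFun hinv b) b
    rw [Matrix.mul_apply, Matrix.one_apply_eq] at this
    simp [hall] at this
  obtain ⟨f, hf⟩ := exists_minor_ratio_notMem F hp (Matrix.of z)⁻¹ (compoundIndex p n b) w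
    (fun j => by
      have h5 : w = a ᵥ* Matrix.of z := by
        rw [ha]
        ext i
        simp [Matrix.vecMul, dotProduct]
      have h6 : w ᵥ* (Matrix.of z)⁻¹ = a := by
        rw [h5, Matrix.vecMul_vecMul, Matrix.mul_nonsing_inv _
          (isUnit_iff_ne_zero.2 (det_ne_zero_iff_linearIndependent.2 hz.1)), Matrix.vecMul_one]
      have h7 := congrFun h6 (compoundIndex p n b j)
      rw [ha0 _ ((hb _).2 ⟨j, rfl⟩)] at h7
      exact h7) hind (compoundIndex p n T₁) hT₁
  refine ⟨_, _, _, c', g, fun T => compound p (Matrix.of z)⁻¹ T b, T₁,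
    (compoundIndex p n).symm f, hMA', h1, h2, h3, hT₁, fun x hx => ?_, ?_⟩
  · obtain ⟨α, hα⟩ := (linearIndependent_compound (p := p) hz.1).2.exists_sum_eq x
    rw [hα]
    refine h4 α ?_
    have h5 : x = α ᵥ* compound p (Matrix.of z) := by
      rw [hα]
      ext i
      simp [Matrix.vecMul, dotProduct]
    have h6 : x ᵥ* compound p (Matrix.of z)⁻¹ = α := by
      rw [h5, Matrix.vecMul_vecMul, hinv, Matrix.vecMul_one]
    rw [← h6, ← hx]
    simp only [Matrix.vecMul, dotProduct, mul_comm]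
  · simpa [compound] using hf

open Filter

/-- The field of germs of sequences along an ultrafilter. -/
abbrev Hyper (𝒰 : Ultrafilter ℕ) (K : Type*) : Type _ := Germ (𝒰 : Filter ℕ) K

namespace Hyper

variable {𝒰 : Ultrafilter ℕ} {K : Type*}

/-- The predicate on germs that a property of the terms holds eventually. -/
def Ev (P : ℕ → K → Prop) (x : Hyper 𝒰 K) : Prop := ∃ f : ℕ → K, (f : Hyper 𝒰 K) = x ∧ ∀ᶠ j in 𝒰, P j (f j)

theorem ev_coe {P : ℕ → K → Prop} {f : ℕ → K} :
    Ev P (f : Hyper 𝒰 K) ↔ ∀ᶠ j in 𝒰, P j (f j) := by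
  refine ⟨?_, fun h => ⟨f, rfl, h⟩⟩
  rintro ⟨g, hg, h⟩
  filter_upwards [Germ.coe_eq.1 hg, h] with j h1 h2
  rwa [← h1]

theorem exists_rep {ι : Type*} (x : ι → Hyper 𝒰 K) : ∃ f : ι → ℕ → K, ∀ i, x i = (f i : Hyper 𝒰 K) :=
  ⟨fun i => (Quotient.out (x i)), fun i => (Quotient.out_eq (x i)).symm⟩

variable [Field K]

theorem coe_eq_zero {f : ℕ → K} : (f : Hyper 𝒰 K) = 0 ↔ ∀ᶠ j in 𝒰, f j = 0 := by
  rw [← Germ.coe_zero, Germ.coe_eq]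
  rfl

theorem coe_ne_zero {f : ℕ → K} : (f : Hyper 𝒰 K) ≠ 0 ↔ ∀ᶠ j in 𝒰, f j ≠ 0 := by
  rw [Ne, coe_eq_zero, ← Ultrafilter.eventually_not]

theorem coe_sum {ι : Type*} (s : Finset ι) (f : ι → ℕ → K) :
    ∑ i ∈ s, (f i : Hyper 𝒰 K) = ((fun j => ∑ i ∈ s, f i j : ℕ → K) : Hyper 𝒰 K) := by
  have := map_sum (Germ.coeRingHom (R := K) (𝒰 : Filter ℕ)) f s
  rw [Germ.coe_coeRingHom] at this
  rw [← this]
  congr 1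
  ext j
  simp

theorem coe_intForm {ι : Type*} [Fintype ι] (A : Matrix ι ι ℤ) (f : ι → ℕ → K) (i : ι) :
    intForm A (fun i => (f i : Hyper 𝒰 K)) i =
      ((fun j => intForm A (fun i => f i j) i : ℕ → K) : Hyper 𝒰 K) := by
  simp only [intForm_apply]
  rw [← coe_sum]
  rfl

theorem coe_det {n : ℕ} (f : Fin n → Fin n → ℕ → K) :
    (Matrix.of fun l i => (f l i : Hyper 𝒰 K)).det =
      ((fun j => (Matrix.of fun l i => f l i j).det : ℕ → K) : Hyper 𝒰 K) := by
  have h := RingHom.map_det (Germ.coeRingHom (R := K) (𝒰 : Filter ℕ)) (Matrix.of f)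
  refine Eq.trans h.symm ?_
  rw [Germ.coe_coeRingHom]
  congr 1
  ext j
  exact RingHom.map_det (Pi.evalRingHom (fun _ : ℕ => K) j) (Matrix.of f)

end Hyper

/-- Sequences of objects satisfying increasingly strong conditions can be diagonalised. -/
theorem Filter.exists_diagonal {𝒰 : Filter ℕ} (h𝒰 : 𝒰 ≤ atTop) {α : Type*} [Nonempty α]
    (Q : ℕ → ℕ → α → Prop) (hQ : ∀ᶠ j in 𝒰, ∀ k l z, k ≤ l → Q l j z → Q k j z)
    (hex : ∀ k, ∀ᶠ j in 𝒰, ∃ z, Q k j z) : ∃ Z : ℕ → α, ∀ k, ∀ᶠ j in 𝒰, Q k j (Z j) := by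
  classical
  refine ⟨fun j => Classical.epsilon (Q (Nat.findGreatest (fun k => ∃ z, Q k j z) j) j), fun k => ?_⟩
  filter_upwards [hQ, hex k, h𝒰 (eventually_ge_atTop k)] with j h1 h2 h3
  refine h1 k _ _ (Nat.le_findGreatest (P := fun k => ∃ z, Q k j z) h3 h2) ?_
  exact Classical.epsilon_spec (Nat.findGreatest_spec (P := fun k => ∃ z, Q k j z) h3 h2)

section Filtration

variable {𝒰 : Ultrafilter ℕ} {K : Type*} [Field K] {h : ℕ → ℝ}

open Hyper

theorem eventually_mul_exp_le (hh : Tendsto h 𝒰 atTop) (C : ℝ) {a b : ℝ} (hab : a < b) :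
    ∀ᶠ j in 𝒰, C * Real.exp (a * h j) ≤ Real.exp (b * h j) := by
  have h1 : Tendsto (fun j => Real.exp ((b - a) * h j)) 𝒰 atTop :=
    Real.tendsto_exp_atTop.comp (hh.const_mul_atTop (sub_pos.2 hab))
  filter_upwards [h1.eventually_ge_atTop C] with j hj
  calc C * Real.exp (a * h j) ≤ Real.exp ((b - a) * h j) * Real.exp (a * h j) := by gcongr
    _ = Real.exp (b * h j) := by rw [← Real.exp_add]; ring_nf

/-- The filtration of the field of germs by the growth of an absolute value relative to a given
scale. -/
def growthFiltration (f : AbsoluteValue K ℝ) (hh : Tendsto h 𝒰 atTop) :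
    LogFiltration (Hyper 𝒰 K) where
  bd c :=
    { carrier := {x | ∀ ε > 0, Ev (fun j y => f y ≤ Real.exp ((c + ε) * h j)) x}
      zero_mem' := fun ε _ => ⟨0, rfl, .of_forall fun j => by
        simp only [Pi.zero_apply, map_zero]; positivity⟩
      add_mem' := by
        intro x y hx hy ε hε
        induction x using Germ.inductionOn with | _ x => ?_
        induction y using Germ.inductionOn with | _ y => ?_
        rw [← Germ.coe_add, ev_coe]
        filter_upwards [ev_coe.1 (hx (ε / 2) (by positivity)), ev_coe.1 (hy (ε / 2) (by positivity)),
          eventually_mul_exp_le hh 2 (show c + ε / 2 < c + ε by linarith)] with j h1 h2 h3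
        have := f.add_le (x j) (y j)
        rw [Pi.add_apply]
        linarith
      neg_mem' := by
        intro x hx ε hε
        induction x using Germ.inductionOn with | _ x => ?_
        rw [← Germ.coe_neg, ev_coe]
        simpa using ev_coe.1 (hx ε hε) }
  mono := by
    intro a b hab x hx ε hε
    induction x using Germ.inductionOn with | _ x => ?_
    rw [ev_coe]
    filter_upwards [ev_coe.1 (hx ε hε), hh.eventually_ge_atTop 0] with j h1 h2
    exact h1.trans (by gcongr)
  one_mem := by
    intro ε hε
    refine ⟨1, rfl, ?_⟩
    filter_upwards [hh.eventually_ge_atTop 0] with j h2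
    rw [Pi.one_apply, map_one, Real.one_le_exp_iff]
    positivity
  mul_mem := by
    intro a b x y hx hy ε hε
    induction x using Germ.inductionOn with | _ x => ?_
    induction y using Germ.inductionOn with | _ y => ?_
    rw [← Germ.coe_mul, ev_coe]
    filter_upwards [ev_coe.1 (hx (ε / 2) (by positivity)), ev_coe.1 (hy (ε / 2) (by positivity))]
      with j h1 h2
    rw [Pi.mul_apply, map_mul, show (a + b + ε) * h j = (a + ε / 2) * h j + (b + ε / 2) * h j by ring,
      Real.exp_add]
    gcongr
  mem_or_inv_mem := by
    intro a x hx
    induction x using Germ.inductionOn with | _ x => ?_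
    rcases Ultrafilter.eventually_or.1 (.of_forall fun j => le_total (f (x j)) (Real.exp (a * h j)))
      with h0 | h0
    · left
      intro ε hε
      rw [ev_coe]
      filter_upwards [h0, hh.eventually_ge_atTop 0] with j h1 h2
      exact h1.trans (by gcongr; linarith)
    · right
      intro ε hε
      rw [← Germ.coe_inv, ev_coe]
      filter_upwards [h0, hh.eventually_ge_atTop 0] with j h1 h2
      rw [Pi.inv_apply, map_inv₀]
      calc (f (x j))⁻¹ ≤ (Real.exp (a * h j))⁻¹ := by gcongr
        _ = Real.exp (-a * h j) := by rw [← Real.exp_neg, neg_mul]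
        _ ≤ _ := by gcongr; linarith

theorem coe_mem_growthFiltration {f : AbsoluteValue K ℝ} {hh : Tendsto h 𝒰 atTop} {x : ℕ → K}
    {c : ℝ} : (x : Hyper 𝒰 K) ∈ (growthFiltration f hh).bd c ↔
      ∀ ε > 0, ∀ᶠ j in 𝒰, f (x j) ≤ Real.exp ((c + ε) * h j) :=
  forall₂_congr fun _ _ => ev_coe

/-- The subring of germs of sequences in a subring. -/
def hyperSubring (𝒰 : Ultrafilter ℕ) (O : Subring K) : Subring (Hyper 𝒰 K) where
  carrier := {x | Ev (fun _ y => y ∈ O) x}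
  zero_mem' := ⟨0, rfl, .of_forall fun _ => O.zero_mem⟩
  one_mem' := ⟨1, rfl, .of_forall fun _ => O.one_mem⟩
  add_mem' := by
    rintro _ _ ⟨x, rfl, hx⟩ ⟨y, rfl, hy⟩
    exact ⟨x + y, rfl, by filter_upwards [hx, hy] with j h1 h2 using O.add_mem h1 h2⟩
  mul_mem' := by
    rintro _ _ ⟨x, rfl, hx⟩ ⟨y, rfl, hy⟩
    exact ⟨x * y, rfl, by filter_upwards [hx, hy] with j h1 h2 using O.mul_mem h1 h2⟩
  neg_mem' := by
    rintro _ ⟨x, rfl, hx⟩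
    exact ⟨-x, rfl, by filter_upwards [hx] with j h1 using O.neg_mem h1⟩

theorem coe_mem_hyperSubring {O : Subring K} {x : ℕ → K} :
    (x : Hyper 𝒰 K) ∈ hyperSubring 𝒰 O ↔ ∀ᶠ j in 𝒰, x j ∈ O := ev_coe

end Filtration

open Filter Hyper

namespace PlaceData

variable {𝒰 : Ultrafilter ℕ} {K : Type*} [Field K] {S : Type*} [Fintype S] {h : ℕ → ℝ}

/-- The asymptotic places on the field of germs attached to a scale tending to infinity. -/
def asymptoticPlaces (𝔖 : PlaceData K S) (h𝒰 : (𝒰 : Filter ℕ) ≤ atTop)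
    (hh : Tendsto h 𝒰 atTop) : AsymptoticPlaces (Hyper 𝒰 K) S where
  B v := growthFiltration (𝔖.abv v) hh
  e := 𝔖.e
  e_pos := 𝔖.e_pos
  O := hyperSubring 𝒰 𝔖.O
  sum_nonneg := by
    intro x hx hx0 c hc
    induction x using Germ.inductionOn with | _ x => ?_
    have hε : ∀ ε > 0, 0 ≤ ∑ v, (𝔖.e v : ℝ) * (c v + ε) := by
      intro ε hε
      have h1 : ∀ᶠ j in 𝒰, 0 ≤ (∑ v, (𝔖.e v : ℝ) * (c v + ε)) * h j := by
        filter_upwards [coe_mem_hyperSubring.1 hx, coe_ne_zero.1 hx0,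
          eventually_all.2 fun v => coe_mem_growthFiltration.1 (hc v) ε hε] with j h1 h2 h3
        rw [← Real.one_le_exp_iff, Finset.sum_mul, Real.exp_sum]
        refine (𝔖.one_le_prod _ h1 h2).trans (Finset.prod_le_prod (fun v _ => by positivity)
          fun v _ => ?_)
        rw [mul_assoc, Real.exp_nat_mul]
        gcongr
        exact h3 v
      obtain ⟨j, hj, hj'⟩ := (h1.and (hh.eventually_gt_atTop 0)).exists
      exact nonneg_of_mul_nonneg_left hj hj'
    have h2 : Tendsto (fun ε : ℝ => ∑ v, (𝔖.e v : ℝ) * (c v + ε)) (nhdsWithin 0 (Set.Ioi 0))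
        (nhds (∑ v, (𝔖.e v : ℝ) * (c v + 0))) :=
      tendsto_nhdsWithin_of_tendsto_nhds (Continuous.tendsto (by fun_prop) 0)
    simpa using ge_of_tendsto h2 (eventually_nhdsWithin_of_forall hε)
  exists_small := by
    classical
    intro n A hn hA c hc
    obtain ⟨C, hC, hex⟩ := 𝔖.exists_small n A hn hA
    have h1 : ∀ᶠ j in 𝒰, ∃ x : Fin n → K, x ≠ 0 ∧ (∀ i, x i ∈ 𝔖.O) ∧
        ∀ v i, 𝔖.abv v (∑ k, (A v i k : K) * x k) ≤ Real.exp (c v i * h j) := by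
      filter_upwards [eventually_mul_exp_le hh C hc] with j hj
      refine hex (fun v i => Real.exp (c v i * h j)) (fun _ _ => Real.exp_pos _) ?_
      rw [zero_mul, Real.exp_zero, mul_one] at hj
      refine hj.trans_eq ?_
      simp only [Finset.sum_mul, Finset.mul_sum, Real.exp_sum]
      refine Finset.prod_congr rfl fun v _ => Finset.prod_congr rfl fun i _ => ?_
      rw [mul_assoc, Real.exp_nat_mul]
    obtain ⟨X, hX⟩ := h1.choice
    refine ⟨fun i => ((fun j => X j i : ℕ → K) : Hyper 𝒰 K), fun h0 => ?_, fun i => ?_,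
      fun v i => ?_⟩
    · have h2 : ∀ᶠ j in 𝒰, ∀ i, X j i = 0 :=
        eventually_all.2 fun i => coe_eq_zero.1 (congrFun h0 i)
      obtain ⟨j, hj, hj'⟩ := (h2.and hX).exists
      exact hj'.1 (funext hj)
    · rw [coe_mem_hyperSubring]
      filter_upwards [hX] with j hj using hj.2.1 i
    · rw [coe_intForm (A v) fun i j => X j i]
      rw [coe_mem_growthFiltration]
      intro ε hε
      filter_upwards [hX, hh.eventually_ge_atTop 0] with j hj h0
      rw [intForm_apply]
      exact (hj.2.2 v i).trans (by gcongr; linarith)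
  closed := by
    intro n A c hex
    obtain ⟨Q, hQ⟩ : ∃ Q : ℕ → ℕ → (Fin n → Fin n → K) → Prop, Q = fun (k : ℕ) j z =>
      (Matrix.of z).det ≠ 0 ∧ (∀ l i, z l i ∈ 𝔖.O) ∧
      ∀ v l i, 𝔖.abv v (intForm (A v) (z l) i) ≤ Real.exp ((c v l i + 2 / (k + 1)) * h j) := ⟨_, rfl⟩
    obtain ⟨Z, hZ⟩ := Filter.exists_diagonal h𝒰 Q (by
        filter_upwards [hh.eventually_ge_atTop 0] with j hj k l z hkl
        rw [hQ]
        rintro ⟨h1, h2, h3⟩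
        exact ⟨h1, h2, fun v i i' => (h3 v i i').trans (by gcongr)⟩) (by
        intro k
        obtain ⟨z, h1, h2, h3⟩ := hex (1 / (k + 1)) (by positivity)
        choose f hf using fun l => exists_rep (z l)
        obtain rfl : z = fun l i => (f l i : Hyper 𝒰 K) := funext fun l => funext (hf l)
        rw [coe_det, coe_ne_zero] at h1
        simp only [coe_mem_hyperSubring] at h2
        simp only [coe_intForm, coe_mem_growthFiltration] at h3
        filter_upwards [h1, eventually_all.2 fun l => eventually_all.2 fun i => h2 l i,
          eventually_all.2 fun v => eventually_all.2 fun l => eventually_all.2 fun i =>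
            h3 v l i (1 / (k + 1)) (by positivity)] with j h4 h5 h6
        refine ⟨fun l i => f l i j, ?_⟩
        rw [hQ]
        refine ⟨h4, h5, fun v l i => (h6 v l i).trans_eq ?_⟩
        rw [add_assoc, ← add_div, one_add_one_eq_two])
    rw [hQ] at hZ
    refine ⟨fun l i => ((fun j => Z j l i : ℕ → K) : Hyper 𝒰 K), ?_, fun l i => ?_,
      fun v l i => ?_⟩
    · rw [coe_det fun l i j => Z j l i, coe_ne_zero]
      filter_upwards [hZ 0] with j hj using hj.1
    · rw [coe_mem_hyperSubring]
      filter_upwards [hZ 0] with j hj using hj.2.1 l i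
    · rw [coe_intForm (A v) fun i j => Z j l i, coe_mem_growthFiltration]
      intro ε hε
      obtain ⟨k, hk⟩ := exists_nat_gt (2 / ε)
      filter_upwards [hZ k, hh.eventually_ge_atTop 0] with j hj h0
      refine (hj.2.2 v l i).trans ?_
      have : (2 : ℝ) / (k + 1) ≤ ε := by
        rw [div_lt_iff₀ hε] at hk
        rw [div_le_iff₀ (by positivity)]
        nlinarith
      gcongr

theorem exists_separated_indices (hh : Tendsto h 𝒰 atTop) {P : ℕ → Prop} (hP : ∀ᶠ j in 𝒰, P j)
    (ω : ℝ) (m : ℕ) : ∃ k : Fin m → ℕ, (∀ i, P (k i)) ∧ ∀ i j, i < j → ω * h (k j) ≤ h (k i) := by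
  induction m with
  | zero => exact ⟨Fin.elim0, fun i => i.elim0, fun i => i.elim0⟩
  | succ m ih =>
    obtain ⟨k, hk, hk'⟩ := ih
    obtain ⟨j, hj, hj'⟩ := (hP.and (eventually_all.2 fun i : Fin m =>
      hh.eventually_ge_atTop (ω * h (k i)))).exists
    refine ⟨Fin.cons j k, fun i => Fin.cases hj hk i, fun a b hab => ?_⟩
    cases b using Fin.cases with
    | zero => exact absurd hab (Fin.not_lt_zero a)
    | succ b =>
      cases a using Fin.cases with
      | zero => simpa using hj' b
      | succ a => simpa using hk' a b (Fin.succ_lt_succ_iff.1 hab)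

theorem eventually_ker_subset_span {N : ℕ} {g : Fin N → Fin N → ℕ → K} {y : Fin N → ℕ → K}
    (H : ∀ x : Fin N → Hyper 𝒰 K, ∑ i, (y i : Hyper 𝒰 K) * x i = 0 →
      x ∈ Submodule.span (Hyper 𝒰 K) (Set.range fun l i => (g l i : Hyper 𝒰 K))) :
    ∀ᶠ j in 𝒰, ∀ x : Fin N → K, ∑ i, y i j * x i = 0 →
      x ∈ Submodule.span K (Set.range fun l i => g l i j) := by
  by_contra hcon
  rw [← Ultrafilter.eventually_not] at hcon
  have h1 : ∀ᶠ j in 𝒰, ∃ x : Fin N → K, ∑ i, y i j * x i = 0 ∧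
      x ∉ Submodule.span K (Set.range fun l i => g l i j) := by
    filter_upwards [hcon] with j hj
    push Not at hj
    exact hj
  obtain ⟨X, hX⟩ := h1.choice
  have h2 := H (fun i => ((fun j => X j i : ℕ → K) : Hyper 𝒰 K)) (by
    change ∑ i, ((fun j => y i j * X j i : ℕ → K) : Hyper 𝒰 K) = 0
    rw [coe_sum, coe_eq_zero]
    filter_upwards [hX] with j hj using hj.1)
  obtain ⟨α, hα⟩ := (Submodule.mem_span_range_iff_exists_fun _).1 h2
  obtain ⟨β, hβ⟩ := exists_rep α
  have h3 : ∀ᶠ j in 𝒰, ∀ i, ∑ l, β l j * g l i j = X j i := by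
    refine eventually_all.2 fun i => ?_
    have h4 := congrFun hα i
    simp only [Finset.sum_apply, Pi.smul_apply, smul_eq_mul, hβ] at h4
    change ∑ l, ((fun j => β l j * g l i j : ℕ → K) : Hyper 𝒰 K) = _ at h4
    rw [coe_sum] at h4
    exact Germ.coe_eq.1 h4
  obtain ⟨j, hj, hj'⟩ := (h3.and hX).exists
  refine hj'.2 ((Submodule.mem_span_range_iff_exists_fun _).2 ⟨fun l => β l j, ?_⟩)
  ext i
  simpa using hj i

/-- A vector of germs which is small at the places of a system of negative weight cannot be linearly
independent over a subfield `F` such that the elements outside `F` satisfy height bounds. -/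
theorem exists_relation [CharZero K] (𝔖 : PlaceData K S) (h𝒰 : (𝒰 : Filter ℕ) ≤ atTop)
    (hh : Tendsto h 𝒰 atTop) (F : Subfield (Hyper 𝒰 K))
    (hF : ∀ ξ : ℕ → K, (ξ : Hyper 𝒰 K) ∉ F → ∃ c₀ > 0, ∀ᶠ j in 𝒰, HB (ξ j) (c₀ * h j))
    {n : ℕ} (A M : S → Matrix (Fin n) (Fin n) ℤ) (hMA : ∀ v, M v * A v = 1) (c : S → Fin n → ℝ)
    (hc : ∑ v, 𝔖.e v * ∑ i, c v i < 0) (w : Fin n → Hyper 𝒰 K)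
    (hwO : ∀ i, w i ∈ hyperSubring 𝒰 𝔖.O)
    (hw : ∀ v i, intForm (A v) w i ∈ (growthFiltration (𝔖.abv v) hh).bd (c v i)) :
    ∃ d : Fin n → Hyper 𝒰 K, (∀ i, d i ∈ F) ∧ ∑ i, d i * w i = 0 ∧ ∃ i, d i ≠ 0 := by
  by_contra! hcon
  obtain ⟨N, A', M', c', g, y, a, b, hMA', hc', hgO, hg, hya, hspan, hyb⟩ :=
    (𝔖.asymptoticPlaces h𝒰 hh).exists_hyperplane_system F A M hMA c hc w hwO hw hcon
  have : Nonempty (Fin N) := ⟨a⟩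
  choose G hG using fun l => exists_rep (g l)
  obtain rfl : g = fun l i => (G l i : Hyper 𝒰 K) := funext fun l => funext (hG l)
  obtain ⟨Y, hY⟩ := exists_rep y
  obtain rfl : y = fun i => (Y i : Hyper 𝒰 K) := funext hY
  have hab : a ≠ b := by
    rintro rfl
    rw [div_self hya] at hyb
    exact hyb F.one_mem
  obtain ⟨c₀, hc₀, hHB⟩ := hF (fun j => -(Y b j / Y a j)) (fun hmem => hyb (by
    rw [← neg_neg (_ / _)]
    exact F.neg_mem hmem))
  obtain ⟨m, ε, A₀, ω, -, hε, hmach⟩ := 𝔖.parametric_bound (μ := Fin N) A' M' hMA' c' hc' hc₀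
  have hgood := ((((hh.eventually_ge_atTop A₀).and (eventually_all.2 fun l => eventually_all.2
    fun i => coe_mem_hyperSubring.1 (hgO l i))).and (eventually_all.2 fun v => eventually_all.2
    fun l => eventually_all.2 fun i => by
      have := hg v l i
      rw [coe_intForm] at this
      exact (coe_mem_growthFiltration (hh := hh)).1 this ε hε)).and
    ((coe_ne_zero.1 hya).and hHB)).and (eventually_ker_subset_span hspan)
  obtain ⟨k, hk, hk'⟩ := exists_separated_indices hh hgood ω m
  refine hmach (fun i => h (k i)) (fun i l t => G l t (k i)) (fun i t => Y t (k i)) a b hab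
    (fun i => (hk i).1.1.1.1) hk' (fun i => (hk i).1.1.1.2) (fun v i l t => ?_)
    (fun i => (hk i).1.2.1) (fun i => (hk i).2) (fun i => (hk i).1.2.2)
  rw [← intForm_apply]
  exact (hk i).1.1.2 v l t

end PlaceData

open Filter Polynomial NumberField Height

section HeightBound

variable {K : Type*} [Field K] [NumberField K]

theorem sum_norm_coeff_map_le (V : ℤ[X]) :
    ((V.map (Int.castRingHom ℂ)).sum fun _ a => ‖a‖) ≤ lonep V := by
  rw [Polynomial.sum_def, lonep, pseminorm_eq_sum_support]
  refine (Finset.sum_le_sum_of_subset_of_nonneg (support_map_subset _ _)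
    fun _ _ _ => norm_nonneg _).trans (Finset.sum_le_sum fun n _ => ?_)
  rw [intSeminorm_apply, coeff_map, eq_intCast]
  rw [Complex.norm_intCast]

omit [NumberField K] in
/-- The part of the height bound for the multiplicity of a root coming from an infinite place. -/
theorem infinitePlace_max_pow_mul_leadingCoeff_le (v : InfinitePlace K) {V : ℤ[X]} {ξ : K} {e : ℕ}
    {W : K[X]} (hW : V.map (Int.castRingHom K) = (X - C ξ) ^ e * W) :
    max (v ξ) 1 ^ e * v W.leadingCoeff ≤ lonep V := by
  have h1 : V.map (Int.castRingHom ℂ) = (X - C (v.embedding ξ)) ^ e * W.map v.embedding := by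
    have := congrArg (Polynomial.map v.embedding) hW
    rw [Polynomial.map_map, Subsingleton.elim (v.embedding.comp (Int.castRingHom K)) (Int.castRingHom ℂ)] at this
    rw [this]
    simp
  have h2 : (V.map (Int.castRingHom ℂ)).mahlerMeasure =
      max (v ξ) 1 ^ e * (W.map v.embedding).mahlerMeasure := by
    have h3 : ∀ n : ℕ, ((X - C (v.embedding ξ)) ^ n).mahlerMeasure = max (v ξ) 1 ^ n := by
      intro n
      induction n with
      | zero => simp
      | succ n ih =>
        rw [pow_succ, mahlerMeasure_mul, ih, mahlerMeasure_X_sub_C, v.norm_embedding_eq, max_comm,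
          pow_succ]
    rw [h1, mahlerMeasure_mul, h3]
  have h4 := leadingCoeff_le_mahlerMeasure (W.map v.embedding)
  rw [leadingCoeff_map, v.norm_embedding_eq] at h4
  calc max (v ξ) 1 ^ e * v W.leadingCoeff
      ≤ max (v ξ) 1 ^ e * (W.map v.embedding).mahlerMeasure := by gcongr
    _ = _ := h2.symm
    _ ≤ _ := mahlerMeasure_le_sum_norm_coeff _
    _ ≤ _ := sum_norm_coeff_map_le V

theorem FinitePlace.isNonarchimedean (v : FinitePlace K) : IsNonarchimedean v.val :=
  fun x y => FinitePlace.add_le v x y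

theorem FinitePlace.apply_intCast_le_one (v : FinitePlace K) (n : ℤ) : v (n : K) ≤ 1 := by
  rw [show (n : K) = ((n : 𝓞 K) : K) by simp, ← FinitePlace.norm_embedding_eq]
  exact FinitePlace.norm_le_one _ _ _

/-- The part of the height bound for the multiplicity of a root coming from a finite place. -/
theorem finitePlace_max_pow_mul_leadingCoeff_le (v : FinitePlace K) {V : ℤ[X]} {ξ : K} {e : ℕ}
    {W : K[X]} (hW : V.map (Int.castRingHom K) = (X - C ξ) ^ e * W) :
    max (v ξ) 1 ^ e * v W.leadingCoeff ≤ 1 := by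
  have hna := FinitePlace.isNonarchimedean v
  have h3 : ∀ n : ℕ, max (v ξ) 1 ^ n ≤ ((X - C ξ) ^ n).gaussNorm v.val 1 := by
    intro n
    induction n with
    | zero => rw [pow_zero, pow_zero, ← C_1, gaussNorm_C]; simp
    | succ n ih =>
      have h5 : max (v ξ) 1 ≤ (X - C ξ).gaussNorm v.val 1 := by
        refine max_le ?_ ?_
        · have := le_gaussNorm v.val (X - C ξ) zero_le_one 0
          simpa [FinitePlace.coe_apply] using this
        · have := le_gaussNorm v.val (X - C ξ) zero_le_one 1
          simpa [coeff_C] using this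
      rw [pow_succ, pow_succ, gaussNorm_mul hna one_pos]
      exact mul_le_mul ih h5 (by positivity) (gaussNorm_nonneg _ _ zero_le_one)
  have h4 : v W.leadingCoeff ≤ W.gaussNorm v.val 1 := by
    have := le_gaussNorm v.val W zero_le_one W.natDegree
    simpa [FinitePlace.coe_apply] using this
  have h6 : (V.map (Int.castRingHom K)).gaussNorm v.val 1 ≤ 1 := by
    obtain ⟨i, hi⟩ := exists_eq_gaussNorm v.val 1 (V.map (Int.castRingHom K))
    rw [hi, one_pow, mul_one, coeff_map, eq_intCast]
    exact FinitePlace.apply_intCast_le_one v _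
  rw [hW, gaussNorm_mul hna one_pos] at h6
  exact (mul_le_mul (h3 e) h4 (apply_nonneg _ _) (gaussNorm_nonneg _ _ zero_le_one)).trans h6

theorem hasFiniteMulSupport_max_one (x : K) :
    (fun v : FinitePlace K => max (v x) 1).HasFiniteMulSupport := by
  by_cases hx : x = 0
  · simp [hx, Function.HasFiniteMulSupport, Function.mulSupport]
  · refine (FinitePlace.hasFiniteMulSupport hx).subset fun v hv h => hv ?_
    simp only at h
    simp [h]

/-- The multiplicity of a root of an integral polynomial is bounded in terms of its height. -/
theorem mulHeight₁_pow_le {V : ℤ[X]} (hV : V ≠ 0) {ξ : K} {e : ℕ}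
    (h : (X - C ξ) ^ e ∣ V.map (Int.castRingHom K)) :
    mulHeight₁ ξ ^ e ≤ lonep V ^ Module.finrank ℚ K := by
  obtain ⟨W, hW⟩ := h
  have hV' : V.map (Int.castRingHom K) ≠ 0 :=
    (Polynomial.map_ne_zero_iff (RingHom.injective_int _)).2 hV
  have hα : W.leadingCoeff ≠ 0 := by
    rw [Ne, leadingCoeff_eq_zero]
    rintro rfl
    exact hV' (by rw [hW, mul_zero])
  obtain ⟨α, hαW⟩ : ∃ α, α = W.leadingCoeff := ⟨_, rfl⟩
  rw [← hαW] at hα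
  have hfin := FinitePlace.hasFiniteMulSupport hα
  have hmax := hasFiniteMulSupport_max_one ξ
  have hpow : (fun v : FinitePlace K => max (v ξ) 1 ^ e).HasFiniteMulSupport :=
    hmax.subset fun v hv h => hv (by simp only at h; simp [h])
  calc mulHeight₁ ξ ^ e
      = mulHeight₁ ξ ^ e * ((∏ w : InfinitePlace K, w α ^ w.mult) * ∏ᶠ w : FinitePlace K, w α) := by
        rw [prod_abs_eq_one hα, mul_one]
    _ = (∏ v : InfinitePlace K, (max (v ξ) 1 ^ e * v α) ^ v.mult) *
          ∏ᶠ v : FinitePlace K, max (v ξ) 1 ^ e * v α := by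
        rw [NumberField.mulHeight₁_eq, finprod_mul_distrib hpow hfin, ← finprod_pow hmax]
        simp only [mul_pow, Finset.prod_mul_distrib, ← Finset.prod_pow, ← pow_mul, mul_comm e]
        ring
    _ ≤ (∏ v : InfinitePlace K, lonep V ^ v.mult) * 1 := by
        refine mul_le_mul ?_ ?_ (finprod_nonneg fun v => by positivity)
          (Finset.prod_nonneg fun v _ => pow_nonneg (apply_nonneg _ _) _)
        · refine Finset.prod_le_prod (fun v _ => by positivity) fun v _ => ?_
          exact pow_le_pow_left₀ (by positivity)
            (hαW ▸ infinitePlace_max_pow_mul_leadingCoeff_le v hW) _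
        · refine (finprod_induction (fun x : ℝ => 0 ≤ x ∧ x ≤ 1) ⟨zero_le_one, le_rfl⟩
            (fun x y hx hy => ⟨mul_nonneg hx.1 hy.1, mul_le_one₀ hx.2 hy.1 hy.2⟩) fun v => ?_).2
          exact ⟨by positivity, hαW ▸ finitePlace_max_pow_mul_leadingCoeff_le v hW⟩
    _ = _ := by rw [Finset.prod_pow_eq_pow_sum, InfinitePlace.sum_mult_eq, mul_one]

theorem HB.of_logHeight₁ {ξ : K} {η : ℝ} (h : Module.finrank ℚ K * η ≤ logHeight₁ ξ) : HB ξ η := by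
  intro V hV e he
  have h1 := Real.log_le_log (pow_pos (mulHeight₁_pos ξ) e) (mulHeight₁_pow_le hV he)
  rw [Real.log_pow, Real.log_pow, ← logHeight₁_eq_log_mulHeight₁] at h1
  have h2 : (0 : ℝ) < Module.finrank ℚ K := by exact_mod_cast Module.finrank_pos
  have h3 : Module.finrank ℚ K * (e * η) ≤ Module.finrank ℚ K * Real.log (lonep V) := by
    calc _ = e * (Module.finrank ℚ K * η) := by ring
      _ ≤ e * logHeight₁ ξ := by gcongr
      _ ≤ _ := h1
  exact le_of_mul_le_mul_left h3 h2

end HeightBound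

namespace Hyper

variable {K : Type*} [Field K] [NumberField K] {𝒰 : Ultrafilter ℕ} {h : ℕ → ℝ}

/-- The field of germs of sequences whose height is negligible compared with `h`. -/
def slowField (hh : Tendsto h 𝒰 atTop) : Subfield (Hyper 𝒰 K) where
  carrier := {x | ∀ ε > 0, Ev (fun j y => logHeight₁ y ≤ ε * h j) x}
  zero_mem' ε hε := by
    refine ev_coe (f := fun _ => 0).2 ?_
    filter_upwards [hh.eventually_ge_atTop 0] with j hj
    simp only [logHeight₁_zero]; positivity
  one_mem' ε hε := by
    refine ev_coe (f := fun _ => 1).2 ?_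
    filter_upwards [hh.eventually_ge_atTop 0] with j hj
    simp only [logHeight₁_one]; positivity
  neg_mem' {x} hx ε hε := by
    induction x using Germ.inductionOn with | _ x => ?_
    refine ev_coe (f := fun j => - x j).2 ?_
    filter_upwards [ev_coe.1 (hx ε hε)] with j hj
    rwa [logHeight₁_neg]
  inv_mem' x hx ε hε := by
    induction x using Germ.inductionOn with | _ x => ?_
    refine ev_coe (f := fun j => (x j)⁻¹).2 ?_
    filter_upwards [ev_coe.1 (hx ε hε)] with j hj
    rwa [logHeight₁_inv]
  mul_mem' {x y} hx hy ε hε := by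
    induction x using Germ.inductionOn with | _ x => ?_
    induction y using Germ.inductionOn with | _ y => ?_
    refine ev_coe (f := fun j => x j * y j).2 ?_
    filter_upwards [ev_coe.1 (hx (ε / 2) (half_pos hε)), ev_coe.1 (hy (ε / 2) (half_pos hε))]
      with j hj hj'
    linarith [logHeight₁_mul_le (x j) (y j)]
  add_mem' {x y} hx hy ε hε := by
    induction x using Germ.inductionOn with | _ x => ?_
    induction y using Germ.inductionOn with | _ y => ?_
    refine ev_coe (f := fun j => x j + y j).2 ?_
    filter_upwards [ev_coe.1 (hx (ε / 3) (by positivity)), ev_coe.1 (hy (ε / 3) (by positivity)),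
      hh.eventually_ge_atTop (totalWeight K * Real.log 2 / (ε / 3))] with j hj hj' hj''
    rw [div_le_iff₀ (by positivity)] at hj''
    linarith [logHeight₁_add_le (x j) (y j)]

theorem coe_mem_slowField {hh : Tendsto h 𝒰 atTop} {x : ℕ → K} :
    (x : Hyper 𝒰 K) ∈ slowField hh ↔ ∀ ε > 0, ∀ᶠ j in 𝒰, logHeight₁ (x j) ≤ ε * h j :=
  forall₂_congr fun _ _ => ev_coe

theorem exists_HB_of_notMem_slowField (hh : Tendsto h 𝒰 atTop) (ξ : ℕ → K)
    (hξ : (ξ : Hyper 𝒰 K) ∉ slowField hh) : ∃ c₀ > 0, ∀ᶠ j in 𝒰, HB (ξ j) (c₀ * h j) := by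
  rw [coe_mem_slowField] at hξ
  push Not at hξ
  obtain ⟨ε, hε, h1⟩ := hξ
  have h2 : (0 : ℝ) < Module.finrank ℚ K := by exact_mod_cast Module.finrank_pos
  refine ⟨ε / Module.finrank ℚ K, by positivity, ?_⟩
  filter_upwards [h1] with j hj
  refine HB.of_logHeight₁ (le_trans (le_of_eq ?_) hj.le)
  field_simp

end Hyper

open NumberField

section Cells

theorem exists_fin_map {α β : Type*} (s : Finset β) (g : α → β) (hg : ∀ a, g a ∈ s) :
    ∃ f : α → Fin s.card, ∀ a b, f a = f b → g a = g b := by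
  refine ⟨fun a => s.equivFin ⟨g a, hg a⟩, fun a b h => ?_⟩
  simpa using h

theorem floor_mem_Icc {t s : ℝ} (h : |t| ≤ s) : ⌊t⌋ ∈ Finset.Icc (-⌈s⌉) ⌈s⌉ := by
  rw [abs_le] at h
  rw [Finset.mem_Icc]
  constructor
  · rw [Int.le_floor]
    push_cast
    linarith [Int.le_ceil s]
  · exact Int.cast_le (R := ℝ).1 ((Int.floor_le t).trans (h.2.trans (Int.le_ceil s)))

theorem card_Icc_ceil_le {s : ℝ} (hs : 2 ≤ s) :
    ((Finset.Icc (-⌈s⌉) ⌈s⌉).card : ℝ) ≤ 7 / 2 * s := by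
  have h0 : 0 ≤ ⌈s⌉ := Int.ceil_nonneg (by linarith)
  have h1 : (((Finset.Icc (-⌈s⌉) ⌈s⌉).card : ℤ) : ℝ) = ((2 * ⌈s⌉ + 1 : ℤ) : ℝ) := by
    rw [Int.card_Icc]
    congr 1
    omega
  rw [← Int.cast_natCast, h1]
  push_cast
  linarith [Int.ceil_lt_add_one s]

theorem abs_sub_le_of_floor_eq {x y r : ℝ} (hr : 0 < r) (h : ⌊x / r⌋ = ⌊y / r⌋) : |x - y| ≤ r := by
  have h1 := Int.abs_sub_lt_one_of_floor_eq_floor h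
  rw [← sub_div, abs_div, abs_of_pos hr, div_lt_one hr] at h1
  exact h1.le

variable {K : Type*} [Field K] [NumberField K]

omit [NumberField K] in
/-- The elements of a number field of bounded size at an infinite place can be divided into few
cells of small diameter. -/
theorem infinitePlace_exists_cells (v : InfinitePlace K) {R X : ℝ} (hR : 0 < R) (hRX : R ≤ X) :
    ∃ (N : ℕ) (f : {x : K // v x ≤ X} → Fin N), (∀ x y, f x = f y → v (x.1 - y.1) ≤ R) ∧
      (N : ℝ) ≤ (7 * X / R) ^ v.mult := by
  classical
  obtain ⟨s, hs⟩ : ∃ s, s = X / (R / 2) := ⟨_, rfl⟩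
  have hs2 : 2 ≤ s := by
    rw [hs, le_div_iff₀ (by positivity)]
    linarith
  have hcard : ((Finset.Icc (-⌈s⌉) ⌈s⌉).card : ℝ) ≤ 7 * X / R := by
    refine (card_Icc_ceil_le hs2).trans (le_of_eq ?_)
    rw [hs]
    field_simp
  have habs : ∀ t : ℝ, |t| ≤ X → |t / (R / 2)| ≤ s := fun t ht => by
    rw [abs_div, abs_of_pos (half_pos hR), hs]
    gcongr
  have hre : ∀ x : {x : K // v x ≤ X},
      ⌊(v.embedding x.1).re / (R / 2)⌋ ∈ Finset.Icc (-⌈s⌉) ⌈s⌉ := fun x =>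
    floor_mem_Icc (habs _ ((Complex.abs_re_le_norm _).trans
      ((v.norm_embedding_eq x.1).le.trans x.2)))
  have him : ∀ x : {x : K // v x ≤ X},
      ⌊(v.embedding x.1).im / (R / 2)⌋ ∈ Finset.Icc (-⌈s⌉) ⌈s⌉ := fun x =>
    floor_mem_Icc (habs _ ((Complex.abs_im_le_norm _).trans
      ((v.norm_embedding_eq x.1).le.trans x.2)))
  by_cases hv : v.IsReal
  · obtain ⟨f, hf⟩ := exists_fin_map _ _ hre
    refine ⟨_, f, fun x y hxy => ?_, ?_⟩
    · have h1 := abs_sub_le_of_floor_eq (half_pos hR) (hf x y hxy)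
      have h2 : ∀ z, (v.embedding z).im = 0 := fun z => by
        rw [← InfinitePlace.embedding_of_isReal_apply hv, Complex.ofReal_im]
      rw [← v.norm_embedding_eq, map_sub]
      refine (Complex.norm_le_abs_re_add_abs_im _).trans ?_
      rw [Complex.sub_re, Complex.sub_im, h2, h2]
      simp only [sub_zero, abs_zero, add_zero]
      linarith
    · rwa [InfinitePlace.mult_isReal ⟨v, hv⟩, pow_one]
  · obtain ⟨f, hf⟩ := exists_fin_map (Finset.Icc (-⌈s⌉) ⌈s⌉ ×ˢ Finset.Icc (-⌈s⌉) ⌈s⌉)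
      (fun x : {x : K // v x ≤ X} =>
        (⌊(v.embedding x.1).re / (R / 2)⌋, ⌊(v.embedding x.1).im / (R / 2)⌋))
      (fun x => Finset.mem_product.2 ⟨hre x, him x⟩)
    refine ⟨_, f, fun x y hxy => ?_, ?_⟩
    · have h0 := Prod.ext_iff.1 (hf x y hxy)
      have h1 := abs_sub_le_of_floor_eq (half_pos hR) h0.1
      have h2 := abs_sub_le_of_floor_eq (half_pos hR) h0.2
      rw [← v.norm_embedding_eq, map_sub]
      refine (Complex.norm_le_abs_re_add_abs_im _).trans ?_
      rw [Complex.sub_re, Complex.sub_im]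
      linarith
    · rw [InfinitePlace.mult_isComplex ⟨v, InfinitePlace.not_isReal_iff_isComplex.1 hv⟩,
        Finset.card_product, Nat.cast_mul, ← sq]
      gcongr

/-- The algebraic integers can be divided into few cells of small diameter with respect to a
finite place. -/
theorem finitePlace_exists_cells (v : FinitePlace K) {R : ℝ} (hR : 0 < R) (hR1 : R ≤ 1) :
    ∃ (N : ℕ) (f : 𝓞 K → Fin N), (∀ x y : 𝓞 K, f x = f y → v ((x : K) - y) ≤ R) ∧
      (N : ℝ) ≤ v.maximalIdeal.asIdeal.absNorm / R := by
  classical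
  obtain ⟨P, hP⟩ : ∃ P, P = v.maximalIdeal.asIdeal := ⟨_, rfl⟩
  obtain ⟨q, hq⟩ : ∃ q : ℝ, q = P.absNorm := ⟨_, rfl⟩
  have hq1 : 1 < q := by
    rw [hq, hP]
    exact_mod_cast HeightOneSpectrum.one_lt_absNorm v.maximalIdeal
  obtain ⟨k, hk⟩ := pow_unbounded_of_one_lt R⁻¹ hq1
  have hex : ∃ m : ℕ, R⁻¹ ≤ q ^ m := ⟨k, hk.le⟩
  obtain ⟨m, hm, hmq⟩ : ∃ m : ℕ, R⁻¹ ≤ q ^ m ∧ q ^ m ≤ q / R := by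
    refine ⟨Nat.find hex, Nat.find_spec hex, ?_⟩
    rcases hf : Nat.find hex with _ | j
    · rw [pow_zero, le_div_iff₀ hR]
      linarith
    · have h1 := not_le.1 (Nat.find_min hex (m := j) (by omega))
      rw [pow_succ', div_eq_mul_inv]
      gcongr
  have hcard : Nat.card (𝓞 K ⧸ P ^ m) = P.absNorm ^ m := by
    rw [← map_pow, Ideal.absNorm_apply, Submodule.cardQuot_apply]
  have : Finite (𝓞 K ⧸ P ^ m) := by
    refine Nat.finite_of_card_ne_zero ?_
    rw [hcard]
    refine pow_ne_zero _ fun h => ?_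
    rw [hq, h] at hq1
    norm_num at hq1
  refine ⟨_, fun x => Finite.equivFin (𝓞 K ⧸ P ^ m) (Ideal.Quotient.mk _ x), fun x y hxy => ?_, ?_⟩
  · have h1 : x - y ∈ P ^ m := Ideal.Quotient.eq.1 ((Finite.equivFin _).injective hxy)
    by_cases h0 : x - y = 0
    · rw [sub_eq_zero] at h0
      simp [h0, hR.le]
    have h2 := FinitePlace.apply_mul_absNorm_pow_eq_one v h0
    rw [← hP, ← hq] at h2
    have h3 : m ≤ multiplicity P (Ideal.span {x - y}) := by
      refine FiniteMultiplicity.le_multiplicity_of_pow_dvd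
        (FiniteMultiplicity.of_prime_left (hP ▸ v.maximalIdeal.prime) ?_)
        ((Ideal.dvd_span_singleton).2 h1)
      simpa using h0
    have h4 : v ((x : K) - y) = (q ^ multiplicity P (Ideal.span {x - y}))⁻¹ :=
      eq_inv_of_mul_eq_one_left (by simpa using h2)
    rw [h4]
    refine inv_le_of_inv_le₀ hR (hm.trans ?_)
    exact pow_le_pow_right₀ hq1.le h3
  · rw [hcard, ← hP, ← hq]
    push_cast
    rwa [← hq]

end Cells

open NumberField

/-- The infinite places of a number field together with the finite places dividing `A`. -/
abbrev SPlace (K : Type*) [Field K] [NumberField K] (A : ℕ) :=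
  InfinitePlace K ⊕ {v : FinitePlace K // v (A : K) ≠ 1}

namespace SPlace

variable (K : Type*) [Field K] [NumberField K] (A : ℕ) [NeZero A]

noncomputable instance : Fintype {v : FinitePlace K // v (A : K) ≠ 1} :=
  Set.Finite.fintype (FinitePlace.hasFiniteMulSupport (K := K) (x := (A : K))
    (NeZero.natCast_ne A K))

variable {K A}

/-- The absolute value attached to a place. -/
def abv : SPlace K A → AbsoluteValue K ℝ := Sum.elim (fun v => v.1) fun v => v.1.val

/-- The exponent of a place in the product formula. -/
noncomputable def e : SPlace K A → ℕ := Sum.elim InfinitePlace.mult fun _ => 1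

variable (K A) in
/-- The ring of elements which are integral at the places not dividing `A`. -/
def integers : Subring K where
  carrier := {x | ∀ v : FinitePlace K, v (A : K) = 1 → v x ≤ 1}
  mul_mem' {x y} hx hy v hv := by
    rw [map_mul]
    exact mul_le_one₀ (hx v hv) (apply_nonneg _ _) (hy v hv)
  one_mem' v _ := by simp
  add_mem' {x y} hx hy v hv := (FinitePlace.add_le v x y).trans (max_le (hx v hv) (hy v hv))
  zero_mem' v _ := by simp
  neg_mem' {x} hx v hv := by
    rw [map_neg_eq_map]
    exact hx v hv

theorem prod_abv (x : K) : ∏ v : SPlace K A, abv v x ^ e v =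
    (∏ v : InfinitePlace K, v x ^ v.mult) *
      ∏ᶠ v : FinitePlace K, Set.mulIndicator {v : FinitePlace K | v (A : K) ≠ 1} (fun v => v x) v := by
  rw [Fintype.prod_sum_type]
  congr 1
  rw [← finprod_mem_def]
  refine Eq.trans ?_ (finprod_subtype_eq_finprod_cond (f := fun v : FinitePlace K => v x)
    fun v : FinitePlace K => v (A : K) ≠ 1)
  rw [finprod_eq_prod_of_fintype]
  refine Finset.prod_congr rfl fun v _ => ?_
  simp [abv, e, FinitePlace.coe_apply]

theorem prod_abv_eq_one {x : K} (hx : x ≠ 0) (h : ∀ v : FinitePlace K, v (A : K) = 1 → v x = 1) :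
    ∏ v : SPlace K A, abv v x ^ e v = 1 := by
  rw [prod_abv]
  refine Eq.trans ?_ (prod_abs_eq_one hx)
  congr 1
  refine finprod_congr fun v => ?_
  by_cases hv : v (A : K) = 1
  · simp [hv, h v hv]
  · simp [hv]

theorem one_le_prod_abv {x : K} (hx : x ≠ 0) (h : x ∈ integers K A) :
    1 ≤ ∏ v : SPlace K A, abv v x ^ e v := by
  rw [prod_abv]
  refine (prod_abs_eq_one hx).symm.le.trans ?_
  refine mul_le_mul_of_nonneg_left ?_ (Finset.prod_nonneg fun v _ => by positivity)
  have hfin := FinitePlace.hasFiniteMulSupport hx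
  refine finprod_le_finprod hfin (fun v => apply_nonneg _ _) ?_ fun v => ?_
  · refine hfin.subset ?_
    rw [Set.mulSupport_mulIndicator]
    exact Set.inter_subset_right
  · by_cases hv : v (A : K) = 1
    · simp [hv, h v hv]
    · simp [hv]

/-- The number of cells needed at a place, up to the diameter of the cells. -/
noncomputable def cellConst (X : ℝ) : SPlace K A → ℝ :=
  Sum.elim (fun _ => 7 * X) fun v => v.1.maximalIdeal.asIdeal.absNorm

omit [NeZero A] in
theorem exists_cells {X : ℝ} (v : SPlace K A) {R : ℝ} (hR : 0 < R) (hRX : R ≤ X)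
    (hR1 : v.isRight → R ≤ 1) :
    ∃ (N : ℕ) (f : {x : 𝓞 K // ∀ w : InfinitePlace K, w x ≤ X} → Fin N),
      (∀ x y, f x = f y → abv v ((x.1 : K) - y.1) ≤ R) ∧ (N : ℝ) ≤ (cellConst X v / R) ^ e v := by
  rcases v with v | v
  · obtain ⟨N, f, hf, hN⟩ := infinitePlace_exists_cells v hR hRX
    exact ⟨N, fun x => f ⟨x.1, x.2 v⟩, fun x y h => hf _ _ h, hN⟩
  · obtain ⟨N, f, hf, hN⟩ := finitePlace_exists_cells v.1 hR (hR1 rfl)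
    exact ⟨N, fun x => f x.1, fun x y h => hf _ _ h, by simpa [cellConst, e] using hN⟩

theorem prod_cellConst (X : ℝ) : ∏ v : SPlace K A, cellConst X v ^ e v =
    (7 * X) ^ Module.finrank ℚ K *
      ∏ v : {v : FinitePlace K // v (A : K) ≠ 1}, (v.1.maximalIdeal.asIdeal.absNorm : ℝ) := by
  rw [Fintype.prod_sum_type]
  simp [cellConst, e, Finset.prod_pow_eq_pow_sum, InfinitePlace.sum_mult_eq]

omit [NeZero A] in
theorem apply_natCast_lt_one {v : FinitePlace K} (hv : v (A : K) ≠ 1) : v (A : K) < 1 :=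
  lt_of_le_of_ne (by exact_mod_cast FinitePlace.apply_intCast_le_one v A) hv

theorem exists_pow_scale {n : ℕ} (r : SPlace K A → Fin n → ℝ) :
    ∃ N : ℕ, ∀ (v : {v : FinitePlace K // v (A : K) ≠ 1}) i,
      r (Sum.inr v) i * v.1 ((A : K) ^ N) ≤ 1 := by
  have h : ∀ᶠ N : ℕ in Filter.atTop, ∀ (v : {v : FinitePlace K // v (A : K) ≠ 1}) i,
      r (Sum.inr v) i * v.1 ((A : K) ^ N) < 1 := by
    refine Filter.eventually_all.2 fun v => Filter.eventually_all.2 fun i => ?_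
    have h1 := (tendsto_pow_atTop_nhds_zero_of_lt_one (apply_nonneg v.1 (A : K))
      (apply_natCast_lt_one v.2)).const_mul (r (Sum.inr v) i)
    rw [mul_zero] at h1
    filter_upwards [h1.eventually_lt_const one_pos] with N hN
    rwa [map_pow]
  obtain ⟨N, hN⟩ := h.exists
  exact ⟨N, fun v i => (hN v i).le⟩

omit [NeZero A] in
theorem le_sum_sum {α β : Type*} [Fintype α] [Fintype β] {f : α → β → ℝ} (hf : ∀ a b, 0 ≤ f a b)
    (a : α) (b : β) : f a b ≤ ∑ a, ∑ b, f a b :=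
  (Finset.single_le_sum (f := f a) (fun b _ => hf a b) (Finset.mem_univ b)).trans
    (Finset.single_le_sum (f := fun a => ∑ b, f a b)
      (fun a _ => Finset.sum_nonneg fun b _ => hf a b) (Finset.mem_univ a))

/-- The pigeonhole principle for integral vectors with bounded coordinates. -/
theorem exists_small_aux {n : ℕ} (hn : 0 < n) (L : SPlace K A → Matrix (Fin n) (Fin n) ℤ) :
    ∃ c : ℝ, 1 ≤ c ∧ ∀ (B : ℕ) (R : SPlace K A → Fin n → ℝ), (∀ v i, 0 < R v i) → 0 < B →
      (∀ v i, R v i ≤ B) → (∀ v i, R (Sum.inr v) i ≤ 1) →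
      (∏ v, cellConst (A := A) (K := K) (c * B) v ^ e v) ^ n ≤
        B ^ (n * Module.finrank ℚ K) * ∏ v, ∏ i, R v i ^ e v →
      ∃ x : Fin n → 𝓞 K, x ≠ 0 ∧ ∀ v i, abv v (∑ j, (L v i j : K) * x j) ≤ R v i := by
  classical
  obtain ⟨b, hb⟩ : ∃ b, b = RingOfIntegers.basis K := ⟨_, rfl⟩
  obtain ⟨c, hc⟩ : ∃ c : ℝ, c = 1 + ∑ v, ∑ i, ∑ w : InfinitePlace K, ∑ j, ∑ k,
    |(L v i j : ℝ)| * w (b k) := ⟨_, rfl⟩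
  have hg : ∀ v i (w : InfinitePlace K), 0 ≤ ∑ j, ∑ k, |(L v i j : ℝ)| * w (b k) := fun v i w =>
    Finset.sum_nonneg fun j _ => Finset.sum_nonneg fun k _ =>
      mul_nonneg (abs_nonneg _) (apply_nonneg _ _)
  have hc0 : ∀ v i (w : InfinitePlace K), ∑ j, ∑ k, |(L v i j : ℝ)| * w (b k) ≤ c := by
    intro v i w
    have h1 := Finset.single_le_sum (f := fun w : InfinitePlace K =>
      ∑ j, ∑ k, |(L v i j : ℝ)| * w (b k)) (fun w _ => hg v i w) (Finset.mem_univ w)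
    have h2 := le_sum_sum (f := fun v i => ∑ w : InfinitePlace K, ∑ j, ∑ k, |(L v i j : ℝ)| * w (b k))
      (fun v i => Finset.sum_nonneg fun w _ => hg v i w) v i
    rw [hc]
    exact h1.trans (h2.trans (le_add_of_nonneg_left zero_le_one))
  have hc1 : 1 ≤ c := by
    rw [hc, le_add_iff_nonneg_right]
    exact Finset.sum_nonneg fun v _ => Finset.sum_nonneg fun i _ => Finset.sum_nonneg fun w _ =>
      hg v i w
  refine ⟨c, hc1, fun B R hR hB hRB hR1 hle => ?_⟩
  let Y := Fin n × Module.Free.ChooseBasisIndex ℤ (𝓞 K) → Fin (B + 1)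
  let p : Y → Fin n → 𝓞 K := fun t j => ∑ k, ((t (j, k) : ℕ) : ℤ) • b k
  have hp : Function.Injective p := by
    intro t t' h
    funext ⟨j₀, k₀⟩
    have h1 := congrFun h j₀
    have h2 := (Fintype.linearIndependent_iff.1 b.linearIndependent)
      (fun k => ((t (j₀, k) : ℕ) : ℤ) - ((t' (j₀, k) : ℕ) : ℤ)) (by
        simp only [sub_smul, Finset.sum_sub_distrib]
        exact sub_eq_zero.2 h1) k₀
    exact Fin.ext (by omega)
  have hbound : ∀ (t : Y) v i (w : InfinitePlace K),
      w ((∑ j, (L v i j : 𝓞 K) * p t j : 𝓞 K) : K) ≤ c * B := by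
    intro t v i w
    have h1 : ((∑ j, (L v i j : 𝓞 K) * p t j : 𝓞 K) : K) =
        ∑ j, ∑ k, (L v i j : K) * (((t (j, k) : ℕ) : K) * (b k : K)) := by
      simp only [p, map_sum, map_mul, Finset.mul_sum, map_intCast, zsmul_eq_mul,
        Int.cast_natCast, map_natCast]
    rw [h1]
    calc _ ≤ ∑ j, ∑ k, w ((L v i j : K) * (((t (j, k) : ℕ) : K) * (b k : K))) :=
          (w.1.sum_le _ _).trans (Finset.sum_le_sum fun j _ => w.1.sum_le _ _)
      _ ≤ ∑ j, ∑ k, |(L v i j : ℝ)| * w (b k) * B := by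
          refine Finset.sum_le_sum fun j _ => Finset.sum_le_sum fun k _ => ?_
          rw [map_mul, map_mul, ← w.norm_embedding_eq (L v i j : K), map_intCast,
            Complex.norm_intCast, ← w.norm_embedding_eq (t (j, k) : K), map_natCast,
            Complex.norm_natCast, mul_assoc, mul_comm (w _)]
          have : ((t (j, k) : ℕ) : ℝ) ≤ B := by
            exact_mod_cast Nat.lt_succ_iff.1 (t (j, k)).2
          gcongr
      _ = (∑ j, ∑ k, |(L v i j : ℝ)| * w (b k)) * B := by simp only [Finset.sum_mul]
      _ ≤ c * B := by
          gcongr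
          exact hc0 v i w
  have hRX : ∀ v i, R v i ≤ c * B := fun v i =>
    (hRB v i).trans (le_mul_of_one_le_left (by positivity) hc1)
  have hcells : ∀ v i, ∃ (N : ℕ) (f : {x : 𝓞 K // ∀ w : InfinitePlace K, w x ≤ c * B} → Fin N),
      (∀ x y, f x = f y → abv v ((x.1 : K) - y.1) ≤ R v i) ∧
        (N : ℝ) ≤ (cellConst (c * B) v / R v i) ^ e v := by
    intro v i
    refine exists_cells v (hR v i) (hRX v i) fun hv => ?_
    obtain ⟨v, rfl⟩ := Sum.isRight_iff.1 hv
    exact hR1 v i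
  choose N f hf hN using hcells
  let F : Y → (v : SPlace K A) → (i : Fin n) → Fin (N v i) :=
    fun t v i => f v i ⟨∑ j, (L v i j : 𝓞 K) * p t j, hbound t v i⟩
  have hF : ¬ Function.Injective F := by
    intro hinj
    have h1 := Fintype.card_le_of_injective F hinj
    simp only [Y, Fintype.card_pi, Fintype.card_fin, Finset.prod_const, Finset.card_univ,
      Fintype.card_prod] at h1
    rw [← Module.finrank_eq_card_chooseBasisIndex, RingOfIntegers.rank] at h1
    have h2 : (((B + 1 : ℕ) : ℝ)) ^ (n * Module.finrank ℚ K) ≤ ∏ v, ∏ i, (N v i : ℝ) := by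
      exact_mod_cast h1
    have h3 : ∏ v, ∏ i, (N v i : ℝ) ≤ ∏ v, ∏ i, (cellConst (A := A) (K := K) (c * B) v / R v i) ^ e v :=
      Finset.prod_le_prod (fun v _ => by positivity) fun v _ =>
        Finset.prod_le_prod (fun i _ => by positivity) fun i _ => hN v i
    have h4 : ∏ v, ∏ i, (cellConst (A := A) (K := K) (c * B) v / R v i) ^ e v =
        (∏ v, cellConst (A := A) (K := K) (c * B) v ^ e v) ^ n / ∏ v, ∏ i, R v i ^ e v := by
      simp only [div_pow, Finset.prod_div_distrib, Finset.prod_const, Finset.card_univ,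
        Fintype.card_fin, Finset.prod_pow]
    have hpos : 0 < ∏ v, ∏ i, R v i ^ e v :=
      Finset.prod_pos fun v _ => Finset.prod_pos fun i _ => pow_pos (hR v i) _
    have h5 : (B + 1 : ℕ) ^ (n * Module.finrank ℚ K) ≤ (B : ℝ) ^ (n * Module.finrank ℚ K) := by
      refine h2.trans (h3.trans ?_)
      rw [h4, div_le_iff₀ hpos]
      exact hle
    have h6 : (B : ℝ) ^ (n * Module.finrank ℚ K) < ((B + 1 : ℕ) : ℝ) ^ (n * Module.finrank ℚ K) := by
      refine pow_lt_pow_left₀ (by push_cast; linarith) (by positivity) ?_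
      exact Nat.mul_ne_zero hn.ne' Module.finrank_pos.ne'
    exact absurd h5 (not_le.2 h6)
  unfold Function.Injective at hF
  push Not at hF
  obtain ⟨t, t', hFt, hne⟩ := hF
  refine ⟨fun j => p t j - p t' j, fun h0 => hne (hp (funext fun j => sub_eq_zero.1 (congrFun h0 j))),
    fun v i => ?_⟩
  have h1 := hf v i _ _ (congrFun (congrFun hFt v) i)
  refine le_of_eq_of_le (congrArg _ ?_) h1
  simp only [map_sum, map_mul, map_intCast, map_sub, mul_sub, Finset.sum_sub_distrib]

theorem exists_small {n : ℕ} (hn : 0 < n) (L : SPlace K A → Matrix (Fin n) (Fin n) ℤ) :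
    ∃ C : ℝ, 0 < C ∧ ∀ r : SPlace K A → Fin n → ℝ, (∀ v i, 0 < r v i) →
      C ≤ ∏ v, ∏ i, r v i ^ e v → ∃ x : Fin n → K, x ≠ 0 ∧ (∀ i, x i ∈ integers K A) ∧
        ∀ v i, abv v (∑ j, (L v i j : K) * x j) ≤ r v i := by
  obtain ⟨c, hc1, H⟩ := exists_small_aux hn L
  obtain ⟨Q, hQ⟩ : ∃ Q, Q = ∏ v : {v : FinitePlace K // v (A : K) ≠ 1},
    (v.1.maximalIdeal.asIdeal.absNorm : ℝ) := ⟨_, rfl⟩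
  have hQ0 : 0 < Q := by
    rw [hQ]
    refine Finset.prod_pos fun v _ => ?_
    exact_mod_cast (HeightOneSpectrum.one_lt_absNorm v.1.maximalIdeal).le
  refine ⟨((7 * c) ^ Module.finrank ℚ K * Q) ^ n, by positivity, fun r hr hC => ?_⟩
  obtain ⟨N, hN⟩ := exists_pow_scale r
  have hA : (A : K) ≠ 0 := NeZero.natCast_ne A K
  obtain ⟨D, hD⟩ : ∃ D : K, D = (A : K) ^ N := ⟨_, rfl⟩
  have hD0 : D ≠ 0 := hD ▸ pow_ne_zero _ hA
  have hD1 : ∀ v : FinitePlace K, v (A : K) = 1 → v D = 1 := fun v hv => by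
    rw [hD, map_pow, hv, one_pow]
  have hDabv : ∀ v : SPlace K A, 0 < abv v D := fun v => (abv v).pos hD0
  obtain ⟨B, hB⟩ := exists_nat_ge (1 + ∑ v, ∑ i, r v i * abv v D)
  have hnn : ∀ v i, 0 < r v i * abv v D := fun v i => mul_pos (hr v i) (hDabv v)
  have hB1 : (1 : ℝ) ≤ B := by
    have : 0 ≤ ∑ v, ∑ i, r v i * abv v D :=
      Finset.sum_nonneg fun v _ => Finset.sum_nonneg fun i _ => (hnn v i).le
    linarith
  obtain ⟨x, hx0, hx⟩ := H B (fun v i => r v i * abv v D) hnn (by exact_mod_cast hB1)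
    (fun v i => by
      have h1 := le_sum_sum (fun v i => (hnn v i).le) v i
      linarith)
    (fun v i => hD ▸ hN v i) (by
      have h1 : ∏ v, ∏ i, (r v i * abv v D) ^ e v = ∏ v, ∏ i, r v i ^ e v := by
        simp only [mul_pow, Finset.prod_mul_distrib, Finset.prod_const, Finset.card_univ,
          Fintype.card_fin, Finset.prod_pow, prod_abv_eq_one hD0 hD1, one_pow, mul_one]
      rw [h1, prod_cellConst, ← hQ]
      calc _ = (B : ℝ) ^ (n * Module.finrank ℚ K) * ((7 * c) ^ Module.finrank ℚ K * Q) ^ n := by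
            rw [mul_comm n, pow_mul]
            ring
        _ ≤ _ := by gcongr)
  refine ⟨fun i => x i / D, fun h0 => hx0 ?_, fun i v hv => ?_, fun v i => ?_⟩
  · funext i
    have := congrFun h0 i
    simpa [hD0] using this
  · rw [map_div₀, hD1 v hv, div_one, ← FinitePlace.norm_embedding_eq]
    exact FinitePlace.norm_le_one _ _ _
  · have h1 : ∑ j, (L v i j : K) * (x j / D) = (∑ j, (L v i j : K) * x j) / D := by
      rw [Finset.sum_div]
      exact Finset.sum_congr rfl fun j _ => by ring
    rw [h1, map_div₀, div_le_iff₀ (hDabv v)]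
    exact hx v i

variable (K A) in
/-- The places of a number field satisfy the product formula and the pigeonhole principle. -/
noncomputable def placeData : PlaceData K (SPlace K A) where
  abv := abv
  e := e
  e_pos := by
    rintro (v | v)
    · exact InfinitePlace.mult_pos
    · exact one_pos
  O := integers K A
  one_le_prod x hx hx0 := one_le_prod_abv hx0 hx
  exists_small n L hn _ := exists_small hn L

end SPlace

open Filter NumberField Height

namespace SPlace

variable {K : Type*} [Field K] [NumberField K] {A : ℕ}

theorem one_le_finprod_max (x : K) (s : FinitePlace K → Prop) :
    1 ≤ ∏ᶠ (v : FinitePlace K) (_ : s v), max (v x) 1 := by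
  refine finprod_induction (fun y : ℝ => 1 ≤ y) le_rfl (fun y z => one_le_mul_of_one_le_of_one_le)
    fun v => ?_
  exact finprod_induction (fun y : ℝ => 1 ≤ y) le_rfl
    (fun y z => one_le_mul_of_one_le_of_one_le) fun _ => le_max_right _ _

omit [NumberField K] in
theorem one_le_prod_max (x : K) (s : Finset (InfinitePlace K)) :
    1 ≤ ∏ v ∈ s, max (v x) 1 ^ v.mult :=
  Finset.prod_induction _ (fun y : ℝ => 1 ≤ y) (fun _ _ => one_le_mul_of_one_le_of_one_le) le_rfl
    fun _ _ => one_le_pow₀ (le_max_right _ _)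

theorem abv_le_mulHeight₁ (v : SPlace K A) (x : K) : abv v x ≤ mulHeight₁ x := by
  classical
  rw [NumberField.mulHeight₁_eq]
  have hf : 1 ≤ ∏ᶠ v : FinitePlace K, max (v x) 1 := by
    simpa using one_le_finprod_max x fun _ => True
  have hi := one_le_prod_max x Finset.univ
  rcases v with v | v
  · refine le_trans ?_ (le_mul_of_one_le_right (by positivity) hf)
    rw [← Finset.mul_prod_erase _ _ (Finset.mem_univ v)]
    refine le_trans ?_ (le_mul_of_one_le_right (by positivity) (one_le_prod_max x _))
    exact (le_max_left (v x) 1).trans (le_self_pow₀ (le_max_right _ _) v.mult_ne_zero)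
  · refine le_trans ?_ (le_mul_of_one_le_left (by positivity) hi)
    rw [← mul_finprod_cond_ne v.1 (hasFiniteMulSupport_max_one x)]
    exact (le_max_left (v.1 x) 1).trans
      (le_mul_of_one_le_right (by positivity) (one_le_finprod_max x _))

theorem abs_log_abv_le {x : K} (hx : x ≠ 0) (v : SPlace K A) :
    |Real.log (abv v x)| ≤ logHeight₁ x := by
  have h : ∀ y : K, y ≠ 0 → Real.log (abv v y) ≤ logHeight₁ y := fun y hy => by
    rw [logHeight₁_eq_log_mulHeight₁]
    exact Real.log_le_log ((abv v).pos hy) (abv_le_mulHeight₁ v y)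
  refine abs_le.2 ⟨?_, h x hx⟩
  have := h x⁻¹ (inv_ne_zero hx)
  rw [map_inv₀, Real.log_inv, logHeight₁_inv] at this
  linarith

variable [NeZero A]

theorem logHeight₁_eq_sum {x : K} (h : ∀ v : FinitePlace K, v (A : K) = 1 → v x = 1) :
    logHeight₁ x = ∑ v : SPlace K A, e v * max (Real.log (abv v x)) 0 := by
  by_cases hx : x = 0
  · subst hx
    simp
  have h1 : mulHeight₁ x = ∏ v : SPlace K A, max (abv v x) 1 ^ e v := by
    rw [NumberField.mulHeight₁_eq, Fintype.prod_sum_type]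
    congr 1
    have h2 : ∀ v : FinitePlace K, max (v x) 1 =
        Set.mulIndicator {v : FinitePlace K | v (A : K) ≠ 1} (fun v => max (v x) 1) v := by
      intro v
      by_cases hv : v (A : K) = 1
      · simp [hv, h v hv]
      · simp [hv]
    rw [finprod_congr h2, ← finprod_mem_def]
    refine (finprod_subtype_eq_finprod_cond (f := fun v : FinitePlace K => max (v x) 1)
      fun v : FinitePlace K => v (A : K) ≠ 1).symm.trans ?_
    rw [finprod_eq_prod_of_fintype]
    refine Finset.prod_congr rfl fun v _ => ?_
    simp [abv, e, FinitePlace.coe_apply]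
  rw [logHeight₁_eq_log_mulHeight₁, h1, Real.log_prod fun v _ => by positivity]
  refine Finset.sum_congr rfl fun v _ => ?_
  rw [Real.log_pow]
  congr 1
  rcases le_total 1 (abv v x) with h3 | h3
  · rw [max_eq_left h3, max_eq_left (Real.log_nonneg h3)]
  · rw [max_eq_right h3, Real.log_one,
      max_eq_right (Real.log_nonpos (apply_nonneg _ _) h3)]

theorem sum_log_abv_eq_zero {x : K} (hx : x ≠ 0)
    (h : ∀ v : FinitePlace K, v (A : K) = 1 → v x = 1) :
    ∑ v : SPlace K A, e v * Real.log (abv v x) = 0 := by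
  have h1 := congrArg Real.log (prod_abv_eq_one hx h)
  rw [Real.log_prod fun v _ => pow_ne_zero _ ((abv v).pos hx).ne', Real.log_one] at h1
  simpa only [Real.log_pow] using h1

end SPlace

theorem logHeight₁_natCast_le {K : Type*} [Field K] [NumberField K] {n : ℕ} (hn : n ≠ 0) :
    logHeight₁ (n : K) ≤ Module.finrank ℚ K * Real.log n := by
  have h1 : mulHeight₁ (n : K) = (n : ℝ) ^ Module.finrank ℚ K := by
    have h2 : ∀ v : InfinitePlace K, max (v (n : K)) 1 = n := fun v => by
      rw [← v.norm_embedding_eq, map_natCast, Complex.norm_natCast]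
      exact max_eq_left (by exact_mod_cast Nat.one_le_iff_ne_zero.2 hn)
    have h3 : ∀ v : FinitePlace K, max (v (n : K)) 1 = 1 := fun v =>
      max_eq_right (by exact_mod_cast FinitePlace.apply_intCast_le_one v n)
    rw [NumberField.mulHeight₁_eq, finprod_congr h3, finprod_one, mul_one]
    simp only [h2]
    rw [Finset.prod_pow_eq_pow_sum, InfinitePlace.sum_mult_eq]
  rw [logHeight₁_eq_log_mulHeight₁, h1, Real.log_pow]

namespace Hyper

variable {K : Type*} [Field K] [NumberField K] {𝒰 : Ultrafilter ℕ} {h : ℕ → ℝ}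

theorem mem_bd_zero_of_mem_slowField {A : ℕ} (hh : Tendsto h 𝒰 atTop) (v : SPlace K A)
    {x : Hyper 𝒰 K} (hx : x ∈ slowField hh) : x ∈ (growthFiltration (SPlace.abv v) hh).bd 0 := by
  induction x using Germ.inductionOn with | _ x => ?_
  rw [coe_mem_slowField] at hx
  refine coe_mem_growthFiltration.2 fun ε hε => ?_
  filter_upwards [hx ε hε] with j hj
  by_cases h0 : x j = 0
  · rw [h0, map_zero]
    positivity
  · rw [zero_add, ← Real.log_le_iff_le_exp ((SPlace.abv v).pos h0)]
    exact (le_abs_self _).trans ((SPlace.abs_log_abv_le h0 v).trans hj)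

/-- A slowly growing element has a slowly growing denominator. -/
theorem exists_denominator {A : ℕ} (hh : Tendsto h 𝒰 atTop) {x : Hyper 𝒰 K}
    (hx : x ∈ slowField hh) : ∃ D ∈ slowField hh, D ≠ 0 ∧
      D ∈ hyperSubring 𝒰 (SPlace.integers K A) ∧ D * x ∈ hyperSubring 𝒰 (SPlace.integers K A) := by
  induction x using Germ.inductionOn with | _ x => ?_
  choose N hN0 hN hNx using fun j => exists_nat_le_mulHeight₁ (x j)
  have hintegral : ∀ y : K, IsIntegral ℤ y → y ∈ SPlace.integers K A := fun y hy v _ => by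
    obtain ⟨z, rfl⟩ : ∃ z : 𝓞 K, (z : K) = y := ⟨⟨y, hy⟩, rfl⟩
    rw [← FinitePlace.norm_embedding_eq]
    exact FinitePlace.norm_le_one _ _ _
  refine ⟨((fun j => (N j : K) : ℕ → K) : Hyper 𝒰 K), ?_, ?_, ?_, ?_⟩
  · rw [coe_mem_slowField] at hx ⊢
    intro ε hε
    have h2 : (0 : ℝ) < Module.finrank ℚ K := by exact_mod_cast Module.finrank_pos
    filter_upwards [hx (ε / Module.finrank ℚ K) (by positivity)] with j hj
    refine (logHeight₁_natCast_le (hN0 j)).trans ?_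
    have h3 := Real.log_le_log (by exact_mod_cast Nat.pos_of_ne_zero (hN0 j)) (hN j)
    rw [← logHeight₁_eq_log_mulHeight₁] at h3
    calc _ ≤ Module.finrank ℚ K * (ε / Module.finrank ℚ K * h j) := by gcongr; exact h3.trans hj
      _ = _ := by field_simp
  · exact coe_ne_zero.2 (Eventually.of_forall fun j => Nat.cast_ne_zero.2 (hN0 j))
  · exact coe_mem_hyperSubring.2 (Eventually.of_forall fun j => natCast_mem _ _)
  · exact coe_mem_hyperSubring.2 (Eventually.of_forall fun j => hintegral _ (hNx j))

theorem exists_common_denominator {A : ℕ} (hh : Tendsto h 𝒰 atTop) {ι : Type*} [Fintype ι]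
    {x : ι → Hyper 𝒰 K} (hx : ∀ i, x i ∈ slowField hh) : ∃ D ∈ slowField hh, D ≠ 0 ∧
      ∀ i, D * x i ∈ hyperSubring 𝒰 (SPlace.integers K A) := by
  classical
  choose D hD hD0 hDO hDx using fun i => exists_denominator (A := A) hh (hx i)
  refine ⟨∏ i, D i, prod_mem fun i _ => hD i, Finset.prod_ne_zero_iff.2 fun i _ => hD0 i,
    fun i => ?_⟩
  rw [← Finset.prod_erase_mul _ _ (Finset.mem_univ i), mul_assoc]
  exact mul_mem (prod_mem fun k _ => hDO k) (hDx i)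

end Hyper

open Filter NumberField Height Topology

/-- The matrix expressing the coordinates other than `l` of a vector with vanishing coordinate sum
in terms of those other than `l'`. -/
def swapMatrix {n : ℕ} (l l' : Fin (n + 1)) : Matrix (Fin n) (Fin n) ℤ :=
  Matrix.of fun i j => if l.succAbove i = l' then -1 else
    if l.succAbove i = l'.succAbove j then 1 else 0

theorem intForm_swapMatrix {L : Type*} [Field L] {n : ℕ} (l l' : Fin (n + 1))
    {y : Fin (n + 1) → L} (hy : ∑ i, y i = 0) (i : Fin n) :
    intForm (swapMatrix l l') (fun j => y (l'.succAbove j)) i = y (l.succAbove i) := by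
  rw [intForm_apply]
  by_cases h : l.succAbove i = l'
  · simp only [swapMatrix, Matrix.of_apply, h, if_true]
    rw [Fin.sum_univ_succAbove _ l'] at hy
    simp only [Int.cast_neg, Int.cast_one, neg_mul, one_mul, Finset.sum_neg_distrib]
    linear_combination -hy
  · obtain ⟨k, hk⟩ := Fin.exists_succAbove_eq h
    simp only [swapMatrix, Matrix.of_apply, ← hk, Fin.succAbove_ne, if_false,
      Fin.succAbove_right_inj]
    simp

theorem swapMatrix_mul_swapMatrix {n : ℕ} (l l' : Fin (n + 1)) :
    swapMatrix l l' * swapMatrix l' l = 1 := by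
  have key : ∀ (l l' : Fin (n + 1)) (x : Fin n → ℚ),
      intForm (swapMatrix l l') (intForm (swapMatrix l' l) x) = x := by
    intro l l' x
    obtain ⟨y, hy⟩ : ∃ y : Fin (n + 1) → ℚ, y = l.insertNth (-∑ i, x i) x := ⟨_, rfl⟩
    have hx : x = fun j => y (l.succAbove j) := by simp [hy]
    have hs : ∑ i, y i = 0 := by
      rw [Fin.sum_univ_succAbove _ l, hy]
      simp
    have h1 : intForm (swapMatrix l' l) x = fun j => y (l'.succAbove j) := by
      rw [hx]
      exact funext fun i => intForm_swapMatrix l' l hs i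
    rw [h1, hx]
    exact funext fun i => intForm_swapMatrix l l' hs i
  ext i k
  have h1 := congrFun (key l l' (Pi.single k 1)) i
  simp only [intForm_apply, Pi.single_apply, mul_ite, mul_one, mul_zero, Finset.sum_ite_eq',
    Finset.mem_univ, if_true] at h1
  rw [Matrix.mul_apply, Matrix.one_apply]
  exact_mod_cast h1

namespace Hyper

variable {K : Type*} [Field K] [NumberField K] {𝒰 : Ultrafilter ℕ} {h : ℕ → ℝ} {A : ℕ}

/-- Sequences of units outside the places dividing `A`, with height bounded by `h`. -/
structure IsUnitSeq (A : ℕ) (h : ℕ → ℝ) (u : ℕ → K) : Prop where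
  ne_zero : ∀ j, u j ≠ 0
  eq_one : ∀ j (v : FinitePlace K), v (A : K) = 1 → v (u j) = 1
  logHeight₁_le : ∀ j, logHeight₁ (u j) ≤ h j

theorem IsUnitSeq.exists_tendsto (hh : Tendsto h 𝒰 atTop) {u : ℕ → K} (hu : IsUnitSeq A h u)
    (v : SPlace K A) : ∃ γ, Tendsto (fun j => Real.log (SPlace.abv v (u j)) / h j) 𝒰 (𝓝 γ) := by
  have h1 : ∀ᶠ j in 𝒰, Real.log (SPlace.abv v (u j)) / h j ∈ Set.Icc (-1 : ℝ) 1 := by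
    filter_upwards [hh.eventually_gt_atTop 0] with j hj
    have h2 := abs_le.1 ((SPlace.abs_log_abv_le (hu.ne_zero j) v).trans (hu.logHeight₁_le j))
    rw [Set.mem_Icc, le_div_iff₀ hj, div_le_iff₀ hj]
    exact ⟨by linarith, by linarith⟩
  obtain ⟨γ, _, hγ⟩ := isCompact_Icc.ultrafilter_le_nhds
    (𝒰.map fun j => Real.log (SPlace.abv v (u j)) / h j) (le_principal_iff.2 h1)
  exact ⟨γ, hγ⟩

/-- The growth exponent of a sequence of units at a place. -/
noncomputable def expo (𝒰 : Ultrafilter ℕ) (h : ℕ → ℝ) (u : ℕ → K) (v : SPlace K A) : ℝ :=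
  lim (map (fun j => Real.log (SPlace.abv v (u j)) / h j) 𝒰)

theorem IsUnitSeq.tendsto_expo (hh : Tendsto h 𝒰 atTop) {u : ℕ → K} (hu : IsUnitSeq A h u)
    (v : SPlace K A) :
    Tendsto (fun j => Real.log (SPlace.abv v (u j)) / h j) 𝒰 (𝓝 (expo 𝒰 h u v)) :=
  le_nhds_lim (hu.exists_tendsto hh v)

theorem IsUnitSeq.mem_bd (hh : Tendsto h 𝒰 atTop) {u : ℕ → K} (hu : IsUnitSeq A h u)
    (v : SPlace K A) :
    (u : Hyper 𝒰 K) ∈ (growthFiltration (SPlace.abv v) hh).bd (expo 𝒰 h u v) := by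
  refine coe_mem_growthFiltration.2 fun ε hε => ?_
  filter_upwards [(hu.tendsto_expo hh v).eventually_lt_const (lt_add_of_pos_right _ hε),
    hh.eventually_gt_atTop 0] with j hj hj'
  rw [div_lt_iff₀ hj'] at hj
  rw [← Real.log_le_iff_le_exp ((SPlace.abv v).pos (hu.ne_zero j))]
  exact hj.le

variable [NeZero A]

theorem IsUnitSeq.sum_expo (hh : Tendsto h 𝒰 atTop) {u : ℕ → K} (hu : IsUnitSeq A h u) :
    ∑ v : SPlace K A, SPlace.e v * expo 𝒰 h u v = 0 := by
  have h1 := tendsto_finsetSum Finset.univ fun (v : SPlace K A) _ =>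
    (hu.tendsto_expo hh v).const_mul (SPlace.e v : ℝ)
  refine tendsto_nhds_unique h1 (tendsto_const_nhds.congr fun j => ?_)
  simp only [mul_div_assoc', ← Finset.sum_div]
  rw [SPlace.sum_log_abv_eq_zero (hu.ne_zero j) (hu.eq_one j), zero_div]

theorem IsUnitSeq.div_mem_slowField (hh : Tendsto h 𝒰 atTop) {u u' : ℕ → K}
    (hu : IsUnitSeq A h u) (hu' : IsUnitSeq A h u')
    (heq : ∀ v : SPlace K A, expo 𝒰 h u v = expo 𝒰 h u' v) :
    (u : Hyper 𝒰 K) / u' ∈ slowField hh := by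
  rw [show (u : Hyper 𝒰 K) / u' = ((u / u' : ℕ → K) : Hyper 𝒰 K) from (Germ.coe_div _ _).symm,
    coe_mem_slowField]
  have h1 := tendsto_finsetSum Finset.univ fun (v : SPlace K A) _ =>
    (((hu.tendsto_expo hh v).sub (hu'.tendsto_expo hh v)).max
      (tendsto_const_nhds (x := (0 : ℝ)))).const_mul (SPlace.e v : ℝ)
  simp only [heq, sub_self, max_self, mul_zero, Finset.sum_const_zero] at h1
  intro ε hε
  filter_upwards [h1.eventually_lt_const hε, hh.eventually_gt_atTop 0] with j hj hj'
  have h2 : logHeight₁ ((u / u') j) = (∑ v : SPlace K A, SPlace.e v *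
      max (Real.log (SPlace.abv v (u j)) / h j - Real.log (SPlace.abv v (u' j)) / h j) 0) * h j := by
    rw [Pi.div_apply, SPlace.logHeight₁_eq_sum (A := A) fun v hv => by
      rw [map_div₀, hu.eq_one j v hv, hu'.eq_one j v hv, div_one], Finset.sum_mul]
    refine Finset.sum_congr rfl fun v _ => ?_
    rw [map_div₀, Real.log_div ((SPlace.abv v).pos (hu.ne_zero j)).ne'
      ((SPlace.abv v).pos (hu'.ne_zero j)).ne', mul_assoc, max_mul_of_nonneg _ _ hj'.le, sub_mul,
      div_mul_cancel₀ _ hj'.ne', div_mul_cancel₀ _ hj'.ne', zero_mul]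
  rw [h2]
  gcongr

end Hyper

open Filter NumberField Height Topology

namespace Hyper

variable {K : Type*} [Field K] [NumberField K] {𝒰 : Ultrafilter ℕ} {h : ℕ → ℝ} {A : ℕ} [NeZero A]

/-- Sequences of units whose quotients are not slow are linearly independent over the
slow field. -/
theorem slow_relation_eq_zero (h𝒰 : (𝒰 : Filter ℕ) ≤ atTop) (hh : Tendsto h 𝒰 atTop) {n : ℕ}
    (w : Fin n → ℕ → K) (hw : ∀ i, IsUnitSeq A h (w i))
    (hne : ∀ i k, i ≠ k → (w i : Hyper 𝒰 K) / w k ∉ slowField hh)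
    (a : Fin n → Hyper 𝒰 K) (ha : ∀ i, a i ∈ slowField hh)
    (hsum : ∑ i, a i * (w i : Hyper 𝒰 K) = 0) : ∀ i, a i = 0 := by
  classical
  induction n with
  | zero => exact fun i => i.elim0
  | succ n ih =>
  have hw0 : ∀ i, (w i : Hyper 𝒰 K) ≠ 0 := fun i =>
    coe_ne_zero.2 (Eventually.of_forall (hw i).ne_zero)
  by_contra hcon
  push Not at hcon
  have ha0 : ∀ i, a i ≠ 0 := by
    intro i hi
    rw [Fin.sum_univ_succAbove _ i, hi, zero_mul, zero_add] at hsum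
    have h1 := ih (fun k => w (i.succAbove k)) (fun k => hw _)
      (fun k k' hk => hne _ _ (i.succAbove_right_injective.ne hk)) (fun k => a (i.succAbove k))
      (fun k => ha _) hsum
    obtain ⟨k, hk⟩ := hcon
    obtain ⟨k', rfl⟩ := Fin.exists_succAbove_eq (x := k) (y := i) fun h2 => hk (h2 ▸ hi)
    exact hk (h1 k')
  rcases Nat.eq_zero_or_pos n with rfl | hn
  · rw [Fin.sum_univ_one] at hsum
    exact mul_ne_zero (ha0 0) (hw0 0) hsum
  obtain ⟨D, hD, hD0, hDO⟩ := exists_common_denominator (A := A) hh ha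
  obtain ⟨y, hy⟩ : ∃ y : Fin (n + 1) → Hyper 𝒰 K, y = fun i => D * a i * w i := ⟨_, rfl⟩
  have hysum : ∑ i, y i = 0 := by
    simp only [hy, mul_assoc, ← Finset.mul_sum, hsum, mul_zero]
  have hyO : ∀ i, y i ∈ hyperSubring 𝒰 (SPlace.integers K A) := fun i => by
    rw [hy]
    exact mul_mem (hDO i) (coe_mem_hyperSubring.2
      (Eventually.of_forall fun j v hv => ((hw i).eq_one j v hv).le))
  have hybd : ∀ (v : SPlace K A) i,
      y i ∈ (growthFiltration (SPlace.abv v) hh).bd (expo 𝒰 h (w i) v) := fun v i => by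
    have h1 := (growthFiltration (SPlace.abv v) hh).mul_mem
      (mem_bd_zero_of_mem_slowField hh v (mul_mem hD (ha i))) ((hw i).mem_bd hh v)
    rw [zero_add] at h1
    rwa [hy]
  have hmax : ∀ v : SPlace K A, ∃ l, ∀ i, expo 𝒰 h (w i) v ≤ expo 𝒰 h (w l) v := fun v =>
    Finite.exists_max fun i => expo 𝒰 h (w i) v
  choose l hl using hmax
  have hκ : 0 < ∑ v : SPlace K A, SPlace.e v * expo 𝒰 h (w (l v)) v := by
    by_contra hκ
    have h1 : ∀ i (v : SPlace K A), expo 𝒰 h (w i) v = expo 𝒰 h (w (l v)) v := by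
      intro i v
      have h2 : ∀ v ∈ (Finset.univ : Finset (SPlace K A)),
          (SPlace.e v : ℝ) * expo 𝒰 h (w i) v ≤ SPlace.e v * expo 𝒰 h (w (l v)) v := fun v _ =>
        mul_le_mul_of_nonneg_left (hl v i) (Nat.cast_nonneg _)
      have h3 := (Finset.sum_eq_sum_iff_of_le h2).1
        (le_antisymm (Finset.sum_le_sum h2) (by rw [(hw i).sum_expo hh]; exact not_lt.1 hκ))
        v (Finset.mem_univ v)
      exact mul_left_cancel₀ (by exact_mod_cast ((SPlace.placeData K A).e_pos v).ne') h3
    refine hne 0 (Fin.succ ⟨0, hn⟩) (Fin.succ_ne_zero _).symm ?_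
    exact (hw 0).div_mem_slowField hh (hw _) fun v => (h1 0 v).trans (h1 _ v).symm
  obtain ⟨d, hd, hdsum, k, hk⟩ := (SPlace.placeData K A).exists_relation h𝒰 hh (slowField hh)
    (exists_HB_of_notMem_slowField hh) (fun v => swapMatrix (l v) 0) (fun v => swapMatrix 0 (l v))
    (fun v => swapMatrix_mul_swapMatrix _ _)
    (fun v i => expo 𝒰 h (w ((l v).succAbove i)) v) (by
      have h1 : ∑ i, ∑ v : SPlace K A, (SPlace.e v : ℝ) * expo 𝒰 h (w i) v = 0 :=
        Finset.sum_eq_zero fun i _ => (hw i).sum_expo hh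
      rw [Finset.sum_comm] at h1
      have h2 : ∀ v : SPlace K A, ∑ i, (SPlace.e v : ℝ) * expo 𝒰 h (w i) v =
          SPlace.e v * expo 𝒰 h (w (l v)) v +
            SPlace.e v * ∑ i, expo 𝒰 h (w ((l v).succAbove i)) v := fun v => by
        rw [Fin.sum_univ_succAbove _ (l v), Finset.mul_sum]
      simp only [h2, Finset.sum_add_distrib] at h1
      change ∑ v : SPlace K A, (SPlace.e v : ℝ) * _ < 0
      linarith)
    (fun i => y (Fin.succ i)) (fun i => hyO _) (fun v i => by
      have h1 := intForm_swapMatrix (l v) 0 hysum i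
      simp only [Fin.succAbove_zero] at h1
      change intForm (swapMatrix (l v) 0) (fun j => y j.succ) i ∈ _
      rw [h1]
      exact hybd v _)
  have h1 := ih (fun i => w i.succ) (fun i => hw _)
    (fun i i' hi => hne _ _ ((Fin.succ_injective n).ne hi)) (fun i => d i * (D * a i.succ))
    (fun i => mul_mem (hd i) (mul_mem hD (ha _))) (by
      refine Eq.trans (Finset.sum_congr rfl fun i _ => ?_) hdsum
      rw [hy, mul_assoc])
  exact mul_ne_zero hk (mul_ne_zero hD0 (ha0 _)) (h1 k)

end Hyper

open Filter NumberField Height Topology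

section NumberFieldUnits

variable {K : Type*} [Field K] [NumberField K]

theorem tendsto_sum_logHeight₁ {n : ℕ} {u : ℕ → Fin n → K} (hu : Function.Injective u) :
    Tendsto (fun j => ∑ i, logHeight₁ (u j i)) atTop atTop := by
  rw [tendsto_atTop, ← Nat.cofinite_eq_atTop]
  intro B
  rw [eventually_cofinite]
  have h1 : {x : Fin n → K | ∀ i, x i ∈ {y : K | logHeight₁ y ≤ B}}.Finite :=
    Set.Finite.pi' fun _ => NumberField.finite_setOfPred_logHeight₁_le K B
  refine (h1.preimage hu.injOn).subset fun j hj i => ?_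
  exact (Finset.single_le_sum (f := fun i => logHeight₁ (u j i))
    (fun i _ => zero_le_logHeight₁ _) (Finset.mem_univ i)).trans (not_le.1 hj).le

variable (K) in
/-- The unit equation has finitely many nondegenerate solutions in units outside the places
dividing `A`. -/
theorem finite_unit_solutions (A : ℕ) [NeZero A] (n : ℕ) :
    {u : Fin n → K | (∀ i, u i ≠ 0) ∧ (∀ i (v : FinitePlace K), v (A : K) = 1 → v (u i) = 1) ∧
      ∑ i, u i = 1 ∧ ∀ I : Finset (Fin n), I.Nonempty → ∑ i ∈ I, u i ≠ 0}.Finite := by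
  classical
  by_contra hinf
  obtain ⟨U, hU⟩ : ∃ U, U = Set.Infinite.natEmbedding _ hinf := ⟨_, rfl⟩
  obtain ⟨u, hu⟩ : ∃ u : ℕ → Fin n → K, u = fun j => (U j).1 := ⟨_, rfl⟩
  have hinj : Function.Injective u := by
    rw [hu]
    exact Subtype.val_injective.comp U.injective
  have hprop : ∀ j, (∀ i, u j i ≠ 0) ∧ (∀ i (v : FinitePlace K), v (A : K) = 1 → v (u j i) = 1) ∧
      ∑ i, u j i = 1 ∧ ∀ I : Finset (Fin n), I.Nonempty → ∑ i ∈ I, u j i ≠ 0 := fun j => by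
    rw [hu]
    exact (U j).2
  obtain ⟨𝒰, h𝒰⟩ : ∃ 𝒰 : Ultrafilter ℕ, (𝒰 : Filter ℕ) ≤ atTop :=
    ⟨hyperfilter ℕ, Nat.hyperfilter_le_atTop⟩
  obtain ⟨h, hdef⟩ : ∃ h : ℕ → ℝ, h = fun j => ∑ i, logHeight₁ (u j i) := ⟨_, rfl⟩
  have hh : Tendsto h 𝒰 atTop := hdef ▸ (tendsto_sum_logHeight₁ hinj).mono_left h𝒰
  have hh0 : ∀ j, 0 ≤ h j := fun j => by
    rw [hdef]
    exact Finset.sum_nonneg fun i _ => zero_le_logHeight₁ _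
  let w : Option (Fin n) → ℕ → K := fun o j => o.elim (-1) (u j)
  have hw : ∀ o, Hyper.IsUnitSeq A h (w o) := by
    rintro (_ | i)
    · refine ⟨fun j => neg_ne_zero.2 one_ne_zero, fun j v _ => ?_, fun j => ?_⟩
      · simp [w]
      · simp only [w, Option.elim, logHeight₁_neg, logHeight₁_one]
        exact hh0 j
    · refine ⟨fun j => (hprop j).1 i, fun j v hv => (hprop j).2.1 i v hv, fun j => ?_⟩
      rw [hdef]
      exact Finset.single_le_sum (f := fun i => logHeight₁ (u j i))
        (fun i _ => zero_le_logHeight₁ _) (Finset.mem_univ i)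
  have hw0 : ∀ o, (w o : Hyper 𝒰 K) ≠ 0 := fun o =>
    Hyper.coe_ne_zero.2 (Eventually.of_forall (hw o).ne_zero)
  let F : Subfield (Hyper 𝒰 K) := Hyper.slowField hh
  let s : Setoid (Option (Fin n)) :=
    { r := fun o o' => (w o : Hyper 𝒰 K) / w o' ∈ F
      iseqv :=
        { refl := fun o => by
            rw [div_self (hw0 o)]
            exact one_mem F
          symm := fun {o o'} ho => by
            rw [← inv_div]
            exact inv_mem ho
          trans := fun {o o' o''} ho ho' => by
            rw [← div_mul_div_cancel₀ (hw0 o')]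
            exact mul_mem ho ho' } }
  have hs : ∀ o o', (Quotient.mk s o = Quotient.mk s o') ↔ (w o : Hyper 𝒰 K) / w o' ∈ F :=
    fun o o' => Quotient.eq (r := s)
  have hclass : ∀ q : Quotient s, ∑ o with Quotient.mk s o = q, (w o : Hyper 𝒰 K) = 0 := by
    obtain ⟨a, ha⟩ : ∃ a : Quotient s → Hyper 𝒰 K, a = fun q =>
      ∑ o with Quotient.mk s o = q, (w o : Hyper 𝒰 K) / w q.out := ⟨_, rfl⟩
    have haF : ∀ q, a q ∈ F := fun q => by
      rw [ha]
      refine sum_mem fun o ho => (hs _ _).1 ?_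
      rw [(Finset.mem_filter.1 ho).2, Quotient.out_eq]
    have haw : ∀ q, a q * w q.out = ∑ o with Quotient.mk s o = q, (w o : Hyper 𝒰 K) := fun q => by
      rw [ha, Finset.sum_mul]
      exact Finset.sum_congr rfl fun o _ => div_mul_cancel₀ _ (hw0 _)
    have hsum : ∑ q, a q * w q.out = 0 := by
      simp only [haw]
      rw [Finset.sum_fiberwise, Hyper.coe_sum, Hyper.coe_eq_zero]
      refine Eventually.of_forall fun j => ?_
      rw [Fintype.sum_option]
      simp [w, (hprop j).2.2.1]
    let eq := Fintype.equivFin (Quotient s)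
    have h0 := Hyper.slow_relation_eq_zero h𝒰 hh (fun k => w (eq.symm k).out) (fun k => hw _)
      (fun k k' hk hmem => hk (eq.symm.injective (by
        have := (hs _ _).2 hmem
        rwa [Quotient.out_eq, Quotient.out_eq] at this)))
      (fun k => a (eq.symm k)) (fun k => haF _)
      ((Equiv.sum_comp eq.symm fun q => a q * (w q.out : Hyper 𝒰 K)).trans hsum)
    intro q
    rw [← haw q, ← eq.symm_apply_apply q, h0 (eq q), zero_mul]
  have hslow : ∀ i, (w (some i) : Hyper 𝒰 K) ∈ F := by
    intro i
    by_contra hi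
    have hne : Quotient.mk s (some i) ≠ Quotient.mk s none := by
      intro h1
      have h2 := (hs _ _).1 h1
      refine hi ?_
      have h3 : (w none : Hyper 𝒰 K) = -1 := rfl
      rw [h3, div_neg, div_one] at h2
      simpa using neg_mem h2
    have h1 := hclass (Quotient.mk s (some i))
    rw [Hyper.coe_sum, Hyper.coe_eq_zero] at h1
    obtain ⟨j, hj⟩ := h1.exists
    rw [Finset.sum_filter, Fintype.sum_option, if_neg hne.symm, zero_add, ← Finset.sum_filter] at hj
    exact (hprop j).2.2.2 _ ⟨i, by simp⟩ hj
  have hε : (0 : ℝ) < 1 / (n + 1) := by positivity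
  have h1 : ∀ᶠ j in 𝒰, ∀ i, logHeight₁ (u j i) ≤ 1 / (n + 1) * h j :=
    eventually_all.2 fun i => Hyper.coe_mem_slowField.1 (hslow i) _ hε
  obtain ⟨j, hj, hj0⟩ := (h1.and (hh.eventually_gt_atTop 0)).exists
  have h2 : h j ≤ n * (1 / (n + 1) * h j) := by
    conv_lhs => rw [hdef]
    refine (Finset.sum_le_sum fun i _ => hj i).trans ?_
    simp
  have h3 : (n + 1 : ℝ) * (1 / (n + 1) * h j) = h j := by field_simp
  nlinarith [mul_pos hε hj0]

end NumberFieldUnits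

open NumberField

/-- The nondegenerate solutions of the unit equation in a group of units. -/
def unitSolutions {K : Type*} [Field K] (Γ : Subgroup Kˣ) (n : ℕ) : Set (Fin n → Kˣ) :=
  {x | (∀ i, x i ∈ Γ) ∧ ∑ i, (x i : K) = 1 ∧
    ∀ I : Finset (Fin n), I.Nonempty → ∑ i ∈ I, (x i : K) ≠ 0}

theorem FinitePlace.apply_absNorm_mul_lt_one {K : Type*} [Field K] [NumberField K]
    (v : FinitePlace K) (m : ℕ) : v ((v.maximalIdeal.asIdeal.absNorm * m : ℕ) : K) < 1 := by
  rw [← FinitePlace.norm_embedding_eq, Nat.cast_mul,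
    show ((v.maximalIdeal.asIdeal.absNorm : K) * m) =
      algebraMap (𝓞 K) K (v.maximalIdeal.asIdeal.absNorm * m) by simp]
  exact (FinitePlace.norm_lt_one_iff_mem K v.maximalIdeal _).2
    (Ideal.mul_mem_right _ _ (Ideal.absNorm_mem _))

theorem exists_nat_forall_apply_eq_one {K : Type*} [Field K] [NumberField K] {Γ : Subgroup Kˣ}
    (hΓ : Γ.FG) : ∃ A : ℕ, A ≠ 0 ∧
      ∀ x ∈ Γ, ∀ v : FinitePlace K, v (A : K) = 1 → v (x : K) = 1 := by
  classical
  obtain ⟨S, rfl⟩ := hΓ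
  have hfin : {v : FinitePlace K | ∃ x ∈ S, v (x : K) ≠ 1}.Finite := by
    have h1 : {v : FinitePlace K | ∃ x ∈ S, v (x : K) ≠ 1} =
        ⋃ x ∈ S, Function.mulSupport fun v : FinitePlace K => v (x : K) := by
      ext v
      simp
    rw [h1]
    exact S.finite_toSet.biUnion fun x _ => FinitePlace.hasFiniteMulSupport x.ne_zero
  refine ⟨∏ v ∈ hfin.toFinset, v.maximalIdeal.asIdeal.absNorm,
    Finset.prod_ne_zero_iff.2 fun v _ =>
      (zero_lt_one.trans (HeightOneSpectrum.one_lt_absNorm v.maximalIdeal)).ne',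
    fun x hx v hv => ?_⟩
  have hS : ∀ x ∈ S, v (x : K) = 1 := by
    intro x hx
    by_contra hvx
    have hmem : v ∈ hfin.toFinset := hfin.mem_toFinset.2 ⟨x, hx, hvx⟩
    rw [← Finset.mul_prod_erase _ _ hmem] at hv
    exact (FinitePlace.apply_absNorm_mul_lt_one v _).ne hv
  induction hx using Subgroup.closure_induction with
  | mem x hx => exact hS x hx
  | one => simp
  | mul x y _ _ hx hy => rw [Units.val_mul, map_mul, hx, hy, one_mul]
  | inv x _ hx => rw [Units.val_inv_eq_inv_val, map_inv₀, hx, inv_one]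

theorem finite_unitSolutions_of_numberField {K : Type*} [Field K] [NumberField K]
    {Γ : Subgroup Kˣ} (hΓ : Γ.FG) (n : ℕ) : (unitSolutions Γ n).Finite := by
  obtain ⟨A, hA, hΓA⟩ := exists_nat_forall_apply_eq_one hΓ
  have : NeZero A := ⟨hA⟩
  refine Set.Finite.of_injOn (f := fun x i => (x i : K)) (fun x hx => ?_)
    (fun x _ y _ h => funext fun i => Units.ext (congrFun h i)) (finite_unit_solutions K A n)
  exact ⟨fun i => (x i).ne_zero, fun i v hv => hΓA _ (hx.1 i) v hv, hx.2⟩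

/-- Finiteness for fewer unknowns allows one to fix one of the unknowns. -/
theorem finite_unitSolutions_of_finite_apply {K : Type*} [Field K] {n : ℕ}
    (ih : ∀ Γ : Subgroup Kˣ, Γ.FG → (unitSolutions Γ n).Finite) {Γ : Subgroup Kˣ} (hΓ : Γ.FG)
    (i : Fin (n + 1)) {Z : Set Kˣ} (hZ : Z.Finite) :
    {x ∈ unitSolutions Γ (n + 1) | x i ∈ Z}.Finite := by
  classical
  have h1 : {x ∈ unitSolutions Γ (n + 1) | x i ∈ Z} ⊆
      ⋃ z ∈ Z, {x ∈ unitSolutions Γ (n + 1) | x i = z} := fun x hx => by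
    simp only [Set.mem_iUnion]
    exact ⟨x i, hx.2, hx.1, rfl⟩
  refine (hZ.biUnion fun z _ => ?_).subset h1
  rcases Nat.eq_zero_or_pos n with rfl | hn
  · refine (Set.finite_singleton fun _ => z).subset fun x hx => ?_
    refine funext fun k => ?_
    rw [Subsingleton.elim (α := Fin 1) k i]
    exact hx.2
  by_cases hz : (z : K) = 1
  · refine Set.finite_empty.subset fun x hx => ?_
    have h2 := hx.1.2.1
    rw [Fin.sum_univ_succAbove _ i, hx.2, hz, add_eq_left] at h2
    refine hx.1.2.2 (Finset.univ.map i.succAboveEmb) ⟨i.succAbove ⟨0, hn⟩, ?_⟩ ?_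
    · simp
    · rw [Finset.sum_map]
      exact h2
  obtain ⟨c, hc⟩ : ∃ c : Kˣ, (c : K) = 1 - z := ⟨Units.mk0 _ (sub_ne_zero.2 (Ne.symm hz)), rfl⟩
  have hΓ' : (Γ ⊔ Subgroup.zpowers c).FG := hΓ.sup ⟨{c}, by simp [Subgroup.zpowers_eq_closure]⟩
  refine Set.Finite.of_injOn (f := fun x k => x (i.succAbove k) * c⁻¹) (fun x hx => ?_)
    (fun x hx y hy h => ?_) (ih _ hΓ')
  · have key : ∀ I : Finset (Fin n), ∑ k ∈ I, ((x (i.succAbove k) * c⁻¹ : Kˣ) : K) =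
        (∑ k ∈ I, (x (i.succAbove k) : K)) * (c : K)⁻¹ := fun I => by
      simp [Finset.sum_mul]
    refine ⟨fun k => mul_mem (Subgroup.mem_sup_left (hx.1.1 _)) (Subgroup.mem_sup_right
      (inv_mem (Subgroup.mem_zpowers c))), ?_, fun I hI => ?_⟩
    · rw [key, ← div_eq_mul_inv, div_eq_one_iff_eq c.ne_zero, hc, ← hx.1.2.1,
        Fin.sum_univ_succAbove _ i, hx.2]
      ring
    · rw [key]
      refine mul_ne_zero ?_ (inv_ne_zero c.ne_zero)
      have := hx.1.2.2 (I.map i.succAboveEmb) (hI.map)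
      rwa [Finset.sum_map] at this
  · funext k
    by_cases hk : k = i
    · rw [hk, hx.2, hy.2]
    · obtain ⟨k', rfl⟩ := Fin.exists_succAbove_eq hk
      exact mul_right_cancel (congrFun h k')

/-- A ring homomorphism sends some coordinate of a nondegenerate solution to a coordinate of a
nondegenerate solution. -/
theorem exists_mem_unitSolutions_of_sum_eq_one {L : Type*} [Field L] {Γ : Subgroup Lˣ} {n : ℕ}
    {x : Fin n → Lˣ} (hx : ∀ i, x i ∈ Γ) (hsum : ∑ i, (x i : L) = 1) :
    ∃ i, ∃ m ≤ n, ∃ y ∈ unitSolutions Γ m, x i ∈ Set.range y := by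
  classical
  have hex : (Finset.univ.filter fun I : Finset (Fin n) => ∑ i ∈ I, (x i : L) = 1).Nonempty :=
    ⟨Finset.univ, by simpa using hsum⟩
  obtain ⟨I, hI, hmin⟩ := Finset.exists_min_image _ Finset.card hex
  have hI1 : ∑ i ∈ I, (x i : L) = 1 := (Finset.mem_filter.1 hI).2
  have hne : I.Nonempty := by
    rw [Finset.nonempty_iff_ne_empty]
    rintro rfl
    simp at hI1
  obtain ⟨i, hi⟩ := hne
  let f : Fin I.card ≃ I := I.equivFin.symm
  refine ⟨i, I.card, (Finset.card_le_univ I).trans (by simp), fun k => x (f k),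
    ⟨fun k => hx _, ?_, fun J hJ h0 => ?_⟩, f.symm ⟨i, hi⟩, by simp⟩
  · rw [Equiv.sum_comp f fun k => (x k : L), ← hI1]
    exact Finset.sum_coe_sort I fun k => (x k : L)
  · let J' : Finset (Fin n) := J.map (f.toEmbedding.trans (Function.Embedding.subtype _))
    have hsub : J' ⊆ I := fun k hk => by
      obtain ⟨k', _, rfl⟩ := Finset.mem_map.1 hk
      exact (f k').2
    have hJ0 : ∑ k ∈ J', (x k : L) = 0 := by
      rw [Finset.sum_map]
      exact h0
    have h1 : ∑ k ∈ I \ J', (x k : L) = 1 := by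
      rw [← hI1, ← Finset.sum_sdiff hsub, hJ0, add_zero]
    have h2 := hmin _ (Finset.mem_filter.2 ⟨Finset.mem_univ _, h1⟩)
    have h3 := Finset.card_sdiff_of_subset hsub
    have h4 := Finset.card_le_card hsub
    have h5 : 0 < J'.card := by
      rw [Finset.card_map]
      exact hJ.card_pos
    omega

open NumberField

/-- The order of a root of unity in a field of degree at most `D` divides `(2 * D)!`. -/
theorem IsOfFinOrder.pow_factorial_eq_one {L : Type*} [Field L] [Algebra ℚ L]
    [FiniteDimensional ℚ L] {D : ℕ} (hD : Module.finrank ℚ L ≤ D) {x : L} (hx : IsOfFinOrder x) :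
    x ^ (2 * D).factorial = 1 := by
  have : CharZero L := algebraRat.charZero L
  refine orderOf_dvd_iff_pow_eq_one.1 ((Nat.dvd_iff_prime_pow_dvd_dvd _ _).2 fun p k hp hpk => ?_)
  have hpos := hx.orderOf_pos
  have h1 : (orderOf x).totient ≤ D := by
    have h2 := Polynomial.cyclotomic_eq_minpoly_rat (IsPrimitiveRoot.orderOf x) hpos
    rw [← Polynomial.natDegree_cyclotomic (orderOf x) ℚ, h2]
    convert! (minpoly.natDegree_le x).trans hD
    exact Subsingleton.elim _ _
  rcases Nat.eq_zero_or_pos k with rfl | hk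
  · simp
  have h3 := (Nat.le_of_dvd (Nat.totient_pos.2 hpos) (Nat.totient_dvd_of_dvd hpk)).trans h1
  rw [Nat.totient_prime_pow hp hk] at h3
  refine Nat.dvd_factorial (pow_pos hp.pos k) (le_trans ?_ (Nat.mul_le_mul_left 2 h3))
  obtain ⟨k, rfl⟩ := Nat.exists_eq_succ_of_ne_zero hk.ne'
  have h4 : p ≤ 2 * (p - 1) := by have := hp.two_le; omega
  calc p ^ (k + 1) = p ^ k * p := pow_succ _ _
    _ ≤ p ^ k * (2 * (p - 1)) := Nat.mul_le_mul_left _ h4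
    _ = 2 * (p ^ (k + 1 - 1) * (p - 1)) := by rw [Nat.add_sub_cancel]; ring

/-- Nonzero elements of a finitely generated domain over the rational numbers remain nonzero under
some homomorphism to a number field in which the orders of the roots of unity are bounded. -/
theorem exists_specialization {B : Type*} [CommRing B] [IsDomain B] [Algebra ℚ B]
    [Algebra.FiniteType ℚ B] : ∃ M > 0, ∀ b : B, b ≠ 0 →
      ∃ P : Ideal B, ∃ _ : P.IsMaximal, b ∉ P ∧ FiniteDimensional ℚ (B ⧸ P) ∧
        ∀ x : B ⧸ P, IsOfFinOrder x → x ^ M = 1 := by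
  obtain ⟨s, g, hg, hfin⟩ := exists_finite_inj_algHom_of_fg ℚ B
  let _ : Algebra (MvPolynomial (Fin s) ℚ) B := g.toRingHom.toAlgebra
  have hgalg : ∀ p, algebraMap (MvPolynomial (Fin s) ℚ) B p = g p := fun p => rfl
  have : Module.Finite (MvPolynomial (Fin s) ℚ) B := hfin
  obtain ⟨D, β, hβ⟩ := Module.Finite.exists_fin (R := MvPolynomial (Fin s) ℚ) (M := B)
  refine ⟨(2 * D).factorial, Nat.factorial_pos _, fun b hb => ?_⟩
  obtain ⟨p, hp, hp0⟩ := (Submodule.ne_bot_iff _).1 (Ideal.comap_ne_bot_of_integral_mem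
    (R := MvPolynomial (Fin s) ℚ) hb (Ideal.mem_span_singleton_self b)
    (Algebra.IsIntegral.isIntegral b))
  obtain ⟨t, ht⟩ : ∃ t : Fin s → ℚ, MvPolynomial.eval t p ≠ 0 := by
    by_contra! hcon
    exact hp0 (MvPolynomial.funext fun t => by rw [hcon t, map_zero])
  have hsurj : Function.Surjective (MvPolynomial.eval t) := fun q => ⟨MvPolynomial.C q, by simp⟩
  have hmax : (RingHom.ker (MvPolynomial.eval t)).IsMaximal :=
    RingHom.ker_isMaximal_of_surjective _ hsurj
  obtain ⟨P, hP, hPm⟩ := Ideal.exists_ideal_over_maximal_of_isIntegral (S := B)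
    (RingHom.ker (MvPolynomial.eval t)) (by
      rw [(RingHom.injective_iff_ker_eq_bot _).1 (show Function.Injective
        (algebraMap (MvPolynomial (Fin s) ℚ) B) from hg)]
      exact bot_le)
  have hbP : b ∉ P := fun hbP => by
    have h1 : p ∈ P.comap (algebraMap (MvPolynomial (Fin s) ℚ) B) :=
      (Ideal.span_singleton_le_iff_mem P).2 hbP hp
    rw [hPm] at h1
    exact ht h1
  have hred : ∀ q : MvPolynomial (Fin s) ℚ,
      Ideal.Quotient.mk P (g q) = algebraMap ℚ (B ⧸ P) (MvPolynomial.eval t q) := by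
    intro q
    have h1 : q - MvPolynomial.C (MvPolynomial.eval t q) ∈
        P.comap (algebraMap (MvPolynomial (Fin s) ℚ) B) := by
      rw [hPm, RingHom.mem_ker]
      simp
    rw [Ideal.mem_comap, hgalg, map_sub, ← Ideal.Quotient.eq_zero_iff_mem, map_sub,
      sub_eq_zero] at h1
    rw [h1, ← MvPolynomial.algebraMap_eq, AlgHom.commutes]
    rfl
  have hspan : Submodule.span ℚ (Set.range fun i => Ideal.Quotient.mk P (β i)) = ⊤ := by
    refine eq_top_iff.2 fun x _ => ?_
    obtain ⟨y, rfl⟩ := Ideal.Quotient.mk_surjective x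
    have hy : y ∈ Submodule.span (MvPolynomial (Fin s) ℚ) (Set.range β) := hβ ▸ Submodule.mem_top
    obtain ⟨c, rfl⟩ := (Submodule.mem_span_range_iff_exists_fun _).1 hy
    rw [map_sum]
    refine Submodule.sum_mem _ fun i _ => ?_
    rw [Algebra.smul_def, hgalg, map_mul, hred, ← Algebra.smul_def]
    exact Submodule.smul_mem _ _ (Submodule.subset_span ⟨i, rfl⟩)
  have hfd : FiniteDimensional ℚ (B ⧸ P) := ⟨⟨Set.finite_range _ |>.toFinset, by simpa using hspan⟩⟩
  refine ⟨P, hP, hbP, hfd, fun x hx => ?_⟩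
  let _ : Field (B ⧸ P) := Ideal.Quotient.field P
  refine IsOfFinOrder.pow_factorial_eq_one ?_ hx
  have h1 := finrank_range_le_card (R := ℚ) fun i => Ideal.Quotient.mk P (β i)
  rw [Set.finrank, hspan, finrank_top, Fintype.card_fin] at h1
  exact h1

open NumberField

theorem finrank_inf_ker_lt {V W : Type*} [AddCommGroup V] [AddCommGroup W] [Module.Finite ℤ V]
    (f : V →ₗ[ℤ] W) (Δ : Submodule ℤ V) {γ : V} (hγ : γ ∈ Δ) (hf : ¬ IsOfFinAddOrder (f γ)) :
    Module.finrank ℤ ↥(Δ ⊓ LinearMap.ker f) < Module.finrank ℤ Δ := by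
  have h1 := (LinearMap.ker (f.domRestrict Δ)).finrank_quotient_add_finrank
  rw [(f.domRestrict Δ).quotKerEquivRange.finrank_eq] at h1
  have h2 : Module.finrank ℤ (LinearMap.ker (f.domRestrict Δ)) =
      Module.finrank ℤ ↥(Δ ⊓ LinearMap.ker f) := by
    have h := (Submodule.comapSubtypeEquivOfLe
      (inf_le_left : Δ ⊓ LinearMap.ker f ≤ Δ)).finrank_eq
    rwa [Submodule.comap_inf, Submodule.comap_subtype_self, top_inf_eq,
      ← LinearMap.ker_domRestrict] at h
  have h3 : LinearIndependent ℤ fun _ : Unit =>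
      (⟨f γ, ⟨γ, hγ⟩, rfl⟩ : LinearMap.range (f.domRestrict Δ)) := by
    rw [Fintype.linearIndependent_iff]
    intro g hg i
    by_contra hi
    refine hf (isOfFinAddOrder_iff_zsmul_eq_zero.2 ⟨g i, hi, ?_⟩)
    simpa using congrArg Subtype.val hg
  have h4 := h3.fintype_card_le_finrank
  rw [Fintype.card_unit] at h4
  omega

theorem NumberField.of_finiteDimensional (L : Type*) [Field L] [Algebra ℚ L]
    [FiniteDimensional ℚ L] : NumberField L := by
  have : CharZero L := algebraRat.charZero L
  refine { to_finiteDimensional := ?_ }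
  convert! ‹FiniteDimensional ℚ L›
  exact Subsingleton.elim _ _

/-- A finitely generated group of units of a field of characteristic zero maps to a number field
compatibly with unit equations and without sending given elements of infinite order to torsion. -/
theorem exists_monoidHom_numberField.{u, v} {K : Type u} [Field K] [CharZero K] {Γ : Subgroup Kˣ}
    (hΓ : Γ.FG) {ι : Type v} [Finite ι] (γ : ι → Γ) (hγ : ∀ i, ¬ IsOfFinOrder (γ i)) :
    ∃ (L : Type u) (_ : Field L) (_ : NumberField L) (ψ : Γ →* Lˣ),
      (∀ i, ¬ IsOfFinOrder (ψ (γ i))) ∧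
      ∀ (n : ℕ) (x : Fin n → Γ), ∑ i, ((x i : Kˣ) : K) = 1 → ∑ i, (ψ (x i) : L) = 1 := by
  classical
  cases nonempty_fintype ι
  obtain ⟨s, rfl⟩ := hΓ
  obtain ⟨T, hT⟩ : ∃ T : Set K, T = Units.val '' (s : Set Kˣ) ∪ (fun u : Kˣ => ((u⁻¹ : Kˣ) : K)) '' (s : Set Kˣ) :=
    ⟨_, rfl⟩
  have hTfin : T.Finite := hT ▸ (s.finite_toSet.image _).union (s.finite_toSet.image _)
  obtain ⟨B, hB⟩ : ∃ B : Subalgebra ℚ K, B = Algebra.adjoin ℚ T := ⟨_, rfl⟩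
  have hBfg : Algebra.FiniteType ℚ B :=
    B.fg_iff_finiteType.1 ⟨hTfin.toFinset, by rw [hTfin.coe_toFinset, hB]⟩
  have hmem : ∀ u ∈ Subgroup.closure (s : Set Kˣ), (u : K) ∈ B := by
    intro u hu
    refine Subgroup.closure_induction'' (p := fun (u : Kˣ) _ => (u : K) ∈ B) ?_ ?_ ?_ ?_ hu
    · intro v hv
      exact hB ▸ Algebra.subset_adjoin (hT ▸ Or.inl ⟨v, hv, rfl⟩)
    · intro v hv
      exact hB ▸ Algebra.subset_adjoin (hT ▸ Or.inr ⟨v, hv, rfl⟩)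
    · exact B.one_mem
    · intro v w _ _ hv hw
      exact Units.val_mul v w ▸ B.mul_mem hv hw
  obtain ⟨f, hf⟩ : ∃ f : Subgroup.closure (s : Set Kˣ) →* B, ∀ u, (f u : K) = ((u : Kˣ) : K) :=
    ⟨{ toFun := fun u => ⟨((u : Kˣ) : K), hmem u u.2⟩
       map_one' := rfl
       map_mul' := fun _ _ => rfl }, fun _ => rfl⟩
  obtain ⟨M, hM, hspec⟩ := exists_specialization (B := B)
  have hb : ∏ i, (f (γ i) ^ M - 1) ≠ 0 := by
    refine Finset.prod_ne_zero_iff.2 fun i _ h => hγ i (isOfFinOrder_iff_pow_eq_one.2 ⟨M, hM, ?_⟩)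
    have h1 := congrArg Subtype.val (sub_eq_zero.1 h)
    refine Subtype.ext (Units.ext ?_)
    simpa [hf] using h1
  obtain ⟨P, hP, hbP, hfd, hord⟩ := hspec _ hb
  let _ : Field (B ⧸ P) := Ideal.Quotient.field P
  have hnf : NumberField (B ⧸ P) := .of_finiteDimensional _
  obtain ⟨ψ, hψ⟩ : ∃ ψ : Subgroup.closure (s : Set Kˣ) →* (B ⧸ P)ˣ,
      ∀ u, (ψ u : B ⧸ P) = Ideal.Quotient.mk P (f u) :=
    ⟨((Ideal.Quotient.mk P : B →* B ⧸ P).comp f).toHomUnits, fun _ => rfl⟩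
  refine ⟨B ⧸ P, inferInstance, hnf, ψ, fun i hi => hbP ?_, fun n x hx => ?_⟩
  · have h1 := hord _ ((Units.coeHom (B ⧸ P)).isOfFinOrder hi)
    rw [Units.coeHom_apply, hψ, ← map_pow, ← sub_eq_zero, ← map_one (Ideal.Quotient.mk P),
      ← map_sub, Ideal.Quotient.eq_zero_iff_mem] at h1
    exact Ideal.mem_of_dvd _ (Finset.dvd_prod_of_mem _ (Finset.mem_univ i)) h1
  · have h1 : ∑ i, f (x i) = 1 := Subtype.ext (by simpa [hf] using hx)
    simp_rw [hψ]
    rw [← map_sum, h1, map_one]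

/-- The unit equation in `n + 1` variables has finitely many nondegenerate solutions whose
coordinates lie in prescribed cosets, provided the unit equation in `n` variables does. -/
theorem finite_unitSolutions_of_mem_cosets {K : Type*} [Field K] [CharZero K] {n : ℕ}
    (ih : ∀ Γ : Subgroup Kˣ, Γ.FG → (unitSolutions Γ n).Finite) {Γ : Subgroup Kˣ} (hΓ : Γ.FG)
    (Δ : Fin (n + 1) → Submodule ℤ (Additive Γ)) (y : Fin (n + 1) → Additive Γ) :
    {x ∈ unitSolutions Γ (n + 1) |
      ∀ i, ∃ d ∈ Δ i, x i = (((y i + d).toMul : Γ) : Kˣ)}.Finite := by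
  classical
  have hfg : Group.FG Γ := (Group.fg_iff_subgroup_fg Γ).2 hΓ
  have hmod : Module.Finite ℤ (Additive Γ) := Module.Finite.iff_addGroup_fg.2 inferInstance
  obtain ⟨N, hN⟩ : ∃ N, N = ∑ i, Module.finrank ℤ (Δ i) := ⟨_, rfl⟩
  induction N using Nat.strong_induction_on generalizing Δ y with
  | _ N hrec =>
  by_cases htor : ∃ i, ∀ d ∈ Δ i, IsOfFinAddOrder d
  · obtain ⟨i, hi⟩ := htor
    have hfin : Finite (Δ i) := by
      have h1 : AddGroup.FG (Δ i) := Module.Finite.iff_addGroup_fg.1 inferInstance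
      exact AddCommGroup.finite_of_fg_isAddTorsion _ fun d =>
        AddSubmonoid.isOfFinAddOrder_coe (H := (Δ i).toAddSubmonoid) |>.1 (hi d d.2)
    refine (finite_unitSolutions_of_finite_apply ih hΓ i (Set.finite_range fun d : Δ i =>
      (((y i + (d : Additive Γ)).toMul : Γ) : Kˣ))).subset ?_
    rintro x ⟨hx, hx'⟩
    obtain ⟨d, hd, h⟩ := hx' i
    exact ⟨hx, ⟨d, hd⟩, h.symm⟩
  push Not at htor
  choose γ hγ hγt using htor
  obtain ⟨L, _, _, ψ, hψ, hsum⟩ := exists_monoidHom_numberField hΓ (fun i => (γ i).toMul)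
    fun i hi => hγt i ((isOfFinAddOrder_ofMul_iff (x := (γ i).toMul)).2 hi)
  have hfgψ : ψ.range.FG := (Group.fg_iff_subgroup_fg _).1 inferInstance
  obtain ⟨Z, hZ⟩ : ∃ Z : Set Lˣ,
      Z = ⋃ m ∈ Set.Iic (n + 1), ⋃ z ∈ unitSolutions ψ.range m, Set.range z := ⟨_, rfl⟩
  have hZfin : Z.Finite := hZ ▸ (Set.finite_Iic _).biUnion fun m _ =>
    (finite_unitSolutions_of_numberField hfgψ m).biUnion fun z _ => Set.finite_range z
  obtain ⟨f, hf⟩ : ∃ f : Additive Γ →ₗ[ℤ] Additive Lˣ, ∀ g, f g = Additive.ofMul (ψ g.toMul) :=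
    ⟨(MonoidHom.toAdditive ψ).toIntLinearMap, fun _ => rfl⟩
  have hpiece : ∀ (i : Fin (n + 1)) (z : Lˣ), {x ∈ {x ∈ unitSolutions Γ (n + 1) |
      ∀ i, ∃ d ∈ Δ i, x i = (((y i + d).toMul : Γ) : Kˣ)} |
        ∃ d ∈ Δ i, x i = (((y i + d).toMul : Γ) : Kˣ) ∧ ψ (y i + d).toMul = z}.Finite := by
    intro i z
    by_cases h : ∃ d ∈ Δ i, ψ (y i + d).toMul = z
    swap
    · exact Set.finite_empty.subset fun x ⟨_, d, hd, _, hz⟩ => (h ⟨d, hd, hz⟩).elim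
    obtain ⟨d₀, hd₀, hz₀⟩ := h
    have hlt : ∑ j, Module.finrank ℤ (Function.update Δ i (Δ i ⊓ LinearMap.ker f) j) < N := by
      rw [hN]
      refine Finset.sum_lt_sum (fun j _ => ?_) ⟨i, Finset.mem_univ i, ?_⟩
      · obtain rfl | hj := eq_or_ne j i
        · rw [Function.update_self]
          exact Submodule.finrank_mono inf_le_left
        · rw [Function.update_of_ne hj]
      · rw [Function.update_self]
        refine finrank_inf_ker_lt f _ (hγ i) fun h => hψ i ?_
        rw [hf] at h
        exact isOfFinAddOrder_ofMul_iff.1 h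
    refine (hrec _ hlt _ (Function.update y i (y i + d₀)) rfl).subset ?_
    rintro x ⟨⟨hx, hx'⟩, d, hd, hxd, hz⟩
    refine ⟨hx, fun j => ?_⟩
    obtain rfl | hj := eq_or_ne j i
    · rw [Function.update_self, Function.update_self]
      refine ⟨d - d₀, ⟨sub_mem hd hd₀, ?_⟩, by rw [hxd]; congr 2; abel⟩
      rw [SetLike.mem_coe, LinearMap.mem_ker, ← add_sub_add_left_eq_sub d d₀ (y j), map_sub, hf, hf, hz, hz₀,
        sub_self]
    · rw [Function.update_of_ne hj, Function.update_of_ne hj]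
      exact hx' j
  refine ((Set.finite_univ (α := Fin (n + 1))).biUnion fun i _ =>
    hZfin.biUnion fun z _ => hpiece i z).subset ?_
  rintro x ⟨hx, hx'⟩
  choose d hd hxd using hx'
  have h1 := hsum (n + 1) (fun i => (y i + d i).toMul) (by simpa only [← hxd] using hx.2.1)
  obtain ⟨i, m, hm, w, hw, hiw⟩ := exists_mem_unitSolutions_of_sum_eq_one (Γ := ψ.range)
    (fun i => ⟨_, rfl⟩) h1
  refine Set.mem_biUnion (Set.mem_univ i) (Set.mem_biUnion (x := ψ (y i + d i).toMul) ?_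
    ⟨⟨hx, fun j => ⟨d j, hd j, hxd j⟩⟩, d i, hd i, hxd i, rfl⟩)
  rw [hZ]
  exact Set.mem_biUnion hm (Set.mem_biUnion hw hiw)

/-- The unit equation over a field of characteristic zero has finitely many nondegenerate
solutions in a finitely generated group. -/
theorem finite_unitSolutions {K : Type*} [Field K] [CharZero K] (n : ℕ) (Γ : Subgroup Kˣ)
    (hΓ : Γ.FG) : (unitSolutions Γ n).Finite := by
  induction n generalizing Γ with
  | zero => exact Set.toFinite _
  | succ n ih =>
    refine (finite_unitSolutions_of_mem_cosets ih hΓ (fun _ => ⊤) 0).subset fun x hx =>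
      ⟨hx, fun i => ⟨Additive.ofMul ⟨x i, hx.1 i⟩, Submodule.mem_top, ?_⟩⟩
    simp

/-- The S-unit theorem of Evertse–Schlickewei–Schmidt: over a field `K` of
characteristic zero, for nonzero `a₁, …, aₙ ∈ K` and a finitely generated
subgroup `H ≤ (K*)ⁿ`, the equation `a₁x₁ + ⋯ + aₙxₙ = 1` has only finitely
many non-degenerate solutions `(x₁, …, xₙ) ∈ H`. -/
theorem sunit_finiteness
    (K : Type*) [Field K] [CharZero K] (n : ℕ) (hn : 1 ≤ n)
    (a : Fin n → K) (ha : ∀ i, a i ≠ 0)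
    (H : Subgroup (Fin n → Kˣ)) (hH : H.FG) :
    { x : Fin n → Kˣ | x ∈ H ∧ (∑ i, a i * (x i : K)) = 1 ∧
        ∀ I : Finset (Fin n), I.Nonempty → ∑ i ∈ I, a i * (x i : K) ≠ 0 }.Finite := by
  obtain ⟨Γ, hΓ⟩ : ∃ Γ : Subgroup Kˣ, Γ = ⨆ i : Fin n,
      Subgroup.zpowers (Units.mk0 (a i) (ha i)) ⊔ H.map (Pi.evalMonoidHom (fun _ => Kˣ) i) :=
    ⟨_, rfl⟩
  have hle : ∀ i, Subgroup.zpowers (Units.mk0 (a i) (ha i)) ⊔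
      H.map (Pi.evalMonoidHom (fun _ => Kˣ) i) ≤ Γ := fun i => hΓ ▸ le_iSup_of_le i le_rfl
  have hfg : Γ.FG := by
    rw [hΓ]
    refine Subgroup.FG.iSup _ fun i => ?_
    exact Subgroup.FG.sup ⟨{Units.mk0 (a i) (ha i)}, by
      rw [Finset.coe_singleton, Subgroup.zpowers_eq_closure]⟩ ((Subgroup.fg_iff_submonoid_fg _).2
        (((Subgroup.fg_iff_submonoid_fg _).1 hH).map _))
  refine Set.Finite.of_finite_image ((finite_unitSolutions n Γ hfg).subset ?_)
    (f := fun x i => Units.mk0 (a i) (ha i) * x i)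
    fun x _ y _ h => funext fun i => mul_left_cancel (congrFun h i)
  rintro _ ⟨x, ⟨hxH, hsum, hnd⟩, rfl⟩
  refine ⟨fun i => Γ.mul_mem ?_ ?_, by simpa using hsum, fun I hI => by simpa using hnd I hI⟩
  · exact hle i (Subgroup.mem_sup_left (Subgroup.mem_zpowers _))
  · exact hle i (Subgroup.mem_sup_right ⟨x, hxH, rfl⟩)
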